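/- arXiv:2005.10769 — 3 statements merged into one kernel-verified Lean document; each statement's English description precedes it below -/
import Mathlib

section
/- For every n ≥ 0, the number of partitions in 𝒫(n) equals the number of partitions of n all of whose parts are congruent to ±2, ±3, ±4 or ±5 modulo 16 (i.e., congruent to 2, 3, 4, 5, 11, 12, 13 or 14 mod 16). -/
/-- The forbidden partitions of the Ising model basis, as multisets of parts. -/
def Forbidden : Set (Multiset ℕ) :=
  {mu | (∃ p : ℕ, 2 ≤ p ∧
        (mu = {p, p, p} ∨ mu = {p + 1, p, p} ∨ mu = {p + 1, p + 1, p} ∨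
         mu = {p + 2, p + 1, p} ∨ mu = {p + 2, p + 2, p} ∨
         mu = {p + 3, p + 3, p, p} ∨ mu = {p + 4, p + 3, p, p} ∨
         mu = {p + 4, p + 3, p + 1, p} ∨ mu = {p + 4, p + 4, p + 1, p} ∨
         mu = {p + 6, p + 5, p + 3, p + 1, p})) ∨
      (∃ p : ℕ, 3 ≤ p ∧ mu = {p + 2, p, p}) ∨
      mu = {5, 4, 2, 2} ∨ mu = {7, 6, 4, 2, 2} ∨ mu = {7, 7, 4, 2, 2} ∨
      mu = {9, 8, 6, 4, 2, 2}}

/-- Membership in `𝒫(n)`: all parts are `≥ 2` and the partition avoids every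
forbidden partition (`λ` avoids `μ` iff the multiset of parts of `μ` is not a
sub-multiset of the multiset of parts of `λ`). -/
def MemP {n : ℕ} (l : n.Partition) : Prop :=
  (∀ i ∈ l.parts, 2 ≤ i) ∧ ∀ mu ∈ Forbidden, ¬ mu ≤ l.parts


namespace Ising
variable {R : Type*} [CommRing R]

/-- Finite sums of trinomial type, defined through a Pascal-type recursion. -/
def Z (y : R) : ℕ → ℕ → ℕ → R
  | 0, _, _ => 1
  | 1, _, j => 1 + y ^ (1 + j)
  | n + 2, i, j => y ^ (1 + j) * Z y (n + 1) (i + 6) (j + 2) + Z y (n + 1) (i + 4) (j + 2)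
      + y ^ (6 * n + 6 + i) * Z y n (i + 4) (j + 2)

theorem Z_cab (y : R) (n i j : ℕ) : Z y (n + 2) i j =
    y ^ (1 + j) * Z y (n + 1) (i + 6) (j + 2) + Z y (n + 1) (i + 4) (j + 2)
      + y ^ (6 * n + 6 + i) * Z y n (i + 4) (j + 2) := by
  rw [Z]

theorem Z_abc (y : R) : ∀ n i j : ℕ, Z y (n + 2) i j =
    (1 + y ^ (2 * n + 3 + j)) * Z y (n + 1) (i + 4) j + y ^ (6 * n + 6 + i) * Z y n (i + 4) j
  | 0, i, j => by simp [Z]; ring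
  | 1, i, j => by simp [Z]; ring
  | n + 2, i, j => by
    have h1 := Z_abc y (n + 1) (i + 4) (j + 2)
    have h2 := Z_abc y (n + 1) (i + 6) (j + 2)
    have h3 := Z_abc y n (i + 4) (j + 2)
    have e0 := Z_cab y (n + 2) i j
    have e1 := Z_cab y (n + 1) (i + 4) j
    have e2 := Z_cab y n (i + 4) j
    simp only [add_assoc, Nat.reduceAdd] at *
    linear_combination h1 + y ^ (1 + j) * h2 + y ^ (6 * n + 18 + i) * h3 + e0
      - (1 + y ^ (2 * n + 7 + j)) * e1 - y ^ (6 * n + 18 + i) * e2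

theorem Z_b (y : R) : ∀ n i j : ℕ, Z y (n + 2) i j - Z y (n + 2) (i + 2) j =
    y ^ (4 * n + 6 + i) * (Z y n (i + 8) (j + 2) - y ^ (2 * n + 2) * Z y n (i + 6) (j + 2))
  | 0, i, j => by simp [Z]; ring
  | 1, i, j => by simp [Z]; ring
  | n + 2, i, j => by
    have h1 := Z_b y (n + 1) (i + 4) (j + 2)
    have h2 := Z_b y (n + 1) (i + 6) (j + 2)
    have h3 := Z_b y n (i + 4) (j + 2)
    have e0 := Z_cab y (n + 2) i j
    have e1 := Z_cab y (n + 2) (i + 2) j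
    have e2 := Z_cab y n (i + 6) (j + 2)
    have e3 := Z_cab y n (i + 8) (j + 2)
    simp only [add_assoc, Nat.reduceAdd] at *
    linear_combination h1 + y ^ (1 + j) * h2 + y ^ (6 * n + 18 + i) * h3 + e0 - e1
      + y ^ (6 * n + 18 + i) * e2 - y ^ (4 * n + 14 + i) * e3

/-- The odd/even generating sums. -/
def E (y : R) : ℕ → R
  | 0 => 1
  | n + 1 => Z y (n + 1) 4 0 + y ^ (2 * n + 3) * Z y n 8 2

theorem E_rec4 (y : R) (n : ℕ) : E y (n + 4) =
    (1 + y ^ (2 * n + 8) - y ^ (4 * n + 14)) * E y (n + 3)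
    + (y ^ (6 * n + 18) + y ^ (6 * n + 20) + y ^ (8 * n + 26)) * E y (n + 2)
    + y ^ (12 * n + 32) * E y (n + 1) := by
  have a0 := Z_abc y (n + 2) 0 0
  have a1 := Z_abc y (n + 1) 0 0
  have a2 := Z_abc y (n + 1) 4 2
  have a3 := Z_abc y n 4 2
  have b0 := Z_b y (n + 2) 0 0
  have b1 := Z_b y (n + 2) 2 0
  have b2 := Z_b y (n + 1) 0 0
  have c0 := Z_cab y (n + 2) 0 0
  have c1 := Z_cab y (n + 2) 2 0
  have c2 := Z_cab y (n + 1) 2 0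
  have c3 := Z_cab y (n + 1) 4 0
  simp only [E]
  simp only [add_assoc, Nat.reduceAdd, zero_add] at *
  linear_combination (1 - y ^ (2 * n + 7) + y ^ (2 * n + 8)) * a0 + y ^ (6 * n + 20) * a1
    + y ^ (2 * n + 7) * a2 + y ^ (8 * n + 25) * a3 - (1 + y ^ (2 * n + 8)) * b0 - b1
    - y ^ (6 * n + 20) * b2 + y ^ (2 * n + 7) * c0 - y ^ (2 * n + 8) * c1
    - y ^ (6 * n + 20) * c2 + y ^ (4 * n + 15) * c3

theorem E_rec (y : R) (n : ℕ) : E y (n + 3) =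
    (1 + y ^ (2 * n + 6) - y ^ (4 * n + 10)) * E y (n + 2)
    + (y ^ (6 * n + 12) + y ^ (6 * n + 14) + y ^ (8 * n + 18)) * E y (n + 1)
    + y ^ (12 * n + 20) * E y n := by
  cases n with
  | zero => simp [E, Z]; ring
  | succ n => 
    have := E_rec4 y n
    convert this using 4 <;> ring

theorem Z_lim (y : R) (K : ℕ) (hK : y ^ K = 0) : ∀ n i j : ℕ, K + 2 ≤ 4 * n + i →
    Z y n i j = ∏ k ∈ Finset.range n, (1 + y ^ (1 + j + 2 * k))
  | 0, i, j, h => by simp [Z]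
  | 1, i, j, h => by simp [Z]
  | n + 2, i, j, h => by
    rw [Z_cab, Z_lim y K hK (n + 1) (i + 6) (j + 2) (by omega),
      Z_lim y K hK (n + 1) (i + 4) (j + 2) (by omega),
      pow_eq_zero_of_le (by omega : K ≤ 6 * n + 6 + i) hK, Finset.prod_range_succ' _ (n + 1)]
    have : ∀ k, 1 + (j + 2) + 2 * k = 1 + j + 2 * (k + 1) := fun k => by ring
    simp only [this, mul_zero, add_zero]
    ring

theorem E_lim (y : R) (K : ℕ) (hK : y ^ K = 0) (n : ℕ) (h : K ≤ n) :
    E y (n + 1) = ∏ k ∈ Finset.range (n + 1), (1 + y ^ (1 + 2 * k)) := by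
  rw [E, Z_lim y K hK (n + 1) 4 0 (by omega),
    pow_eq_zero_of_le (by omega : K ≤ 2 * n + 3) hK]
  simp

/-- The continuants of the q-difference equation. -/
def D (q : R) : ℕ → R
  | 0 => 1
  | 1 => 1
  | 2 => 1 + q ^ 2 + q ^ 4 + q ^ 5
  | n + 3 => (1 + q ^ (n + 3) - q ^ (2 * n + 5)) * D q (n + 2)
    + (q ^ (3 * n + 6) + q ^ (3 * n + 7) + q ^ (4 * n + 9)) * D q (n + 1)
    + q ^ (6 * n + 10) * D q n

theorem D_E (y : R) : ∀ n, 2 * D (y ^ 2) n = E y n + E (-y) n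
  | 0 => by simp [D, E]; norm_num
  | 1 => by simp [D, E, Z]; ring
  | 2 => by simp [D, E, Z]; ring
  | n + 3 => by
    have h0 := D_E y n
    have h1 := D_E y (n + 1)
    have h2 := D_E y (n + 2)
    have e : ∀ k, (-y) ^ (2 * k) = y ^ (2 * k) := fun k => by rw [pow_mul, pow_mul, neg_sq]
    have r1 := E_rec y n
    have r2 := E_rec (-y) n
    have k1 := e (n + 3); have k2 := e (2 * n + 5); have k3 := e (3 * n + 6)
    have k4 := e (3 * n + 7); have k5 := e (4 * n + 9); have k6 := e (6 * n + 10)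
    have c1 : 2 * n + 6 = 2 * (n + 3) := by ring
    have c2 : 4 * n + 10 = 2 * (2 * n + 5) := by ring
    have c3 : 6 * n + 12 = 2 * (3 * n + 6) := by ring
    have c4 : 6 * n + 14 = 2 * (3 * n + 7) := by ring
    have c5 : 8 * n + 18 = 2 * (4 * n + 9) := by ring
    have c6 : 12 * n + 20 = 2 * (6 * n + 10) := by ring
    rw [c1, c2, c3, c4, c5, c6] at r1 r2
    rw [k1, k2, k3, k4, k5, k6] at r2
    rw [r1, r2, D]
    simp only [← pow_mul]
    linear_combination (1 + y ^ (2 * (n + 3)) - y ^ (2 * (2 * n + 5))) * h2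
      + (y ^ (2 * (3 * n + 6)) + y ^ (2 * (3 * n + 7)) + y ^ (2 * (4 * n + 9))) * h1
      + y ^ (2 * (6 * n + 10)) * h0
end Ising

namespace Ising
variable {R : Type*} [CommRing R]

/-- inverse q-Pochhammer symbols in a ring where `q ^ K = 0` -/
def ip (q : R) (K : ℕ) : ℕ → R
  | 0 => 1
  | k + 1 => ip q K k * ∑ t ∈ Finset.range K, (q ^ (k + 1)) ^ t

theorem ip_succ (q : R) (K : ℕ) (hK : q ^ K = 0) (k : ℕ) :
    (1 - q ^ (k + 1)) * ip q K (k + 1) = ip q K k := by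
  have h := mul_neg_geom_sum (q ^ (k + 1)) K
  rw [← pow_mul, mul_comm (k + 1) K, pow_mul, hK, zero_pow (by omega)] at h
  rw [ip]
  linear_combination ip q K k * h

/-- summand of the double series -/
def at' (q : R) (K i j k l : ℕ) : R :=
  q ^ (4 * k * k + 3 * k * l + l * l + i * k + j * l) * (ip q K k * ip q K l)

/-- the double series -/
def a (q : R) (K i j : ℕ) : R :=
  ∑ k ∈ Finset.range K, ∑ l ∈ Finset.range K, at' q K i j k l

theorem sum_shift (f : ℕ → R) (K : ℕ) (h0 : f 0 = 0) (hK : f K = 0) :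
    ∑ k ∈ Finset.range K, f k = ∑ k ∈ Finset.range K, f (k + 1) := by
  have h1 := Finset.sum_range_succ f K
  have h2 := Finset.sum_range_succ' f K
  rw [hK] at h1
  rw [h0] at h2
  rw [add_zero] at h1 h2
  rw [← h1, h2]

theorem a_R1 (q : R) (K : ℕ) (hK : q ^ K = 0) (i j : ℕ) :
    a q K i j - a q K (i + 1) j = q ^ (4 + i) * a q K (i + 8) (j + 3) := by
  unfold a
  rw [← Finset.sum_sub_distrib, sum_shift, Finset.mul_sum]
  · refine Finset.sum_congr rfl fun k _ => ?_
    rw [← Finset.sum_sub_distrib, Finset.mul_sum]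
    refine Finset.sum_congr rfl fun l _ => ?_
    unfold at'
    rw [← ip_succ q K hK k]
    ring
  · simp [at']
  · rw [← Finset.sum_sub_distrib]
    refine Finset.sum_eq_zero fun l _ => ?_
    unfold at'
    rw [pow_eq_zero_of_le (by nlinarith [Nat.le_mul_self K]) hK,
      pow_eq_zero_of_le (by nlinarith [Nat.le_mul_self K]) hK]
    simp

theorem a_R2 (q : R) (K : ℕ) (hK : q ^ K = 0) (i j : ℕ) :
    a q K i j - a q K i (j + 1) = q ^ (1 + j) * a q K (i + 3) (j + 2) := by
  unfold a
  rw [← Finset.sum_sub_distrib, Finset.mul_sum]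
  refine Finset.sum_congr rfl fun k _ => ?_
  rw [← Finset.sum_sub_distrib, sum_shift, Finset.mul_sum]
  · refine Finset.sum_congr rfl fun l _ => ?_
    unfold at'
    rw [← ip_succ q K hK l]
    ring
  · simp [at']
  · unfold at'
    rw [pow_eq_zero_of_le (by nlinarith [Nat.le_mul_self K]) hK,
      pow_eq_zero_of_le (by nlinarith [Nat.le_mul_self K]) hK]
    simp

theorem a_lim (q : R) (K : ℕ) (hK : q ^ K = 0) (i j : ℕ) (hi : K ≤ 4 + i) (hj : K ≤ 1 + j) :
    a q K i j = 1 := by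
  rcases K with _ | K
  · have : (1 : R) = 0 := by simpa using hK
    exact (subsingleton_of_zero_eq_one this.symm).elim _ _
  unfold a
  rw [Finset.sum_range_succ', Finset.sum_range_succ']
  rw [Finset.sum_eq_zero, Finset.sum_eq_zero]
  · simp [at', ip]
  · intro l _
    unfold at'
    rw [pow_eq_zero_of_le (by nlinarith) hK]
    simp
  · intro k _
    refine Finset.sum_eq_zero fun l _ => ?_
    unfold at'
    rw [pow_eq_zero_of_le (by nlinarith [Nat.zero_le (k*l), Nat.zero_le (k * k), Nat.zero_le (j*l), Nat.zero_le (l*l), Nat.zero_le (i*k)]) hK]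
    simp

/-- the deformed main series at `x = q ^ s` -/
def G (q : R) (K s : ℕ) : R := a q K (4 * s) s - q ^ (2 * s + 1) * a q K (4 * s + 4) (s + 2)

theorem G_rec (q : R) (K : ℕ) (hK : q ^ K = 0) (s : ℕ) : G q K s =
    (1 + q ^ (s + 1) - q ^ (2 * s + 1)) * G q K (s + 1)
    + (q ^ (3 * s + 3) + q ^ (3 * s + 4) + q ^ (4 * s + 5)) * G q K (s + 2)
    + q ^ (6 * s + 10) * G q K (s + 3) := by
  have r1 := fun i j => a_R1 q K hK (4 * s + i) (s + j)
  have r2 := fun i j => a_R2 q K hK (4 * s + i) (s + j)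
  have h1 := r2 7 2
  have h2 := r2 9 2
  have h3 := r2 2 0
  have h4 := r1 3 1
  have h5 := r2 8 2
  have h6 := r1 2 1
  have h7 := r1 4 1
  have h8 := r2 4 1
  have h9 := r1 0 0
  have h10 := r1 4 0
  have h11 := r1 1 0
  have h12 := r2 5 0
  have h13 := r2 5 1
  have h14 := r1 8 2
  have h15 := r2 4 0
  clear r1 r2
  have c1 : 4 * (s + 1) = 4 * s + 4 := by ring
  have c2 : 4 * (s + 2) = 4 * s + 8 := by ring
  have c3 : 4 * (s + 3) = 4 * s + 12 := by ring
  unfold G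
  rw [c1, c2, c3]
  simp only [add_assoc, Nat.reduceAdd, add_zero] at *
  linear_combination -q ^ (3 * s + 3) * h1 - q ^ (4 * s + 5) * h2 + h3 + h4 - q ^ (3 * s + 4) * h5
    + h6 - (q ^ (s + 1) + q ^ (2 * s + 2)) * h7 + q ^ (2 * s + 1) * h8 + h9
    + q ^ (2 * s + 2) * h10 + h11 + q ^ (2 * s + 2) * h12 - q ^ (s + 1) * h13
    - q ^ (4 * s + 5) * h14 - q ^ (2 * s + 2) * h15

theorem G_iter (q : R) (K : ℕ) (hK : q ^ K = 0) (n : ℕ) : G q K 0 = D q (n + 2) * G q K (n + 2)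
    + ((q ^ (3 * n + 6) + q ^ (3 * n + 7) + q ^ (4 * n + 9)) * D q (n + 1)
        + q ^ (6 * n + 10) * D q n) * G q K (n + 3)
    + q ^ (6 * n + 16) * D q (n + 1) * G q K (n + 4) := by
  induction n with
  | zero =>
    have h0 := G_rec q K hK 0
    have h1 := G_rec q K hK 1
    simp only [D]
    norm_num at h0 h1 ⊢
    linear_combination h0 + h1
  | succ n ih =>
    have h := G_rec q K hK (n + 2)
    rw [ih]
    simp only [D]
    simp only [add_assoc, Nat.reduceAdd] at *
    linear_combination D q (n + 2) * h

theorem G_zero (q : R) (K : ℕ) (hK : q ^ K = 0) (n : ℕ) (hn : K ≤ n) :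
    G q K 0 = D q (n + 2) := by
  rw [G_iter q K hK n]
  have h : ∀ m, K ≤ m → q ^ m = 0 := fun m hm => pow_eq_zero_of_le hm hK
  rw [h (3 * n + 6) (by omega), h (3 * n + 7) (by omega), h (4 * n + 9) (by omega),
    h (6 * n + 10) (by omega), h (6 * n + 16) (by omega)]
  unfold G
  rw [h _ (by omega), a_lim q K hK _ _ (by omega) (by omega)]
  ring
end Ising

namespace Ising
variable {R : Type*} [CommRing R]

/-- multisets all of whose elements are positive -/
def Pos (A : Set (Multiset ℕ)) : Prop := ∀ m ∈ A, ∀ i ∈ m, 0 < i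

theorem fin_of_pos {A : Set (Multiset ℕ)} (hA : Pos A) (n : ℕ) : {m ∈ A | m.sum = n}.Finite := by
  refine (Set.finite_range (fun p : n.Partition => p.parts)).subset ?_
  rintro m ⟨hm, hs⟩
  exact ⟨⟨m, fun {i} hi => hA m hm i hi, hs⟩, rfl⟩

/-- truncated generating function -/
noncomputable def gf (q : R) (K : ℕ) (A : Set (Multiset ℕ)) : R :=
  ∑ n ∈ Finset.range K, ({m ∈ A | m.sum = n}.ncard : R) * q ^ n

theorem gf_union (q : R) (K : ℕ) {A B : Set (Multiset ℕ)} (hA : Pos A) (hB : Pos B)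
    (h : Disjoint A B) : gf q K (A ∪ B) = gf q K A + gf q K B := by
  unfold gf
  rw [← Finset.sum_add_distrib]
  refine Finset.sum_congr rfl fun n _ => ?_
  have e : {m ∈ A ∪ B | m.sum = n} = {m ∈ A | m.sum = n} ∪ {m ∈ B | m.sum = n} := by
    ext m; simp only [Set.mem_ofPred_eq, Set.mem_union]; tauto
  rw [e, Set.ncard_union_eq ?_ (fin_of_pos hA n) (fin_of_pos hB n)]
  · push_cast; ring
  · exact h.mono (fun m hm => hm.1) (fun m hm => hm.1)

theorem sum_shift_pow (q : R) (K : ℕ) (hK : q ^ K = 0) (c : ℕ → R) (d : ℕ) :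
    ∑ n ∈ Finset.range K, (if d ≤ n then c (n - d) else 0) * q ^ n
      = q ^ d * ∑ n ∈ Finset.range K, c n * q ^ n := by
  have h1 : ∑ n ∈ Finset.range (d + K), (if d ≤ n then c (n - d) else 0) * q ^ n
      = q ^ d * ∑ n ∈ Finset.range K, c n * q ^ n := by
    rw [Finset.sum_range_add, Finset.sum_eq_zero, zero_add, Finset.mul_sum]
    · refine Finset.sum_congr rfl fun n _ => ?_
      rw [if_pos (by omega), Nat.add_sub_cancel_left, pow_add]; ring
    · intro n hn
      rw [Finset.mem_range] at hn
      rw [if_neg (by omega), zero_mul]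
  rw [← h1, add_comm d K, Finset.sum_range_add, eq_comm, add_eq_left]
  refine Finset.sum_eq_zero fun n _ => ?_
  rw [pow_eq_zero_of_le (by omega) hK, mul_zero]

theorem gf_image (q : R) (K : ℕ) (hK : q ^ K = 0) (A : Set (Multiset ℕ)) (c : Multiset ℕ) :
    gf q K ((fun m => c + m) '' A) = q ^ c.sum * gf q K A := by
  unfold gf
  rw [← sum_shift_pow q K hK]
  refine Finset.sum_congr rfl fun n _ => ?_
  congr 1
  split_ifs with h
  · have e : {m ∈ (fun m => c + m) '' A | m.sum = n}
        = (fun m => c + m) '' {m ∈ A | m.sum = n - c.sum} := by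
      ext m
      constructor
      · rintro ⟨⟨m, hm, rfl⟩, hs⟩
        refine ⟨m, ⟨hm, ?_⟩, rfl⟩
        simp only [Multiset.sum_add] at hs; omega
      · rintro ⟨m, ⟨hm, hs⟩, rfl⟩
        refine ⟨⟨m, hm, rfl⟩, ?_⟩
        simp only [Multiset.sum_add]; omega
    rw [e, Set.ncard_image_of_injective _ (add_right_injective c)]
  · have e : {m ∈ (fun m => c + m) '' A | m.sum = n} = ∅ := by
      rw [Set.eq_empty_iff_forall_notMem]
      rintro m ⟨⟨m, hm, rfl⟩, hs⟩
      simp only [Multiset.sum_add] at hs; omega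
    rw [e]; simp

theorem gf_empty (q : R) (K : ℕ) : gf q K ∅ = 0 := by
  unfold gf; simp

theorem gf_one (q : R) (K : ℕ) (hK : q ^ K = 0) (A : Set (Multiset ℕ)) (h0 : 0 ∈ A)
    (h : ∀ m ∈ A, m.sum < K → m = 0) : gf q K A = 1 := by
  rcases K with _ | K
  · have : (1 : R) = 0 := by simpa using hK
    exact (subsingleton_of_zero_eq_one this.symm).elim _ _
  unfold gf
  rw [Finset.sum_range_succ', Finset.sum_eq_zero]
  · have e : {m ∈ A | m.sum = 0} = {0} := by
      ext m
      constructor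
      · rintro ⟨hm, hs⟩
        exact h m hm (by omega)
      · rintro rfl
        exact ⟨h0, by simp⟩
    rw [e]; simp
  · intro n hn
    rw [Finset.mem_range] at hn
    have e : {m ∈ A | m.sum = n + 1} = ∅ := by
      rw [Set.eq_empty_iff_forall_notMem]
      rintro m ⟨hm, hs⟩
      have := h m hm (by omega)
      subst this
      simp at hs
    rw [e]; simp

/-- prepend a value to a sequence -/
def sc (v : ℕ) (g : ℕ → ℕ) : ℕ → ℕ
  | 0 => v
  | k + 1 => g k

/-- the multiplicities of the parts `s, s + 1, …` -/
def mult (s : ℕ) (m : Multiset ℕ) (k : ℕ) : ℕ := m.count (s + k)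

/-- multisets with parts `≥ s` whose sequence of multiplicities satisfies `A` -/
def La (A : (ℕ → ℕ) → Prop) (s : ℕ) : Set (Multiset ℕ) :=
  {m | (∀ i ∈ m, s ≤ i) ∧ A (mult s m)}

theorem La_pos (A : (ℕ → ℕ) → Prop) (s : ℕ) (hs : 0 < s) : Pos (La A s) :=
  fun _ hm i hi => lt_of_lt_of_le hs (hm.1 i hi)

theorem mult_add (s v : ℕ) (m : Multiset ℕ) (hm : ∀ i ∈ m, s + 1 ≤ i) :
    mult s (Multiset.replicate v s + m) = sc v (mult (s + 1) m) := by
  funext k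
  cases k with
  | zero =>
    have : m.count s = 0 := Multiset.count_eq_zero.2 fun h => by have := hm s h; omega
    simp [mult, sc, this]
  | succ k =>
    simp only [mult, sc, Multiset.count_add, Multiset.count_replicate]
    rw [if_neg (by omega), zero_add]
    congr 1; ring

theorem La_decomp (A : (ℕ → ℕ) → Prop) (s : ℕ) (m : Multiset ℕ) : m ∈ La A s ↔
    ∃ v, ∃ m' ∈ La (fun g => A (sc v g)) (s + 1), Multiset.replicate v s + m' = m := by
  constructor
  · rintro ⟨h1, h2⟩
    have e : Multiset.replicate (m.count s) s + m.filter (fun i => i ≠ s) = m := by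
      rw [← Multiset.filter_eq']
      exact Multiset.filter_add_not (fun i => i = s) m
    have hp : ∀ i ∈ m.filter (fun i => i ≠ s), s + 1 ≤ i := by
      intro i hi
      rw [Multiset.mem_filter] at hi
      have := h1 i hi.1
      omega
    refine ⟨m.count s, m.filter (fun i => i ≠ s), ⟨hp, ?_⟩, e⟩
    show A (sc _ (mult (s + 1) _))
    rw [← mult_add s _ _ hp, e]
    exact h2
  · rintro ⟨v, m', ⟨h1, h2⟩, rfl⟩
    refine ⟨?_, ?_⟩
    · intro i hi
      rw [Multiset.mem_add] at hi
      rcases hi with hi | hi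
      · rw [Multiset.eq_of_mem_replicate hi]
      · have := h1 i hi; omega
    · rw [mult_add s _ _ h1]; exact h2

theorem gf_decomp (q : R) (K : ℕ) (hK : q ^ K = 0) (A A0 A1 A2 : (ℕ → ℕ) → Prop) (s : ℕ)
    (hs : 0 < s)
    (h0 : ∀ g, A (sc 0 g) ↔ A0 g) (h1 : ∀ g, A (sc 1 g) ↔ A1 g) (h2 : ∀ g, A (sc 2 g) ↔ A2 g)
    (h3 : ∀ v g, ¬ A (sc (v + 3) g)) :
    gf q K (La A s) = gf q K (La A0 (s + 1)) + q ^ s * gf q K (La A1 (s + 1))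
      + q ^ (2 * s) * gf q K (La A2 (s + 1)) := by
  have e0 : (fun g => A (sc 0 g)) = A0 := funext fun g => propext (h0 g)
  have e1 : (fun g => A (sc 1 g)) = A1 := funext fun g => propext (h1 g)
  have e2 : (fun g => A (sc 2 g)) = A2 := funext fun g => propext (h2 g)
  have key : La A s = (((fun m => Multiset.replicate 0 s + m) '' La A0 (s + 1)) ∪
      ((fun m => Multiset.replicate 1 s + m) '' La A1 (s + 1))) ∪
      ((fun m => Multiset.replicate 2 s + m) '' La A2 (s + 1)) := by
    ext m
    rw [La_decomp, ← e0, ← e1, ← e2]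
    constructor
    · rintro ⟨v, m', hm, rfl⟩
      match v, hm with
      | 0, hm => exact Or.inl (Or.inl ⟨m', hm, rfl⟩)
      | 1, hm => exact Or.inl (Or.inr ⟨m', hm, rfl⟩)
      | 2, hm => exact Or.inr ⟨m', hm, rfl⟩
      | v + 3, hm => exact absurd hm.2 (h3 v _)
    · rintro ((⟨m', hm, rfl⟩ | ⟨m', hm, rfl⟩) | ⟨m', hm, rfl⟩)
      · exact ⟨0, m', hm, rfl⟩
      · exact ⟨1, m', hm, rfl⟩
      · exact ⟨2, m', hm, rfl⟩
  have hpos : ∀ v (B : (ℕ → ℕ) → Prop), Pos ((fun m => Multiset.replicate v s + m) '' La B (s + 1)) := by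
    rintro v B _ ⟨m, hm, rfl⟩ i hi
    rw [Multiset.mem_add] at hi
    rcases hi with hi | hi
    · rw [Multiset.eq_of_mem_replicate hi]; exact hs
    · have := hm.1 i hi; omega
  have hcount : ∀ v (B : (ℕ → ℕ) → Prop), ∀ m ∈ ((fun m => Multiset.replicate v s + m) '' La B (s + 1)),
      m.count s = v := by
    rintro v B _ ⟨m, hm, rfl⟩
    have : m.count s = 0 := Multiset.count_eq_zero.2 fun h => by have := hm.1 s h; omega
    simp [this]
  have hpos' : Pos (((fun m => Multiset.replicate 0 s + m) '' La A0 (s + 1)) ∪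
      ((fun m => Multiset.replicate 1 s + m) '' La A1 (s + 1))) := by
    rintro m (hm | hm)
    · exact hpos _ _ m hm
    · exact hpos _ _ m hm
  rw [key, gf_union q K hpos' (hpos _ _), gf_union q K (hpos _ _) (hpos _ _),
    gf_image q K hK, gf_image q K hK, gf_image q K hK]
  · simp [two_mul]
  · rw [Set.disjoint_left]
    intro m h h'
    have := hcount _ _ m h
    have := hcount _ _ m h'
    omega
  · rw [Set.disjoint_left]
    intro m h h'
    have := hcount _ _ m h'
    rcases h with h | h
    · have := hcount _ _ m h; omega
    · have := hcount _ _ m h; omega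

theorem gf_La_one (q : R) (K : ℕ) (hK : q ^ K = 0) (A : (ℕ → ℕ) → Prop) (s : ℕ) (hs : K ≤ s)
    (hA : A (fun _ => 0)) : gf q K (La A s) = 1 := by
  refine gf_one q K hK _ ⟨by simp, ?_⟩ ?_
  · convert hA using 1
    funext k
    simp [mult]
  · intro m hm hlt
    by_contra hne
    obtain ⟨i, hi⟩ := Multiset.exists_mem_of_ne_zero hne
    have h1 := hm.1 i hi
    have h2 := Multiset.single_le_sum (fun x _ => Nat.zero_le x) i hi
    omega

theorem gf_La_false (q : R) (K : ℕ) (s : ℕ) : gf q K (La (fun _ => False) s) = 0 := by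
  have : La (fun _ => False) s = ∅ := by
    ext m; simp [La]
  rw [this, gf_empty]
end Ising

namespace Ising
variable {R : Type*} [CommRing R]
set_option linter.unusedSimpArgs false

/-- the local condition on seven consecutive multiplicities -/
def loc (a0 a1 a2 a3 a4 a5 a6 : ℕ) : Prop :=
  a0 ≤ 2 ∧ ¬ (2 ≤ a0 ∧ (1 ≤ a1 ∨ 1 ≤ a2)) ∧ ¬ (1 ≤ a0 ∧ (2 ≤ a1 ∨ 2 ≤ a2)) ∧
  ¬ (1 ≤ a0 ∧ 1 ≤ a1 ∧ 1 ≤ a2) ∧ ¬ (2 ≤ a0 ∧ (2 ≤ a3 ∨ (1 ≤ a3 ∧ 1 ≤ a4))) ∧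
  ¬ (1 ≤ a0 ∧ 1 ≤ a1 ∧ ((1 ≤ a3 ∧ 1 ≤ a4) ∨ 2 ≤ a4)) ∧
  ¬ (1 ≤ a0 ∧ 1 ≤ a1 ∧ 1 ≤ a3 ∧ 1 ≤ a5 ∧ 1 ≤ a6)

/-- the multiplicity sequences satisfying all the local conditions -/
def Ok (g : ℕ → ℕ) : Prop :=
  ∀ k, loc (g k) (g (k + 1)) (g (k + 2)) (g (k + 3)) (g (k + 4)) (g (k + 5)) (g (k + 6))

theorem Ok_sc (v : ℕ) (g : ℕ → ℕ) : Ok (sc v g) ↔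
    loc v (g 0) (g 1) (g 2) (g 3) (g 4) (g 5) ∧ Ok g := by
  constructor
  · intro h
    exact ⟨h 0, fun k => h (k + 1)⟩
  · rintro ⟨h0, h⟩ k
    cases k with
    | zero => exact h0
    | succ k => exact h k

@[simp] theorem sc_zero (v : ℕ) (g : ℕ → ℕ) : sc v g 0 = v := rfl
theorem sc_1 (v : ℕ) (g : ℕ → ℕ) : sc v g 1 = g 0 := rfl
theorem sc_2 (v : ℕ) (g : ℕ → ℕ) : sc v g 2 = g 1 := rfl
theorem sc_3 (v : ℕ) (g : ℕ → ℕ) : sc v g 3 = g 2 := rfl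
theorem sc_4 (v : ℕ) (g : ℕ → ℕ) : sc v g 4 = g 3 := rfl
theorem sc_5 (v : ℕ) (g : ℕ → ℕ) : sc v g 5 = g 4 := rfl

def A0 (g : ℕ → ℕ) : Prop := Ok g
def A1 (g : ℕ → ℕ) : Prop := Ok (sc 1 g)
def A2 (g : ℕ → ℕ) : Prop := Ok (sc 2 g)
def A3 (g : ℕ → ℕ) : Prop := Ok (sc 1 (sc 0 g))
def A4 (g : ℕ → ℕ) : Prop := Ok (sc 1 (sc 1 g))
def A5 (g : ℕ → ℕ) : Prop := Ok (sc 2 (sc 0 g))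
def A6 (g : ℕ → ℕ) : Prop := Ok (sc 1 (sc 1 (sc 0 g)))
def A7 (g : ℕ → ℕ) : Prop := Ok (sc 2 (sc 0 (sc 0 g)))
def A8 (g : ℕ → ℕ) : Prop := Ok (sc 2 (sc 0 (sc 0 (sc 1 g))))

theorem t00 (g : ℕ → ℕ) : A0 (sc 0 g) ↔ A0 g := by
  simp only [A0, Ok_sc, sc_zero, sc_1, sc_2, sc_3, sc_4, sc_5, loc]; grind
theorem t03 (v : ℕ) (g : ℕ → ℕ) : ¬ A0 (sc (v + 3) g) := by
  simp only [A0, Ok_sc, sc_zero, sc_1, sc_2, sc_3, sc_4, sc_5, loc]; grind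
theorem t12 (v : ℕ) (g : ℕ → ℕ) : ¬ A1 (sc (v + 2) g) := by
  simp only [A1, Ok_sc, sc_zero, sc_1, sc_2, sc_3, sc_4, sc_5, loc]; grind
theorem t21 (v : ℕ) (g : ℕ → ℕ) : ¬ A2 (sc (v + 1) g) := by
  simp only [A2, Ok_sc, sc_zero, sc_1, sc_2, sc_3, sc_4, sc_5, loc]; grind
theorem t30 (g : ℕ → ℕ) : A3 (sc 0 g) ↔ A0 g := by
  simp only [A3, A0, Ok_sc, sc_zero, sc_1, sc_2, sc_3, sc_4, sc_5, loc]; grind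
theorem t31 (g : ℕ → ℕ) : A3 (sc 1 g) ↔ A1 g := by
  simp only [A3, A1, Ok_sc, sc_zero, sc_1, sc_2, sc_3, sc_4, sc_5, loc]; grind
theorem t32 (v : ℕ) (g : ℕ → ℕ) : ¬ A3 (sc (v + 2) g) := by
  simp only [A3, Ok_sc, sc_zero, sc_1, sc_2, sc_3, sc_4, sc_5, loc]; grind
theorem t41 (v : ℕ) (g : ℕ → ℕ) : ¬ A4 (sc (v + 1) g) := by
  simp only [A4, Ok_sc, sc_zero, sc_1, sc_2, sc_3, sc_4, sc_5, loc]; grind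
theorem t51 (v : ℕ) (g : ℕ → ℕ) : ¬ A5 (sc (v + 1) g) := by
  simp only [A5, Ok_sc, sc_zero, sc_1, sc_2, sc_3, sc_4, sc_5, loc]; grind
theorem t60 (g : ℕ → ℕ) : A6 (sc 0 g) ↔ A3 g := by
  simp only [A6, A3, Ok_sc, sc_zero, sc_1, sc_2, sc_3, sc_4, sc_5, loc]; grind
theorem t61 (g : ℕ → ℕ) : A6 (sc 1 g) ↔ A5 g := by
  simp only [A6, A5, Ok_sc, sc_zero, sc_1, sc_2, sc_3, sc_4, sc_5, loc]; grind
theorem t62 (v : ℕ) (g : ℕ → ℕ) : ¬ A6 (sc (v + 2) g) := by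
  simp only [A6, Ok_sc, sc_zero, sc_1, sc_2, sc_3, sc_4, sc_5, loc]; grind
theorem t70 (g : ℕ → ℕ) : A7 (sc 0 g) ↔ A0 g := by
  simp only [A7, A0, Ok_sc, sc_zero, sc_1, sc_2, sc_3, sc_4, sc_5, loc]; grind
theorem t72 (v : ℕ) (g : ℕ → ℕ) : ¬ A7 (sc (v + 2) g) := by
  simp only [A7, Ok_sc, sc_zero, sc_1, sc_2, sc_3, sc_4, sc_5, loc]; grind
theorem t80 (g : ℕ → ℕ) : A8 (sc 0 g) ↔ A3 g := by
  simp only [A8, A3, Ok_sc, sc_zero, sc_1, sc_2, sc_3, sc_4, sc_5, loc]; grind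
theorem t81 (v : ℕ) (g : ℕ → ℕ) : ¬ A8 (sc (v + 1) g) := by
  simp only [A8, Ok_sc, sc_zero, sc_1, sc_2, sc_3, sc_4, sc_5, loc]; grind
end Ising

namespace Ising
variable {R : Type*} [CommRing R]

theorem A_zero : A0 (fun _ => 0) ∧ A1 (fun _ => 0) ∧ A2 (fun _ => 0) ∧ A3 (fun _ => 0) ∧
    A4 (fun _ => 0) ∧ A5 (fun _ => 0) ∧ A6 (fun _ => 0) ∧ A7 (fun _ => 0) ∧ A8 (fun _ => 0) := by
  have h : Ok (fun _ => 0) := fun k => by simp [loc]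
  simp [A0, A1, A2, A3, A4, A5, A6, A7, A8, Ok_sc, h, loc, sc_1, sc_2, sc_3, sc_4, sc_5]

/-- the closed forms of the generating functions of the states of the automaton -/
theorem closed (q : R) (K : ℕ) (hK : q ^ K = 0) : ∀ d t : ℕ, K ≤ t + 2 + d →
    gf q K (La A0 (t + 2)) = a q K (2 * t) (t + 1) ∧
    gf q K (La A1 (t + 2)) = a q K (2 * t + 3) (t + 2) + q ^ (t + 2) * a q K (2 * t + 7) (t + 3) ∧
    gf q K (La A2 (t + 2)) = a q K (2 * t + 6) (t + 3) ∧
    gf q K (La A3 (t + 2)) = a q K (2 * t + 1) (t + 1) ∧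
    gf q K (La A4 (t + 2)) = a q K (2 * t + 5) (t + 2) ∧
    gf q K (La A5 (t + 2)) = a q K (2 * t + 4) (t + 2) ∧
    gf q K (La A6 (t + 2)) = a q K (2 * t + 3) (t + 1) ∧
    gf q K (La A7 (t + 2)) = a q K (2 * t + 2) (t + 1) ∧
    gf q K (La A8 (t + 2)) = a q K (2 * t + 3) (t + 2) := by
  intro d
  induction d with
  | zero =>
    intro t ht
    obtain ⟨z0, z1, z2, z3, z4, z5, z6, z7, z8⟩ := A_zero
    have hl : ∀ i j, 2 * t ≤ i → t + 1 ≤ j → a q K i j = 1 := fun i j hi hj =>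
      a_lim q K hK i j (by omega) (by omega)
    have hg : ∀ A : (ℕ → ℕ) → Prop, A (fun _ => 0) → gf q K (La A (t + 2)) = 1 := fun A hA =>
      gf_La_one q K hK A _ (by omega) hA
    have hq : q ^ (t + 2) = 0 := pow_eq_zero_of_le (by omega) hK
    rw [hg _ z0, hg _ z1, hg _ z2, hg _ z3, hg _ z4, hg _ z5, hg _ z6, hg _ z7, hg _ z8, hq]
    refine ⟨?_, ?_, ?_, ?_, ?_, ?_, ?_, ?_, ?_⟩
    all_goals rw [hl _ _ (by omega) (by omega)]
    simp
  | succ d ih =>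
    intro t ht
    obtain ⟨i0, i1, i2, i3, i4, i5, i6, i7, i8⟩ := ih (t + 1) (by omega)
    have r0 := gf_decomp q K hK A0 A0 A1 A2 (t + 2) (by omega) t00 (fun _ => Iff.rfl)
      (fun _ => Iff.rfl) t03
    have r1 := gf_decomp q K hK A1 A3 A4 (fun _ => False) (t + 2) (by omega) (fun _ => Iff.rfl)
      (fun _ => Iff.rfl) (fun g => iff_false_intro (t12 0 g)) (fun v g => t12 (v + 1) g)
    have r2 := gf_decomp q K hK A2 A5 (fun _ => False) (fun _ => False) (t + 2) (by omega)
      (fun _ => Iff.rfl) (fun g => iff_false_intro (t21 0 g)) (fun g => iff_false_intro (t21 1 g))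
      (fun v g => t21 (v + 2) g)
    have r3 := gf_decomp q K hK A3 A0 A1 (fun _ => False) (t + 2) (by omega) t30
      t31 (fun g => iff_false_intro (t32 0 g)) (fun v g => t32 (v + 1) g)
    have r4 := gf_decomp q K hK A4 A6 (fun _ => False) (fun _ => False) (t + 2) (by omega)
      (fun _ => Iff.rfl) (fun g => iff_false_intro (t41 0 g)) (fun g => iff_false_intro (t41 1 g))
      (fun v g => t41 (v + 2) g)
    have r5 := gf_decomp q K hK A5 A7 (fun _ => False) (fun _ => False) (t + 2) (by omega)
      (fun _ => Iff.rfl) (fun g => iff_false_intro (t51 0 g)) (fun g => iff_false_intro (t51 1 g))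
      (fun v g => t51 (v + 2) g)
    have r6 := gf_decomp q K hK A6 A3 A5 (fun _ => False) (t + 2) (by omega) t60
      t61 (fun g => iff_false_intro (t62 0 g)) (fun v g => t62 (v + 1) g)
    have r7 := gf_decomp q K hK A7 A0 A8 (fun _ => False) (t + 2) (by omega) t70
      (fun _ => Iff.rfl) (fun g => iff_false_intro (t72 0 g)) (fun v g => t72 (v + 1) g)
    have r8 := gf_decomp q K hK A8 A3 (fun _ => False) (fun _ => False) (t + 2) (by omega)
      t80 (fun g => iff_false_intro (t81 0 g)) (fun g => iff_false_intro (t81 1 g))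
      (fun v g => t81 (v + 2) g)
    simp only [gf_La_false, mul_zero, add_zero] at r0 r1 r2 r3 r4 r5 r6 r7 r8
    rw [show t + 2 + 1 = t + 1 + 2 by ring] at r0 r1 r2 r3 r4 r5 r6 r7 r8
    rw [r0, r1, r2, r3, r4, r5, r6, r7, r8, i0, i1, i2, i3, i4, i5, i6, i7, i8]
    have e1 := a_R1 q K hK (2 * t) (t + 1)
    have e2 := a_R1 q K hK (2 * t + 1) (t + 1)
    have e3 := a_R2 q K hK (2 * t + 2) (t + 1)
    have e4 := a_R2 q K hK (2 * t + 3) (t + 1)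
    rw [show 2 * (t + 1) = 2 * t + 2 by ring]
    simp only [add_assoc, Nat.reduceAdd] at *
    refine ⟨?_, trivial, trivial, ?_, trivial, trivial, ?_, ?_, trivial⟩
    · linear_combination -e1 - e2 - e3
    · linear_combination -e2 - e3
    · linear_combination -e4
    · linear_combination -e3
end Ising


namespace Ising
variable {R : Type*} [CommRing R]
set_option linter.unusedSimpArgs false

/-- the local condition at the part `2` -/
def loc2 (a0 a1 a2 a3 a4 a5 a6 a7 : ℕ) : Prop :=
  a0 ≤ 2 ∧ ¬ (2 ≤ a0 ∧ 1 ≤ a1) ∧ ¬ (1 ≤ a0 ∧ (2 ≤ a1 ∨ 2 ≤ a2)) ∧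
  ¬ (1 ≤ a0 ∧ 1 ≤ a1 ∧ 1 ≤ a2) ∧ ¬ (2 ≤ a0 ∧ (2 ≤ a3 ∨ (1 ≤ a3 ∧ 1 ≤ a4))) ∧
  ¬ (1 ≤ a0 ∧ 1 ≤ a1 ∧ ((1 ≤ a3 ∧ 1 ≤ a4) ∨ 2 ≤ a4)) ∧
  ¬ (1 ≤ a0 ∧ 1 ≤ a1 ∧ 1 ≤ a3 ∧ 1 ≤ a5 ∧ 1 ≤ a6) ∧
  ¬ (2 ≤ a0 ∧ 1 ≤ a2 ∧ 1 ≤ a3) ∧ ¬ (2 ≤ a0 ∧ 1 ≤ a2 ∧ 1 ≤ a4 ∧ 1 ≤ a5) ∧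
  ¬ (2 ≤ a0 ∧ 1 ≤ a2 ∧ 2 ≤ a5) ∧ ¬ (2 ≤ a0 ∧ 1 ≤ a2 ∧ 1 ≤ a4 ∧ 1 ≤ a6 ∧ 1 ≤ a7)

/-- the condition on all multiplicities, starting from the part `2` -/
def Ok2 (g : ℕ → ℕ) : Prop :=
  loc2 (g 0) (g 1) (g 2) (g 3) (g 4) (g 5) (g 6) (g 7) ∧ Ok (fun k => g (k + 1))

theorem Ok2_sc (v : ℕ) (g : ℕ → ℕ) : Ok2 (sc v g) ↔
    loc2 v (g 0) (g 1) (g 2) (g 3) (g 4) (g 5) (g 6) ∧ Ok g := Iff.rfl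

theorem sc_6 (v : ℕ) (g : ℕ → ℕ) : sc v g 6 = g 5 := rfl

theorem u0 (g : ℕ → ℕ) : Ok2 (sc 0 g) ↔ A0 g := by
  simp only [A0, Ok2_sc, Ok_sc, sc_zero, sc_1, sc_2, sc_3, sc_4, sc_5, sc_6, loc, loc2]; grind
theorem u1 (g : ℕ → ℕ) : Ok2 (sc 1 g) ↔ A1 g := by
  simp only [A1, Ok2_sc, Ok_sc, sc_zero, sc_1, sc_2, sc_3, sc_4, sc_5, sc_6, loc, loc2]; grind
theorem u3 (v : ℕ) (g : ℕ → ℕ) : ¬ Ok2 (sc (v + 3) g) := by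
  simp only [Ok2_sc, Ok_sc, sc_zero, sc_1, sc_2, sc_3, sc_4, sc_5, sc_6, loc, loc2]; grind
theorem u21 (v : ℕ) (g : ℕ → ℕ) : ¬ Ok2 (sc 2 (sc (v + 1) g)) := by
  simp only [Ok2_sc, Ok_sc, sc_zero, sc_1, sc_2, sc_3, sc_4, sc_5, sc_6, loc, loc2]; grind
theorem u200 (g : ℕ → ℕ) : Ok2 (sc 2 (sc 0 (sc 0 g))) ↔ A7 g := by
  simp only [A7, Ok2_sc, Ok_sc, sc_zero, sc_1, sc_2, sc_3, sc_4, sc_5, sc_6, loc, loc2]; grind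
theorem u201 (g : ℕ → ℕ) : Ok2 (sc 2 (sc 0 (sc 1 g))) ↔ A4 g := by
  simp only [A4, Ok2_sc, Ok_sc, sc_zero, sc_1, sc_2, sc_3, sc_4, sc_5, sc_6, loc, loc2]; grind
theorem u202 (v : ℕ) (g : ℕ → ℕ) : ¬ Ok2 (sc 2 (sc 0 (sc (v + 2) g))) := by
  simp only [Ok2_sc, Ok_sc, sc_zero, sc_1, sc_2, sc_3, sc_4, sc_5, sc_6, loc, loc2]; grind

theorem gf_P (q : R) (K : ℕ) (hK : q ^ K = 0) : gf q K (La Ok2 2) = G q K 0 := by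
  have r0 := gf_decomp q K hK Ok2 A0 A1 (fun g => Ok2 (sc 2 g)) 2 (by omega) u0 u1
    (fun _ => Iff.rfl) u3
  have r1 := gf_decomp q K hK (fun g => Ok2 (sc 2 g)) (fun g => Ok2 (sc 2 (sc 0 g)))
    (fun _ => False) (fun _ => False) 3 (by omega)
    (fun _ => Iff.rfl) (fun g => iff_false_intro (u21 0 g)) (fun g => iff_false_intro (u21 1 g))
    (fun v g => u21 (v + 2) g)
  have r2 := gf_decomp q K hK (fun g => Ok2 (sc 2 (sc 0 g))) A7 A4
    (fun _ => False) 4 (by omega)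
    u200 u201 (fun g => iff_false_intro (u202 0 g))
    (fun v g => u202 (v + 1) g)
  simp only [gf_La_false, mul_zero, add_zero, Nat.reduceAdd] at r0 r1 r2
  obtain ⟨c0, c1, -⟩ := closed q K hK K 1 (by omega)
  obtain ⟨-, -, -, -, c4, -, -, c7, -⟩ := closed q K hK K 3 (by omega)
  simp only [Nat.reduceAdd, Nat.reduceMul] at c0 c1 c4 c7
  rw [r0, r1, r2, c0, c1, c4, c7]
  have e1 := a_R2 q K hK 0 0
  have e2 := a_R1 q K hK 3 2
  have e3 := a_R1 q K hK 0 1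
  have e4 := a_R1 q K hK 1 1
  have e5 := a_R2 q K hK 2 1
  unfold G
  simp only [Nat.reduceAdd, Nat.reduceMul] at *
  linear_combination -e1 - q * e2 - e3 - e4 - e5

theorem cons1 (x : ℕ) (s m : Multiset ℕ) (h : x ∉ s) : x ::ₘ s ≤ m ↔ 1 ≤ m.count x ∧ s ≤ m := by
  rw [Multiset.cons_le_of_notMem h, Multiset.one_le_count_iff_mem]

theorem cons_le_aux (v x : ℕ) (s m : Multiset ℕ) (h : x ∉ s) :
    Multiset.replicate v x + s ≤ m ↔ v ≤ m.count x ∧ s ≤ m := by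
  have h0 : s.count x = 0 := Multiset.count_eq_zero.2 h
  simp only [Multiset.le_iff_count, Multiset.count_add, Multiset.count_replicate]
  constructor
  · intro hh
    refine ⟨?_, fun z => ?_⟩
    · have := hh x; simpa [h0] using this
    · have := hh z; omega
  · rintro ⟨h1, h2⟩ z
    split_ifs with hz
    · subst hz; omega
    · simpa using h2 z

theorem cons2 (x : ℕ) (s m : Multiset ℕ) (h : x ∉ s) :
    x ::ₘ x ::ₘ s ≤ m ↔ 2 ≤ m.count x ∧ s ≤ m := by
  rw [← cons_le_aux 2 x s m h]; simp [Multiset.replicate_succ]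

theorem cons3 (x : ℕ) (s m : Multiset ℕ) (h : x ∉ s) :
    x ::ₘ x ::ₘ x ::ₘ s ≤ m ↔ 3 ≤ m.count x ∧ s ≤ m := by
  rw [← cons_le_aux 3 x s m h]; simp [Multiset.replicate_succ]

set_option maxHeartbeats 1000000 in
theorem memP_iff (m : Multiset ℕ) : (∀ mu ∈ Forbidden, ¬ mu ≤ m) ↔ Ok2 (mult 2 m) := by
  have f1 : ∀ p : ℕ, ({p, p, p} : Multiset ℕ) ≤ m ↔ 3 ≤ m.count p := fun p => by
    simp only [Multiset.insert_eq_cons, ← Multiset.cons_zero]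
    rw [cons3 _ _ _ (by simp)]; simp
  have f2 : ∀ p : ℕ, ({p + 1, p, p} : Multiset ℕ) ≤ m ↔ 1 ≤ m.count (p + 1) ∧ 2 ≤ m.count p :=
    fun p => by
    simp only [Multiset.insert_eq_cons, ← Multiset.cons_zero]
    rw [cons1 _ _ _ (by simp), cons2 _ _ _ (by simp)]; simp
  have f3 : ∀ p : ℕ, ({p + 1, p + 1, p} : Multiset ℕ) ≤ m ↔ 2 ≤ m.count (p + 1) ∧ 1 ≤ m.count p :=
    fun p => by
    simp only [Multiset.insert_eq_cons, ← Multiset.cons_zero]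
    rw [cons2 _ _ _ (by simp), cons1 _ _ _ (by simp)]; simp
  have f4 : ∀ p : ℕ, ({p + 2, p + 1, p} : Multiset ℕ) ≤ m ↔
      1 ≤ m.count (p + 2) ∧ 1 ≤ m.count (p + 1) ∧ 1 ≤ m.count p := fun p => by
    simp only [Multiset.insert_eq_cons, ← Multiset.cons_zero]
    rw [cons1 _ _ _ (by simp), cons1 _ _ _ (by simp), cons1 _ _ _ (by simp)]; simp
  have f5 : ∀ p : ℕ, ({p + 2, p + 2, p} : Multiset ℕ) ≤ m ↔ 2 ≤ m.count (p + 2) ∧ 1 ≤ m.count p :=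
    fun p => by
    simp only [Multiset.insert_eq_cons, ← Multiset.cons_zero]
    rw [cons2 _ _ _ (by simp), cons1 _ _ _ (by simp)]; simp
  have f6 : ∀ p : ℕ, ({p + 3, p + 3, p, p} : Multiset ℕ) ≤ m ↔
      2 ≤ m.count (p + 3) ∧ 2 ≤ m.count p := fun p => by
    simp only [Multiset.insert_eq_cons, ← Multiset.cons_zero]
    rw [cons2 _ _ _ (by simp), cons2 _ _ _ (by simp)]; simp
  have f7 : ∀ p : ℕ, ({p + 4, p + 3, p, p} : Multiset ℕ) ≤ m ↔
      1 ≤ m.count (p + 4) ∧ 1 ≤ m.count (p + 3) ∧ 2 ≤ m.count p := fun p => by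
    simp only [Multiset.insert_eq_cons, ← Multiset.cons_zero]
    rw [cons1 _ _ _ (by simp), cons1 _ _ _ (by simp), cons2 _ _ _ (by simp)]; simp
  have f8 : ∀ p : ℕ, ({p + 4, p + 3, p + 1, p} : Multiset ℕ) ≤ m ↔
      1 ≤ m.count (p + 4) ∧ 1 ≤ m.count (p + 3) ∧ 1 ≤ m.count (p + 1) ∧ 1 ≤ m.count p :=
    fun p => by
    simp only [Multiset.insert_eq_cons, ← Multiset.cons_zero]
    rw [cons1 _ _ _ (by simp), cons1 _ _ _ (by simp), cons1 _ _ _ (by simp),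
      cons1 _ _ _ (by simp)]; simp
  have f9 : ∀ p : ℕ, ({p + 4, p + 4, p + 1, p} : Multiset ℕ) ≤ m ↔
      2 ≤ m.count (p + 4) ∧ 1 ≤ m.count (p + 1) ∧ 1 ≤ m.count p := fun p => by
    simp only [Multiset.insert_eq_cons, ← Multiset.cons_zero]
    rw [cons2 _ _ _ (by simp), cons1 _ _ _ (by simp), cons1 _ _ _ (by simp)]; simp
  have f10 : ∀ p : ℕ, ({p + 6, p + 5, p + 3, p + 1, p} : Multiset ℕ) ≤ m ↔
      1 ≤ m.count (p + 6) ∧ 1 ≤ m.count (p + 5) ∧ 1 ≤ m.count (p + 3) ∧ 1 ≤ m.count (p + 1)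
        ∧ 1 ≤ m.count p := fun p => by
    simp only [Multiset.insert_eq_cons, ← Multiset.cons_zero]
    rw [cons1 _ _ _ (by simp), cons1 _ _ _ (by simp), cons1 _ _ _ (by simp),
      cons1 _ _ _ (by simp), cons1 _ _ _ (by simp)]; simp
  have f11 : ∀ p : ℕ, ({p + 2, p, p} : Multiset ℕ) ≤ m ↔ 1 ≤ m.count (p + 2) ∧ 2 ≤ m.count p :=
    fun p => by
    simp only [Multiset.insert_eq_cons, ← Multiset.cons_zero]
    rw [cons1 _ _ _ (by simp), cons2 _ _ _ (by simp)]; simp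
  have s1 : ({5, 4, 2, 2} : Multiset ℕ) ≤ m ↔ 1 ≤ m.count 5 ∧ 1 ≤ m.count 4 ∧ 2 ≤ m.count 2 := by
    simp only [Multiset.insert_eq_cons, ← Multiset.cons_zero]
    rw [cons1 _ _ _ (by simp), cons1 _ _ _ (by simp), cons2 _ _ _ (by simp)]; simp
  have s2 : ({7, 6, 4, 2, 2} : Multiset ℕ) ≤ m ↔
      1 ≤ m.count 7 ∧ 1 ≤ m.count 6 ∧ 1 ≤ m.count 4 ∧ 2 ≤ m.count 2 := by
    simp only [Multiset.insert_eq_cons, ← Multiset.cons_zero]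
    rw [cons1 _ _ _ (by simp), cons1 _ _ _ (by simp), cons1 _ _ _ (by simp),
      cons2 _ _ _ (by simp)]; simp
  have s3 : ({7, 7, 4, 2, 2} : Multiset ℕ) ≤ m ↔
      2 ≤ m.count 7 ∧ 1 ≤ m.count 4 ∧ 2 ≤ m.count 2 := by
    simp only [Multiset.insert_eq_cons, ← Multiset.cons_zero]
    rw [cons2 _ _ _ (by simp), cons1 _ _ _ (by simp), cons2 _ _ _ (by simp)]; simp
  have s4 : ({9, 8, 6, 4, 2, 2} : Multiset ℕ) ≤ m ↔
      1 ≤ m.count 9 ∧ 1 ≤ m.count 8 ∧ 1 ≤ m.count 6 ∧ 1 ≤ m.count 4 ∧ 2 ≤ m.count 2 := by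
    simp only [Multiset.insert_eq_cons, ← Multiset.cons_zero]
    rw [cons1 _ _ _ (by simp), cons1 _ _ _ (by simp), cons1 _ _ _ (by simp),
      cons1 _ _ _ (by simp), cons2 _ _ _ (by simp)]; simp
  constructor
  · intro h
    have hA : ∀ p, 2 ≤ p → ¬ 3 ≤ m.count p ∧
        ¬ (1 ≤ m.count (p + 1) ∧ 2 ≤ m.count p) ∧
        ¬ (2 ≤ m.count (p + 1) ∧ 1 ≤ m.count p) ∧
        ¬ (1 ≤ m.count (p + 2) ∧ 1 ≤ m.count (p + 1) ∧ 1 ≤ m.count p) ∧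
        ¬ (2 ≤ m.count (p + 2) ∧ 1 ≤ m.count p) ∧
        ¬ (2 ≤ m.count (p + 3) ∧ 2 ≤ m.count p) ∧
        ¬ (1 ≤ m.count (p + 4) ∧ 1 ≤ m.count (p + 3) ∧ 2 ≤ m.count p) ∧
        ¬ (1 ≤ m.count (p + 4) ∧ 1 ≤ m.count (p + 3) ∧ 1 ≤ m.count (p + 1) ∧ 1 ≤ m.count p) ∧
        ¬ (2 ≤ m.count (p + 4) ∧ 1 ≤ m.count (p + 1) ∧ 1 ≤ m.count p) ∧
        ¬ (1 ≤ m.count (p + 6) ∧ 1 ≤ m.count (p + 5) ∧ 1 ≤ m.count (p + 3) ∧ 1 ≤ m.count (p + 1)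
        ∧ 1 ≤ m.count p) := by
      intro p hp
      rw [← f1, ← f2, ← f3, ← f4, ← f5, ← f6, ← f7, ← f8, ← f9, ← f10]
      have h' := fun mu hmu => h mu (Or.inl ⟨p, hp, hmu⟩)
      refine ⟨h' _ (Or.inl rfl),
        h' _ (Or.inr (Or.inl rfl)),
        h' _ (Or.inr (Or.inr (Or.inl rfl))),
        h' _ (Or.inr (Or.inr (Or.inr (Or.inl rfl)))),
        h' _ (Or.inr (Or.inr (Or.inr (Or.inr (Or.inl rfl))))),
        h' _ (Or.inr (Or.inr (Or.inr (Or.inr (Or.inr (Or.inl rfl)))))),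
        h' _ (Or.inr (Or.inr (Or.inr (Or.inr (Or.inr (Or.inr (Or.inl rfl))))))),
        h' _ (Or.inr (Or.inr (Or.inr (Or.inr (Or.inr (Or.inr (Or.inr (Or.inl rfl)))))))),
        h' _ (Or.inr (Or.inr (Or.inr (Or.inr (Or.inr (Or.inr (Or.inr (Or.inr (Or.inl rfl))))))))),
        h' _ (Or.inr (Or.inr (Or.inr (Or.inr (Or.inr (Or.inr (Or.inr (Or.inr (Or.inr (rfl))))))))))⟩
    have hB : ∀ p, 3 ≤ p → ¬ (1 ≤ m.count (p + 2) ∧ 2 ≤ m.count p) := by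
      intro p hp
      rw [← f11]
      exact h _ (Or.inr (Or.inl ⟨p, hp, rfl⟩))
    have h1 := h _ (Or.inr (Or.inr (Or.inl rfl)))
    have h2 := h _ (Or.inr (Or.inr (Or.inr (Or.inl rfl))))
    have h3 := h _ (Or.inr (Or.inr (Or.inr (Or.inr (Or.inl rfl)))))
    have h4 := h _ (Or.inr (Or.inr (Or.inr (Or.inr (Or.inr rfl)))))
    rw [s1] at h1
    rw [s2] at h2
    rw [s3] at h3
    rw [s4] at h4
    clear h f1 f2 f3 f4 f5 f6 f7 f8 f9 f10 f11 s1 s2 s3 s4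
    refine ⟨?_, ?_⟩
    · have hh := hA 2 le_rfl
      simp only [mult, loc2, Nat.reduceAdd] at *
      clear hA hB
      obtain ⟨a1, a2, a3, a4, a5, a6, a7, a8, a9, a10⟩ := hh
      refine ⟨?_, ?_, ?_, ?_, ?_, ?_, ?_, ?_, ?_, ?_, ?_⟩ <;> grind
    · intro k
      have hh := hA (2 + (k + 1)) (by omega)
      have hh2 := hB (2 + (k + 1)) (by omega)
      clear hA hB h1 h2 h3 h4
      simp only [mult, loc, add_assoc, Nat.reduceAdd] at *
      obtain ⟨a1, a2, a3, a4, a5, a6, a7, a8, a9, a10⟩ := hh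
      refine ⟨?_, ?_, ?_, ?_, ?_, ?_, ?_⟩ <;> grind
  · rintro ⟨h1, h2⟩ mu hmu
    have key : ∀ p, 3 ≤ p → loc (m.count p) (m.count (p + 1)) (m.count (p + 2)) (m.count (p + 3))
        (m.count (p + 4)) (m.count (p + 5)) (m.count (p + 6)) := by
      intro p hp
      obtain ⟨k, rfl⟩ := Nat.exists_eq_add_of_le hp
      have := h2 k
      unfold mult at this
      convert this using 2 <;> ring
    rcases hmu with ⟨p, hp, h⟩ | ⟨p, hp, rfl⟩ | rfl | rfl | rfl | rfl
    · rcases hp.eq_or_lt with rfl | hp'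
      · simp only [mult, loc2, Nat.reduceAdd] at h1
        obtain ⟨b1, b2, b3, b4, b5, b6, b7, b8, b9, b10, b11⟩ := h1
        rcases h with rfl | rfl | rfl | rfl | rfl | rfl | rfl | rfl | rfl | rfl
        · rw [f1]; exact not_le.2 (Nat.lt_succ_of_le b1)
        · rw [f2]; exact fun h => b2 ⟨h.2, h.1⟩
        · rw [f3]; exact fun h => b3 ⟨h.2, Or.inl h.1⟩
        · rw [f4]; exact fun h => b4 ⟨h.2.2, h.2.1, h.1⟩
        · rw [f5]; exact fun h => b3 ⟨h.2, Or.inr h.1⟩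
        · rw [f6]; exact fun h => b5 ⟨h.2, Or.inl h.1⟩
        · rw [f7]; exact fun h => b5 ⟨h.2.2, Or.inr ⟨h.2.1, h.1⟩⟩
        · rw [f8]; exact fun h => b6 ⟨h.2.2.2, h.2.2.1, Or.inl ⟨h.2.1, h.1⟩⟩
        · rw [f9]; exact fun h => b6 ⟨h.2.2, h.2.1, Or.inr h.1⟩
        · rw [f10]; exact fun h => b7 ⟨h.2.2.2.2, h.2.2.2.1, h.2.2.1, h.2.1, h.1⟩
      · have h1 := key p hp'
        simp only [loc] at h1
        obtain ⟨b1, b2, b3, b4, b5, b6, b7⟩ := h1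
        rcases h with rfl | rfl | rfl | rfl | rfl | rfl | rfl | rfl | rfl | rfl
        · rw [f1]; exact not_le.2 (Nat.lt_succ_of_le b1)
        · rw [f2]; exact fun h => b2 ⟨h.2, Or.inl h.1⟩
        · rw [f3]; exact fun h => b3 ⟨h.2, Or.inl h.1⟩
        · rw [f4]; exact fun h => b4 ⟨h.2.2, h.2.1, h.1⟩
        · rw [f5]; exact fun h => b3 ⟨h.2, Or.inr h.1⟩
        · rw [f6]; exact fun h => b5 ⟨h.2, Or.inl h.1⟩
        · rw [f7]; exact fun h => b5 ⟨h.2.2, Or.inr ⟨h.2.1, h.1⟩⟩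
        · rw [f8]; exact fun h => b6 ⟨h.2.2.2, h.2.2.1, Or.inl ⟨h.2.1, h.1⟩⟩
        · rw [f9]; exact fun h => b6 ⟨h.2.2, h.2.1, Or.inr h.1⟩
        · rw [f10]; exact fun h => b7 ⟨h.2.2.2.2, h.2.2.2.1, h.2.2.1, h.2.1, h.1⟩
    · have h1 := key p hp
      simp only [loc] at h1
      obtain ⟨b1, b2, b3, b4, b5, b6, b7⟩ := h1
      rw [f11]; exact fun h => b2 ⟨h.2, Or.inr h.1⟩
    · simp only [mult, loc2, Nat.reduceAdd] at h1
      obtain ⟨b1, b2, b3, b4, b5, b6, b7, b8, b9, b10, b11⟩ := h1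
      rw [s1]; exact fun h => b8 ⟨h.2.2, h.2.1, h.1⟩
    · simp only [mult, loc2, Nat.reduceAdd] at h1
      obtain ⟨b1, b2, b3, b4, b5, b6, b7, b8, b9, b10, b11⟩ := h1
      rw [s2]; exact fun h => b9 ⟨h.2.2.2, h.2.2.1, h.2.1, h.1⟩
    · simp only [mult, loc2, Nat.reduceAdd] at h1
      obtain ⟨b1, b2, b3, b4, b5, b6, b7, b8, b9, b10, b11⟩ := h1
      rw [s3]; exact fun h => b10 ⟨h.2.2, h.2.1, h.1⟩
    · simp only [mult, loc2, Nat.reduceAdd] at h1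
      obtain ⟨b1, b2, b3, b4, b5, b6, b7, b8, b9, b10, b11⟩ := h1
      rw [s4]; exact fun h => b11 ⟨h.2.2.2.2, h.2.2.2.1, h.2.2.1, h.2.1, h.1⟩

theorem card_part {n : ℕ} (P : Multiset ℕ → Prop) (A : Set (Multiset ℕ)) (hA : Pos A)
    (h : ∀ m, P m ↔ m ∈ A) :
    Nat.card {l : n.Partition // P l.parts} = {m ∈ A | m.sum = n}.ncard := by
  rw [← Nat.card_coe_set_eq]
  refine Nat.card_congr
    { toFun := fun l => ⟨l.1.parts, (h _).1 l.2, l.1.parts_sum⟩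
      invFun := fun m => ⟨⟨m.1, fun {i} hi => hA m.1 m.2.1 i hi, m.2.2⟩, (h _).2 m.2.1⟩
      left_inv := fun l => rfl
      right_inv := fun m => rfl }

theorem card_P (n : ℕ) : Nat.card {l : n.Partition // MemP l} =
    {m ∈ La Ok2 2 | m.sum = n}.ncard :=
  card_part (fun m => (∀ i ∈ m, 2 ≤ i) ∧ ∀ mu ∈ Forbidden, ¬ mu ≤ m) _ (La_pos _ _ (by omega))
    (fun m => by rw [memP_iff]; rfl)
end Ising

namespace Ising
variable {R : Type*} [CommRing R]

/-- multisets with parts `≥ s` satisfying `P` -/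
def Mb (P : ℕ → Prop) (s : ℕ) : Set (Multiset ℕ) := {m | ∀ i ∈ m, s ≤ i ∧ P i}

theorem Mb_pos (P : ℕ → Prop) (s : ℕ) (hs : 0 < s) : Pos (Mb P s) :=
  fun _ hm i hi => lt_of_lt_of_le hs (hm i hi).1

theorem gf_Mb_step (q : R) (K : ℕ) (hK : q ^ K = 0) (P : ℕ → Prop) [DecidablePred P] (s : ℕ)
    (hs : 0 < s) :
    gf q K (Mb P s) * (if P s then 1 - q ^ s else 1) = gf q K (Mb P (s + 1)) := by
  split_ifs with h
  · have e : Mb P s = Mb P (s + 1) ∪ (fun m => {s} + m) '' Mb P s := by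
      ext m
      constructor
      · intro hm
        by_cases hmem : s ∈ m
        · right
          obtain ⟨m', rfl⟩ := Multiset.exists_cons_of_mem hmem
          exact ⟨m', fun i hi => hm i (Multiset.mem_cons_of_mem hi), by simp⟩
        · left
          intro i hi
          have := hm i hi
          refine ⟨?_, this.2⟩
          have : i ≠ s := fun h => hmem (h ▸ hi)
          omega
      · rintro (hm | ⟨m, hm, rfl⟩)
        · intro i hi
          have := hm i hi
          exact ⟨by omega, this.2⟩
        · intro i hi
          simp only [Multiset.singleton_add, Multiset.mem_cons] at hi
          rcases hi with rfl | hi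
          · exact ⟨le_rfl, h⟩
          · exact hm i hi
    have hd : Disjoint (Mb P (s + 1)) ((fun m => {s} + m) '' Mb P s) := by
      rw [Set.disjoint_left]
      rintro _ hm ⟨m, -, rfl⟩
      have := (hm s (by simp)).1
      omega
    have hp : Pos ((fun m => {s} + m) '' Mb P s) := by
      intro m hm
      exact Mb_pos P s hs m (e ▸ Or.inr hm)
    have := gf_union q K (Mb_pos P (s + 1) (by omega)) hp hd
    rw [← e, gf_image q K hK] at this
    simp only [Multiset.sum_singleton] at this
    linear_combination this
  · have e : Mb P s = Mb P (s + 1) := by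
      ext m
      refine forall₂_congr fun i _ => ?_
      constructor
      · rintro ⟨h1, h2⟩
        have : i ≠ s := by rintro rfl; exact h h2
        exact ⟨by omega, h2⟩
      · rintro ⟨h1, h2⟩
        exact ⟨by omega, h2⟩
    rw [mul_one, ← e]

theorem gf_Mb (q : R) (K : ℕ) (hK : q ^ K = 0) (P : ℕ → Prop) [DecidablePred P] : ∀ d s : ℕ,
    0 < s → K ≤ s + d →
    gf q K (Mb P s) * ∏ k ∈ Finset.range d, (if P (s + k) then 1 - q ^ (s + k) else 1) = 1 := by
  intro d
  induction d with
  | zero =>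
    intro s hs hd
    rw [Finset.prod_range_zero, mul_one]
    refine gf_one q K hK _ (by simp [Mb]) ?_
    intro m hm hlt
    by_contra hne
    obtain ⟨i, hi⟩ := Multiset.exists_mem_of_ne_zero hne
    have h1 := (hm i hi).1
    have h2 := Multiset.single_le_sum (fun x _ => Nat.zero_le x) i hi
    omega
  | succ d ih =>
    intro s hs hd
    have h := ih (s + 1) (by omega) (by omega)
    rw [← gf_Mb_step q K hK P s hs] at h
    rw [Finset.prod_range_succ']
    simp only [add_zero, add_assoc, add_comm 1] at h ⊢
    refine Eq.trans ?_ h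
    ring

/-- the congruence condition -/
def InS (i : ℕ) : Prop :=
  i % 16 = 2 ∨ i % 16 = 3 ∨ i % 16 = 4 ∨ i % 16 = 5 ∨
      i % 16 = 11 ∨ i % 16 = 12 ∨ i % 16 = 13 ∨ i % 16 = 14

instance : DecidablePred InS := fun i => by unfold InS; infer_instance

theorem prod16 (f : ℕ → R) (N : ℕ) : ∏ k ∈ Finset.range (16 * N), f k =
    ∏ t ∈ Finset.range N, ∏ r ∈ Finset.range 16, f (16 * t + r) := by
  induction N with
  | zero => simp
  | succ N ih => rw [mul_add, mul_one, Finset.prod_range_add, ih,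
      Finset.prod_range_succ _ N]

theorem gf_Q (q : R) (K : ℕ) (hK : q ^ K = 0) (N : ℕ) (hN : K ≤ N) :
    gf q K (Mb InS 1) * ∏ t ∈ Finset.range N, ((1 - q ^ (16 * t + 2)) * (1 - q ^ (16 * t + 3)) *
      (1 - q ^ (16 * t + 4)) * (1 - q ^ (16 * t + 5)) * (1 - q ^ (16 * t + 11)) *
      (1 - q ^ (16 * t + 12)) * (1 - q ^ (16 * t + 13)) * (1 - q ^ (16 * t + 14))) = 1 := by
  refine Eq.trans ?_ (gf_Mb q K hK InS (16 * N) 1 (by omega) (by omega))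
  rw [prod16]
  congr 1
  refine Finset.prod_congr rfl fun t _ => ?_
  have h : ∀ r, InS (1 + (16 * t + r)) ↔ InS (1 + r) := by
    intro r
    unfold InS
    rw [show (1 + (16 * t + r)) % 16 = (1 + r) % 16 by omega]
  simp only [h]
  simp only [Finset.prod_range_succ, Finset.prod_range_zero, InS]
  norm_num
  simp only [show ∀ r, 1 + (16 * t + r) = 16 * t + (r + 1) by intro r; ring, Nat.reduceAdd]
end Ising

namespace Ising
variable {R : Type*} [CommRing R]

/-- Gaussian binomial coefficients -/
def gb (Q : R) : ℕ → ℕ → R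
  | _, 0 => 1
  | 0, _ + 1 => 0
  | M + 1, m + 1 => gb Q M m + Q ^ (m + 1) * gb Q M (m + 1)

theorem gb_zero (Q : R) (M : ℕ) : gb Q M 0 = 1 := by cases M <;> rfl

theorem gb_gt (Q : R) : ∀ M m : ℕ, M < m → gb Q M m = 0
  | 0, m + 1, _ => rfl
  | M + 1, m + 1, h => by
    rw [gb, gb_gt Q M m (by omega), gb_gt Q M (m + 1) (by omega)]; ring

theorem gb_self (Q : R) : ∀ M : ℕ, gb Q M M = 1
  | 0 => rfl
  | M + 1 => by rw [gb, gb_self Q M, gb_gt Q M (M + 1) (by omega)]; ring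

theorem gb_sum (Q : R) (M : ℕ) (f : ℕ → R) :
    ∑ m ∈ Finset.range (M + 2), gb Q (M + 1) m * f m =
      ∑ m ∈ Finset.range (M + 1), gb Q M m * f (m + 1)
      + ∑ m ∈ Finset.range (M + 1), gb Q M m * (Q ^ m * f m) := by
  have h1 : ∑ m ∈ Finset.range (M + 1), gb Q M m * (Q ^ m * f m)
      = ∑ m ∈ Finset.range (M + 2), gb Q M m * (Q ^ m * f m) := by
    rw [Finset.sum_range_succ _ (M + 1), gb_gt Q M (M + 1) (by omega)]; ring
  rw [h1, Finset.sum_range_succ' _ (M + 1), Finset.sum_range_succ' _ (M + 1), ← add_assoc,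
    ← Finset.sum_add_distrib, gb_zero, gb_zero]
  congr 1
  · refine Finset.sum_congr rfl fun m _ => ?_
    rw [gb]; ring
  · simp

theorem prod_base (y : R) (A : ℕ) : ∀ a B : ℕ,
    ∏ k ∈ Finset.range a, (1 + y ^ (A * (2 * k + 1) + B)) =
      ∑ m ∈ Finset.range (a + 1), gb (y ^ (2 * A)) a m * y ^ (A * m ^ 2 + B * m) := by
  intro a
  induction a with
  | zero => intro B; simp [gb]
  | succ a ih =>
    intro B
    have h : ∀ k, A * (2 * (k + 1) + 1) + B = A * (2 * k + 1) + (B + 2 * A) := fun k => by ring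
    rw [Finset.prod_range_succ']
    simp only [h]
    rw [ih, gb_sum, mul_add, mul_one, add_comm, Finset.sum_mul]
    congr 1
    · refine Finset.sum_congr rfl fun m _ => ?_
      ring
    · refine Finset.sum_congr rfl fun m _ => ?_
      ring

/-- the quadratic exponent -/
def ex (A B : ℕ) (x : ℤ) : ℕ := ((A : ℤ) * x ^ 2 + B * x).toNat

theorem ex_cast (A B : ℕ) (h : B ≤ A) (x : ℤ) : (ex A B x : ℤ) = A * x ^ 2 + B * x := by
  unfold ex
  refine Int.toNat_of_nonneg ?_
  have h' : (B : ℤ) ≤ A := by exact_mod_cast h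
  have h0 : (0 : ℤ) ≤ B := by positivity
  rcases le_or_gt 0 x with hx | hx
  · positivity
  · have : 0 ≤ x ^ 2 + x := by nlinarith
    nlinarith [mul_nonneg (sub_nonneg.2 h') (sq_nonneg x)]

theorem prod_fin (y : R) (A B : ℕ) (hB : B ≤ A) (a : ℕ) : ∀ b : ℕ,
    (∏ k ∈ Finset.range a, (1 + y ^ (A * (2 * k + 1) + B))) *
      ∏ k ∈ Finset.range b, (1 + y ^ (A * (2 * k + 1) - B)) =
      ∑ m ∈ Finset.range (a + b + 1), gb (y ^ (2 * A)) (a + b) m * y ^ ex A B (m - b) := by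
  intro b
  induction b with
  | zero =>
    rw [Finset.prod_range_zero, mul_one, prod_base]
    refine Finset.sum_congr rfl fun m _ => ?_
    have h : ex A B ((m : ℤ) - (0 : ℕ)) = A * m ^ 2 + B * m := by
      zify
      rw [ex_cast A B hB]
      push_cast; ring
    rw [h, add_zero]
  | succ b ih =>
    rw [Finset.prod_range_succ, ← mul_assoc, ih, ← add_assoc, gb_sum, mul_add, mul_one,
      Finset.sum_mul]
    congr 1
    · refine Finset.sum_congr rfl fun m _ => ?_
      congr 3
      push_cast; ring
    · refine Finset.sum_congr rfl fun m _ => ?_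
      rw [mul_assoc, ← pow_mul, ← pow_add, ← pow_add]
      congr 2
      have h2 : B ≤ A * (2 * b + 1) := by nlinarith
      zify [h2]
      rw [ex_cast A B hB, ex_cast A B hB]
      push_cast; ring

/-- finite q-Pochhammer symbols -/
def po (Q : R) (n : ℕ) : R := ∏ k ∈ Finset.range n, (1 - Q ^ (k + 1))

theorem po_succ (Q : R) (n : ℕ) : po Q (n + 1) = po Q n * (1 - Q ^ (n + 1)) :=
  Finset.prod_range_succ _ _

theorem gb_po (Q : R) : ∀ u v : ℕ, gb Q (u + v) u * po Q u * po Q v = po Q (u + v)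
  | 0, v => by simp [gb_zero, po]
  | u + 1, 0 => by simp [gb_self, po]
  | u + 1, v + 1 => by
    have h1 := gb_po Q u (v + 1)
    have h2 := gb_po Q (u + 1) v
    rw [show u + 1 + (v + 1) = (u + 1 + v) + 1 by ring, gb, po_succ Q (u + 1 + v)]
    rw [show u + (v + 1) = u + 1 + v by ring] at h1
    have e1 := po_succ Q u
    have e2 := po_succ Q v
    rw [e2] at h1 ⊢
    rw [e1] at h2 ⊢
    rw [show u + 1 + v + 1 = (u + 1) + (v + 1) by ring, pow_add Q (u + 1)]
    linear_combination (1 - Q ^ (u + 1)) * h1 + Q ^ (u + 1) * (1 - Q ^ (v + 1)) * h2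

theorem po_stable (Q : R) (K : ℕ) (hK : Q ^ K = 0) (n : ℕ) (h : K ≤ n) : po Q n = po Q K := by
  obtain ⟨d, rfl⟩ := Nat.exists_eq_add_of_le h
  unfold po
  rw [Finset.prod_range_add]
  refine Eq.trans ?_ (mul_one _)
  congr 1
  refine Finset.prod_eq_one fun k _ => ?_
  rw [pow_eq_zero_of_le (by omega) hK, sub_zero]

theorem unit_one_sub (Q : R) (K : ℕ) (hK : Q ^ K = 0) (n : ℕ) (hn : 0 < n) :
    IsUnit (1 - Q ^ n) := by
  refine IsNilpotent.isUnit_one_sub ⟨K, ?_⟩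
  rw [← pow_mul, mul_comm, pow_mul, hK, zero_pow (by omega)]

theorem po_unit (Q : R) (K : ℕ) (hK : Q ^ K = 0) (n : ℕ) : IsUnit (po Q n) := by
  induction n with
  | zero => simp [po]
  | succ n ih => rw [po_succ]; exact ih.mul (unit_one_sub Q K hK _ (by omega))

theorem jtp (y : R) (K : ℕ) (hK : y ^ K = 0) (A B : ℕ) (hB : B < A) (N L : ℕ)
    (hN : 2 * K ≤ N) (hL : K ≤ L) :
    po (y ^ (2 * A)) L * ((∏ k ∈ Finset.range N, (1 + y ^ (A * (2 * k + 1) + B))) *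
      ∏ k ∈ Finset.range N, (1 + y ^ (A * (2 * k + 1) - B))) =
      ∑ m ∈ Finset.range (2 * N + 1), y ^ ex A B (m - N) := by
  rw [prod_fin y A B hB.le N N, ← two_mul, Finset.mul_sum]
  refine Finset.sum_congr rfl fun m hm => ?_
  rw [Finset.mem_range] at hm
  have hQ : (y ^ (2 * A)) ^ K = 0 := by
    rw [← pow_mul, mul_comm, pow_mul, hK, zero_pow (by omega)]
  by_cases h : K ≤ m ∧ K ≤ 2 * N - m
  · obtain ⟨v, hv⟩ := Nat.exists_eq_add_of_le (show m ≤ 2 * N by omega)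
    have e := gb_po (y ^ (2 * A)) m v
    have hv' : K ≤ v := by omega
    rw [po_stable _ K hQ m h.1, po_stable _ K hQ v hv',
      po_stable _ K hQ (m + v) (by omega)] at e
    rw [po_stable _ K hQ L hL, hv]
    have e2 : po (y ^ (2 * A)) K * (po (y ^ (2 * A)) K * gb (y ^ (2 * A)) (m + v) m) =
        po (y ^ (2 * A)) K * 1 := by
      rw [mul_one]; refine Eq.trans ?_ e; ring
    have e3 := (po_unit _ K hQ K).mul_left_cancel e2
    rw [← mul_assoc, e3, one_mul]
  · have : y ^ ex A B (m - N) = 0 := by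
      refine pow_eq_zero_of_le ?_ hK
      zify
      rw [ex_cast A B hB.le]
      have hB' : (B : ℤ) + 1 ≤ A := by exact_mod_cast hB
      have h0 : (0 : ℤ) ≤ B := by positivity
      have hx : (m : ℤ) - N ≤ -K ∨ (K : ℤ) ≤ m - N := by omega
      have hk : (0 : ℤ) ≤ K := by positivity
      generalize (m : ℤ) - N = x at hx ⊢
      have h1 : 0 ≤ ((A : ℤ) - B - 1) * x ^ 2 := mul_nonneg (by linarith) (sq_nonneg x)
      have h2 : 0 ≤ x ^ 2 + x := by
        rcases le_or_gt 0 x with h | h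
        · positivity
        · nlinarith
      have h3 := mul_nonneg h0 h2
      have h4 : (K : ℤ) ≤ x ^ 2 := by
        rcases hx with h | h
        · nlinarith
        · nlinarith
      nlinarith
    rw [this]; ring
end Ising

namespace Ising
variable {R : Type*} [CommRing R]

theorem prod_even_odd (f : ℕ → R) (N : ℕ) : ∏ k ∈ Finset.range (2 * N), f k =
    (∏ k ∈ Finset.range N, f (2 * k)) * ∏ k ∈ Finset.range N, f (2 * k + 1) := by
  induction N with
  | zero => simp
  | succ N ih =>
    rw [show 2 * (N + 1) = 2 * N + 1 + 1 by ring, Finset.prod_range_succ, Finset.prod_range_succ,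
      ih, Finset.prod_range_succ, Finset.prod_range_succ]
    ring

theorem sum_even_odd (f : ℕ → R) (N : ℕ) : ∑ k ∈ Finset.range (2 * N + 1), f k =
    (∑ k ∈ Finset.range (N + 1), f (2 * k)) + ∑ k ∈ Finset.range N, f (2 * k + 1) := by
  induction N with
  | zero => simp
  | succ N ih =>
    rw [show 2 * (N + 1) + 1 = 2 * N + 1 + 1 + 1 by ring, Finset.sum_range_succ,
      Finset.sum_range_succ, ih, Finset.sum_range_succ _ (N + 1),
      Finset.sum_range_succ (fun k => f (2 * k + 1)) N, show 2 * (N + 1) = 2 * N + 1 + 1 by ring]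
    ring

theorem sum_par (y : R) (N : ℕ) :
    ∑ m ∈ Finset.range (2 * (2 * N) + 1), y ^ ex 2 1 (m - (2 * N : ℕ))
    + ∑ m ∈ Finset.range (2 * (2 * N) + 1), (-y) ^ ex 2 1 (m - (2 * N : ℕ))
    = 2 * ∑ m ∈ Finset.range (2 * N + 1), y ^ ex 8 2 (m - N) := by
  rw [← Finset.sum_add_distrib, sum_even_odd]
  have h2 : ∑ k ∈ Finset.range (2 * N), (y ^ ex 2 1 ((2 * k + 1 : ℕ) - (2 * N : ℕ))
      + (-y) ^ ex 2 1 ((2 * k + 1 : ℕ) - (2 * N : ℕ))) = 0 := by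
    refine Finset.sum_eq_zero fun k _ => ?_
    have ho : Odd (ex 2 1 ((2 * k + 1 : ℕ) - (2 * N : ℕ))) := by
      have := ex_cast 2 1 (by norm_num) ((2 * k + 1 : ℕ) - (2 * N : ℕ))
      rw [← Int.odd_coe_nat, this]
      refine ⟨(2 * k + 1 - 2 * N) ^ 2 + (k - N), ?_⟩
      push_cast; ring
    rw [ho.neg_pow]; ring
  rw [h2, add_zero, Finset.mul_sum]
  refine Finset.sum_congr rfl fun k _ => ?_
  have e : ex 2 1 ((2 * k : ℕ) - (2 * N : ℕ)) = ex 8 2 (k - N) := by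
    have h1 := ex_cast 2 1 (by norm_num) ((2 * k : ℕ) - (2 * N : ℕ))
    have h2 := ex_cast 8 2 (by norm_num) ((k : ℤ) - N)
    have : (ex 2 1 ((2 * k : ℕ) - (2 * N : ℕ)) : ℤ) = ex 8 2 (k - N) := by
      rw [h1, h2]; push_cast; ring
    exact_mod_cast this
  have ho : Even (ex 8 2 ((k : ℤ) - N)) := by
    have := ex_cast 8 2 (by norm_num) ((k : ℤ) - N)
    rw [← Int.even_coe_nat, this]
    refine ⟨4 * (k - N) ^ 2 + (k - N), ?_⟩
    push_cast; ring
  rw [e, ho.neg_pow]; ring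

theorem E_jtp (y : R) (K : ℕ) (hK : y ^ K = 0) (N L : ℕ) (hN : 2 * K + 1 ≤ N) (hL : K ≤ L) :
    po (y ^ 4) L * E y (2 * N) = ∑ m ∈ Finset.range (2 * N + 1), y ^ ex 2 1 (m - N) := by
  have h := jtp y K hK 2 1 (by norm_num) N L (by omega) hL
  rw [← h, show 2 * N = (2 * N - 1) + 1 by omega, E_lim y K hK _ (by omega),
    show 2 * N - 1 + 1 = 2 * N by omega, prod_even_odd]
  norm_num only
  rw [mul_comm (∏ k ∈ Finset.range N, (1 + y ^ (2 * (2 * k + 1) + 1)))]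
  congr 2
  · refine Finset.prod_congr rfl fun k _ => ?_
    congr 2; omega
  · refine Finset.prod_congr rfl fun k _ => ?_
    congr 2; omega

theorem GF_prod (y : R) (K : ℕ) (hK : y ^ K = 0) (h2 : IsUnit (2 : R)) (N L : ℕ)
    (hN : 2 * K + 1 ≤ N) (hL : K ≤ L) (L' : ℕ) (hL' : K ≤ L') :
    po (y ^ 4) L * gf (y ^ 2) K (La Ok2 2) = po (y ^ 16) L' *
      ((∏ k ∈ Finset.range N, (1 + y ^ (16 * k + 10))) *
        ∏ k ∈ Finset.range N, (1 + y ^ (16 * k + 6))) := by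
  have hq : (y ^ 2) ^ K = 0 := by rw [← pow_mul, mul_comm, pow_mul, hK]; simp
  have hn : (-y) ^ K = 0 := by rw [neg_pow, hK, mul_zero]
  rw [gf_P _ _ hq, G_zero _ _ hq (4 * N - 2) (by omega), show 4 * N - 2 + 2 = 2 * (2 * N) by omega]
  have e1 := E_jtp y K hK (2 * N) L (by omega) hL
  have e2 := E_jtp (-y) K hn (2 * N) L (by omega) hL
  have e3 := D_E y (2 * (2 * N))
  have e4 := sum_par y N
  have e5 := jtp y K hK 8 2 (by norm_num) N L' (by omega) hL'
  rw [show (-y) ^ 4 = y ^ 4 by ring] at e2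
  have e6 : ∏ k ∈ Finset.range N, (1 + y ^ (8 * (2 * k + 1) + 2)) =
    ∏ k ∈ Finset.range N, (1 + y ^ (16 * k + 10)) := by
    refine Finset.prod_congr rfl fun k _ => ?_
    congr 2; omega
  have e7 : ∏ k ∈ Finset.range N, (1 + y ^ (8 * (2 * k + 1) - 2)) =
    ∏ k ∈ Finset.range N, (1 + y ^ (16 * k + 6)) := by
    refine Finset.prod_congr rfl fun k _ => ?_
    congr 2; omega
  rw [e6, e7] at e5
  norm_num only at e5
  rw [e5]
  refine h2.mul_left_cancel ?_
  rw [← e4, ← e1, ← e2, ← mul_add, ← e3]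
  ring

theorem W_stable (q : R) (K : ℕ) (hK : q ^ K = 0) (r N : ℕ) (h : K ≤ N) :
    ∏ k ∈ Finset.range N, (1 - q ^ (16 * k + r)) =
    ∏ t ∈ Finset.range N, ((1 - q ^ (32 * t + r)) * (1 - q ^ (32 * t + 16 + r))) := by
  have h1 : ∏ k ∈ Finset.range (2 * N), (1 - q ^ (16 * k + r)) =
      ∏ k ∈ Finset.range N, (1 - q ^ (16 * k + r)) := by
    rw [two_mul, Finset.prod_range_add]
    refine Eq.trans ?_ (mul_one _)
    congr 1
    refine Finset.prod_eq_one fun k _ => ?_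
    rw [pow_eq_zero_of_le (by omega) hK, sub_zero]
  rw [← h1, prod_even_odd, ← Finset.prod_mul_distrib]
  refine Finset.prod_congr rfl fun k _ => ?_
  ring_nf

theorem prod8 (f : ℕ → R) (N : ℕ) : ∏ k ∈ Finset.range (8 * N), f k =
    ∏ t ∈ Finset.range N, (f (8 * t) * f (8 * t + 1) * f (8 * t + 2) * f (8 * t + 3)
      * f (8 * t + 4) * f (8 * t + 5) * f (8 * t + 6) * f (8 * t + 7)) := by
  induction N with
  | zero => simp
  | succ N ih =>
    rw [show 8 * (N + 1) = 8 * N + 1 + 1 + 1 + 1 + 1 + 1 + 1 + 1 by ring]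
    simp only [Finset.prod_range_succ]
    rw [ih]
    ring

theorem prodS (q : R) (K : ℕ) (hK : q ^ K = 0) (N : ℕ) (h : K ≤ N) :
    (∏ t ∈ Finset.range N, ((1-q^(16*t+2))*(1-q^(16*t+3))*(1-q^(16*t+4))*(1-q^(16*t+5))*
      (1-q^(16*t+11))*(1-q^(16*t+12))*(1-q^(16*t+13))*(1-q^(16*t+14)))) *
    (po (q ^ 8) (2 * N) * ((∏ k ∈ Finset.range (2 * N), (1 + q ^ (8 * k + 5))) *
        ∏ k ∈ Finset.range (2 * N), (1 + q ^ (8 * k + 3)))) = po (q ^ 2) (8 * N) := by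
  unfold po
  rw [prod8]
  have e : ∏ t ∈ Finset.range N, ((1 - (q ^ 2) ^ (8 * t + 1)) * (1 - (q ^ 2) ^ (8 * t + 1 + 1))
      * (1 - (q ^ 2) ^ (8 * t + 2 + 1)) * (1 - (q ^ 2) ^ (8 * t + 3 + 1))
      * (1 - (q ^ 2) ^ (8 * t + 4 + 1)) * (1 - (q ^ 2) ^ (8 * t + 5 + 1))
      * (1 - (q ^ 2) ^ (8 * t + 6 + 1)) * (1 - (q ^ 2) ^ (8 * t + 7 + 1))) =
      (∏ t ∈ Finset.range N, ((1 - q ^ (16 * t + 2)) * (1 - q ^ (16 * t + 4))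
      * (1 - q ^ (16 * t + 8)) 
      * (1 - q ^ (16 * t + 12))
      * (1 - q ^ (16 * t + 14)) * (1 - q ^ (16 * t + 16)))) *
      ((∏ t ∈ Finset.range N, (1 - q ^ (16 * t + 6))) *
        ∏ t ∈ Finset.range N, (1 - q ^ (16 * t + 10))) := by
    rw [← Finset.prod_mul_distrib, ← Finset.prod_mul_distrib]
    refine Finset.prod_congr rfl fun t _ => ?_
    simp only [← pow_mul]
    rw [show 2 * (8 * t + 1) = 16 * t + 2 by ring, show 2 * (8 * t + 1 + 1) = 16 * t + 4 by ring,
      show 2 * (8 * t + 2 + 1) = 16 * t + 6 by ring, show 2 * (8 * t + 3 + 1) = 16 * t + 8 by ring,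
      show 2 * (8 * t + 4 + 1) = 16 * t + 10 by ring,
      show 2 * (8 * t + 5 + 1) = 16 * t + 12 by ring,
      show 2 * (8 * t + 6 + 1) = 16 * t + 14 by ring,
      show 2 * (8 * t + 7 + 1) = 16 * t + 16 by ring]
    ring
  rw [e, W_stable q K hK 6 N h, W_stable q K hK 10 N h, prod_even_odd, prod_even_odd, prod_even_odd]
  simp only [← Finset.prod_mul_distrib]
  refine Finset.prod_congr rfl fun t _ => ?_
  have d : ∀ a b : ℕ, b = 2 * a → 1 - q ^ b = (1 - q ^ a) * (1 + q ^ a) := by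
    rintro a b rfl; rw [mul_comm, pow_mul]; ring
  rw [d (16 * t + 3) (32 * t + 6) (by ring), d (16 * t + 11) (32 * t + 16 + 6) (by ring),
    d (16 * t + 5) (32 * t + 10) (by ring), d (16 * t + 13) (32 * t + 16 + 10) (by ring)]
  simp only [← pow_mul]
  rw [show 8 * (2 * t + 1) = 16 * t + 8 by ring, show 8 * (2 * t + 1 + 1) = 16 * t + 16 by ring,
    show 8 * (2 * t) + 5 = 16 * t + 5 by ring, show 8 * (2 * t) + 3 = 16 * t + 3 by ring,
    show 16 * t + 8 + 5 = 16 * t + 13 by ring, show 16 * t + 8 + 3 = 16 * t + 11 by ring]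
  ring

theorem gf_eq (y : R) (K : ℕ) (hK : y ^ K = 0) (h2 : IsUnit (2 : R)) :
    gf (y ^ 2) K (La Ok2 2) = gf (y ^ 2) K (Mb InS 1) := by
  have hq : (y ^ 2) ^ K = 0 := by rw [← pow_mul, mul_comm, pow_mul, hK]; simp
  have hq2 : ((y ^ 2) ^ 2) ^ K = 0 := by rw [← pow_mul, mul_comm, pow_mul, hq]; simp
  have h1 := GF_prod y K hK h2 (2 * (2 * K + 1)) (8 * (2 * K + 1)) (by omega) (by omega)
    (2 * (2 * K + 1)) (by omega)
  have h3 := prodS (y ^ 2) K hq (2 * K + 1) (by omega)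
  have h4 := gf_Q (y ^ 2) K hq (2 * K + 1) (by omega)
  have hu := po_unit ((y ^ 2) ^ 2) K hq2 (8 * (2 * K + 1))
  have f1 : ∏ k ∈ Finset.range (2 * (2 * K + 1)), (1 + (y ^ 2) ^ (8 * k + 5)) =
      ∏ k ∈ Finset.range (2 * (2 * K + 1)), (1 + y ^ (16 * k + 10)) := by
    refine Finset.prod_congr rfl fun k _ => ?_
    rw [← pow_mul]; congr 2; ring
  have f2 : ∏ k ∈ Finset.range (2 * (2 * K + 1)), (1 + (y ^ 2) ^ (8 * k + 3)) =
      ∏ k ∈ Finset.range (2 * (2 * K + 1)), (1 + y ^ (16 * k + 6)) := by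
    refine Finset.prod_congr rfl fun k _ => ?_
    rw [← pow_mul]; congr 2; ring
  rw [f1, f2, show (y ^ 2) ^ 8 = y ^ 16 by ring, ← h1] at h3
  rw [show (y ^ 2) ^ 2 = y ^ 4 by ring] at h3 hu
  set S := ∏ t ∈ Finset.range (2 * K + 1), ((1-(y^2)^(16*t+2))*(1-(y^2)^(16*t+3))*
      (1-(y^2)^(16*t+4))*(1-(y^2)^(16*t+5))*
      (1-(y^2)^(16*t+11))*(1-(y^2)^(16*t+12))*(1-(y^2)^(16*t+13))*(1-(y^2)^(16*t+14)))
  have h5 : S * gf (y ^ 2) K (La Ok2 2) = 1 := by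
    refine hu.mul_left_cancel ?_
    linear_combination h3
  linear_combination (gf (y ^ 2) K (Mb InS 1)) * h5 - gf (y ^ 2) K (La Ok2 2) * h4

open Polynomial in
theorem coeff_eq (n : ℕ) :
    {m ∈ La Ok2 2 | m.sum = n}.ncard = {m ∈ Mb InS 1 | m.sum = n}.ncard := by
  let I : Ideal ℚ[X] := Ideal.span {X ^ (2 * n + 1)}
  let φ := Ideal.Quotient.mk I
  have hK : (φ X) ^ (2 * n + 1) = 0 := by
    rw [← map_pow]
    exact Ideal.Quotient.eq_zero_iff_mem.2 (Ideal.subset_span rfl)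
  have h2 : IsUnit (2 : ℚ[X] ⧸ I) := by
    have : IsUnit (C 2 : ℚ[X]) := isUnit_C.2 (by norm_num)
    have := this.map φ
    rwa [show φ (C 2) = 2 from map_ofNat (φ.comp C) 2] at this
  have h := gf_eq (φ X) (2 * n + 1) hK h2
  have hp : ∀ A, gf (φ X ^ 2) (2 * n + 1) A = φ (gf (X ^ 2) (2 * n + 1) A) := by
    intro A; simp [gf]
  rw [hp, hp, Ideal.Quotient.eq, Ideal.mem_span_singleton, X_pow_dvd_iff] at h
  have h' := h (2 * n) (by omega)
  have hc : ∀ A, (gf (X ^ 2 : ℚ[X]) (2 * n + 1) A).coeff (2 * n) =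
      ({m ∈ A | m.sum = n}.ncard : ℚ) := by
    intro A
    unfold gf
    rw [finsetSum_coeff, Finset.sum_eq_single n]
    · rw [← pow_mul, coeff_natCast_mul, coeff_X_pow]; simp
    · intro b _ hb
      rw [← pow_mul, coeff_natCast_mul, coeff_X_pow, if_neg (by omega), mul_zero]
    · intro hn; exact absurd (Finset.mem_range.2 (by omega)) hn
  rw [coeff_sub, hc, hc, sub_eq_zero] at h'
  exact_mod_cast h'
end Ising

/-- for every `n ≥ 0`, the number of partitions in `𝒫(n)` equals the
number of partitions of `n` all of whose parts are congruent to
`2, 3, 4, 5, 11, 12, 13` or `14` modulo `16`. -/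
theorem ising_partition_identity (n : ℕ) :
    Nat.card {l : n.Partition // MemP l} =
    Nat.card {l : n.Partition // ∀ i ∈ l.parts,
      i % 16 = 2 ∨ i % 16 = 3 ∨ i % 16 = 4 ∨ i % 16 = 5 ∨
      i % 16 = 11 ∨ i % 16 = 12 ∨ i % 16 = 13 ∨ i % 16 = 14} := by
  rw [Ising.card_P, Ising.coeff_eq]
  refine (Ising.card_part (fun m => ∀ i ∈ m, Ising.InS i) (Ising.Mb Ising.InS 1)
    (Ising.Mb_pos _ 1 one_pos) fun m => ?_).symm
  constructor
  · intro h i hi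
    have := h i hi
    refine ⟨?_, this⟩
    unfold Ising.InS at this
    omega
  · intro h i hi
    exact (h i hi).2
end

section
/- Let a(n,m), b(n,m), c(n,m), d(n,m), e(n,m) denote the numbers of partitions with exactly m parts in 𝒜(n), ℬ(n), 𝒞(n), 𝒟(n), ℰ(n) respectively, with the convention that these counts are 0 whenever an argument is negative. Then for all n, m: a(n,m) = a(n−m,m)+b(n−m,m)+c(n−m,m)+d(n−m,m); b(n,m) = a(n−m−1,m−1) − d(n−2m,m−1); c(n,m) = b(n−2m+1,m−1) + d(n−2m,m−1); d(n,m) = b(n−m,m−1) − e(n−2m+1,m−1); e(n,m) = c(n−m,m−1). -/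
/-- The parts of a partition sorted in increasing order, so that the smallest
part `λ_m` is (if it exists) entry `0`, `λ_{m-1}` is entry `1`, etc. -/
def sparts {n : ℕ} (l : n.Partition) : List ℕ := l.parts.sort (· ≤ ·)

/-- `λ ∈ 𝒜(n)`: `λ ∈ 𝒫(n)` and the smallest part satisfies `λ_m > 2`
(for `n = 0` this gives `𝒜(0) = {[]}`, the empty partition). -/
def MemA {n : ℕ} (l : n.Partition) : Prop := MemP l ∧ ∀ i ∈ l.parts, 2 < i

/-- `λ ∈ ℬ(n)`: `λ ∈ 𝒫(n)` and `2 = λ_m < λ_{m-1} - 1`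
(for `n = 2` the special case `ℬ(2) = {[2]}` is the length-one clause). -/
def MemB {n : ℕ} (l : n.Partition) : Prop :=
  MemP l ∧ (sparts l)[0]? = some 2 ∧
    ((sparts l).length = 1 ∨ ∃ x, (sparts l)[1]? = some x ∧ 3 < x)

/-- `λ ∈ 𝒞(n)`: `λ ∈ 𝒫(n)` and `2 = λ_m = λ_{m-1} - 1`. -/
def MemC {n : ℕ} (l : n.Partition) : Prop :=
  MemP l ∧ (sparts l)[0]? = some 2 ∧ (sparts l)[1]? = some 3

/-- `λ ∈ 𝒟(n)`: `λ ∈ 𝒫(n)` and `2 = λ_m = λ_{m-1} < λ_{m-2} - 2`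
(for `n = 4` the special case `𝒟(4) = {[2,2]}` is the length-two clause). -/
def MemD {n : ℕ} (l : n.Partition) : Prop :=
  MemP l ∧ (sparts l)[0]? = some 2 ∧ (sparts l)[1]? = some 2 ∧
    ((sparts l).length = 2 ∨ ∃ x, (sparts l)[2]? = some x ∧ 4 < x)

/-- `λ ∈ ℰ(n)`: `λ ∈ 𝒫(n)` and `2 = λ_m = λ_{m-1} = λ_{m-2} - 2`. -/
def MemE {n : ℕ} (l : n.Partition) : Prop :=
  MemP l ∧ (sparts l)[0]? = some 2 ∧ (sparts l)[1]? = some 2 ∧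
    (sparts l)[2]? = some 4

/-- The number of partitions of `n` with exactly `m` parts satisfying a given
predicate, with arguments in `ℤ` and the convention that the count is `0`
whenever an argument is negative. -/
noncomputable def cnt (S : {n : ℕ} → n.Partition → Prop) (n m : ℤ) : ℤ :=
  if 0 ≤ n ∧ 0 ≤ m then
    (Nat.card {l : Nat.Partition n.toNat // S l ∧ Multiset.card l.parts = m.toNat} : ℤ)
  else 0

/-- `a(n,m)`, the number of partitions in `𝒜(n)` with exactly `m` parts. -/
noncomputable def aCnt : ℤ → ℤ → ℤ := cnt fun {_} l => MemA l
/-- `b(n,m)`, the number of partitions in `ℬ(n)` with exactly `m` parts. -/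
noncomputable def bCnt : ℤ → ℤ → ℤ := cnt fun {_} l => MemB l
/-- `c(n,m)`, the number of partitions in `𝒞(n)` with exactly `m` parts. -/
noncomputable def cCnt : ℤ → ℤ → ℤ := cnt fun {_} l => MemC l
/-- `d(n,m)`, the number of partitions in `𝒟(n)` with exactly `m` parts. -/
noncomputable def dCnt : ℤ → ℤ → ℤ := cnt fun {_} l => MemD l
/-- `e(n,m)`, the number of partitions in `ℰ(n)` with exactly `m` parts. -/
noncomputable def eCnt : ℤ → ℤ → ℤ := cnt fun {_} l => MemE l

set_option linter.all false
/-- number of multisets with given sum and cardinality whose count function satisfies `F`. -/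
noncomputable def gcnt (F : (ℕ → ℕ) → Prop) (N M : ℤ) : ℤ :=
  (Nat.card {s : Multiset ℕ // F (fun i => s.count i) ∧ (s.sum : ℤ) = N ∧
    (Multiset.card s : ℤ) = M} : ℤ)

theorem gcnt_finite (F : (ℕ → ℕ) → Prop) (N M : ℤ) :
    Finite {s : Multiset ℕ // F (fun i => s.count i) ∧ (s.sum : ℤ) = N ∧
    (Multiset.card s : ℤ) = M} := by
  have h : (Set.Iic (M.toNat • Multiset.range (N.toNat + 1))).Finite := Set.finite_Iic _
  refine Set.Finite.to_subtype (s := {s : Multiset ℕ | F (fun i => s.count i) ∧ (s.sum : ℤ) = N ∧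
    (Multiset.card s : ℤ) = M}) (h.subset ?_)
  rintro s ⟨-, h1, h2⟩
  simp only [Set.mem_Iic]
  rw [Multiset.le_iff_count]
  intro i
  by_cases hi : i ∈ s
  · have h3 : i ≤ s.sum := Multiset.le_sum_of_mem hi
    have h4 : s.count i ≤ Multiset.card s := Multiset.count_le_card _ _
    have h5 : Multiset.count i (Multiset.range (N.toNat + 1)) = 1 :=
      Multiset.count_eq_one_of_mem (Multiset.nodup_range _) (by
        rw [Multiset.mem_range]; omega)
    rw [Multiset.count_nsmul, h5]
    omega
  · rw [Multiset.count_eq_zero_of_notMem hi]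
    exact Nat.zero_le _

theorem gcnt_congr {F G : (ℕ → ℕ) → Prop} (h : ∀ f, F f ↔ G f) (N M : ℤ) :
    gcnt F N M = gcnt G N M := by
  have : F = G := funext fun f => propext (h f)
  rw [this]

theorem gcnt_split (F G : (ℕ → ℕ) → Prop) (N M : ℤ) :
    gcnt F N M = gcnt (fun f => F f ∧ G f) N M + gcnt (fun f => F f ∧ ¬ G f) N M := by
  classical
  have f1 := gcnt_finite F N M
  have f2 := gcnt_finite (fun f => F f ∧ G f) N M
  have f3 := gcnt_finite (fun f => F f ∧ ¬ G f) N M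
  unfold gcnt
  rw [← Nat.cast_add, ← Nat.card_sum]
  congr 1
  refine Nat.card_congr ((Equiv.sumCompl (fun s : {s : Multiset ℕ // F (fun i => s.count i) ∧
    (s.sum : ℤ) = N ∧ (Multiset.card s : ℤ) = M} => G (fun i => s.1.count i))).symm.trans
    (Equiv.sumCongr ?_ ?_))
  · refine (Equiv.subtypeSubtypeEquivSubtypeInter _
      (fun s : Multiset ℕ => G (fun i => s.count i))).trans (Equiv.subtypeEquivRight ?_)
    intro s; tauto
  · refine (Equiv.subtypeSubtypeEquivSubtypeInter _
      (fun s : Multiset ℕ => ¬ G (fun i => s.count i))).trans (Equiv.subtypeEquivRight ?_)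
    intro s; tauto

theorem count_shift_low (b r : Multiset ℕ) (k i : ℕ) (hi : i < k) :
    (b + r.map (· + k)).count i = b.count i := by
  rw [Multiset.count_add, Multiset.count_eq_zero_of_notMem (s := r.map (· + k))]
  · simp
  · simp only [Multiset.mem_map, not_exists, not_and]; intro x _; omega

theorem count_shift_high (b r : Multiset ℕ) (k i : ℕ) (hb : ∀ i ∈ b, i < k) :
    (b + r.map (· + k)).count (i + k) = r.count i := by
  rw [Multiset.count_add, Multiset.count_eq_zero_of_notMem (s := b), zero_add]
  · exact Multiset.count_map_eq_count' (· + k) r (add_left_injective k) i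
  · intro h; have := hb _ h; omega

theorem exists_shift (b s : Multiset ℕ) (k : ℕ) (hb : ∀ i ∈ b, i < k)
    (h : ∀ i < k, s.count i = b.count i) : ∃ r : Multiset ℕ, b + r.map (· + k) = s := by
  refine ⟨(s.filter (k ≤ ·)).map (· - k), ?_⟩
  have h1 : ((s.filter (k ≤ ·)).map (· - k)).map (· + k) = s.filter (k ≤ ·) := by
    rw [Multiset.map_map]
    conv_rhs => rw [← Multiset.map_id (s.filter (k ≤ ·))]
    refine Multiset.map_congr rfl ?_
    intro x hx
    have := (Multiset.mem_filter.1 hx).2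
    simp only [Function.comp, id]
    omega
  rw [h1]
  ext i
  rw [Multiset.count_add]
  by_cases hi : k ≤ i
  · rw [Multiset.count_filter_of_pos hi, Multiset.count_eq_zero_of_notMem, zero_add]
    intro h'; have := hb _ h'; omega
  · rw [Multiset.count_filter_of_neg hi, h i (by omega), add_zero]

theorem sum_shift (r : Multiset ℕ) (k : ℕ) :
    (r.map (· + k)).sum = r.sum + k * Multiset.card r := by
  induction r using Multiset.induction_on with
  | empty => simp
  | cons a r ih => simp only [Multiset.map_cons, Multiset.sum_cons, Multiset.card_cons, ih]; ring

theorem gcnt_transfer {F G : (ℕ → ℕ) → Prop} (b : Multiset ℕ) (k : ℕ) (hb : ∀ i ∈ b, i < k)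
    (h1 : ∀ s : ℕ → ℕ, F s → ∀ i < k, s i = b.count i)
    (h2 : ∀ s f : ℕ → ℕ, (∀ i, s (i + k) = f i) → (∀ i < k, s i = b.count i) → (F s ↔ G f))
    {N M N' M' : ℤ} (hN : N = b.sum + N' + k * M') (hM : M = Multiset.card b + M') :
    gcnt F N M = gcnt G N' M' := by
  unfold gcnt
  congr 1
  have key : ∀ r : Multiset ℕ, F (fun i => (b + r.map (· + k)).count i) ↔
      G (fun i => r.count i) := fun r =>
    h2 _ _ (fun i => count_shift_high b r k i hb) (fun i hi => count_shift_low b r k i hi)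
  symm
  refine Nat.card_eq_of_bijective (fun r => ⟨b + r.1.map (· + k), (key r.1).2 r.2.1, ?_, ?_⟩) ⟨?_, ?_⟩
  · obtain ⟨-, hs, hc⟩ := r.2
    rw [Multiset.sum_add, sum_shift, Nat.cast_add, Nat.cast_add, Nat.cast_mul, hs, hc, hN]; ring
  · obtain ⟨-, hs, hc⟩ := r.2
    rw [Multiset.card_add, Multiset.card_map]; push_cast; rw [hc, hM]
  · intro r r' h
    have h' := congrArg Subtype.val h
    simp only [add_right_inj] at h'
    exact Subtype.ext (Multiset.map_injective (add_left_injective k) h')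
  · rintro ⟨s, hF, hs, hc⟩
    obtain ⟨r, rfl⟩ := exists_shift b s k hb (h1 _ hF)
    refine ⟨⟨r, (key r).1 hF, ?_, ?_⟩, rfl⟩
    · rw [Multiset.card_add, Multiset.card_map] at hc
      rw [Multiset.sum_add, sum_shift, Nat.cast_add, Nat.cast_add, Nat.cast_mul] at hs; push_cast at hc
      have : (Multiset.card r : ℤ) = M' := by linarith
      rw [this] at hs; linarith
    · rw [Multiset.card_add, Multiset.card_map] at hc
      push_cast at hc; linarith

/-- the local conditions at `p`, without `[p+2,p,p]`. -/
def Loc0 (f : ℕ → ℕ) (p : ℕ) : Prop :=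
  f p ≤ 2 ∧ ¬ (2 ≤ f p ∧ 1 ≤ f (p+1)) ∧ ¬ (1 ≤ f p ∧ 2 ≤ f (p+1)) ∧
  ¬ (1 ≤ f p ∧ 1 ≤ f (p+1) ∧ 1 ≤ f (p+2)) ∧ ¬ (1 ≤ f p ∧ 2 ≤ f (p+2)) ∧
  ¬ (2 ≤ f p ∧ 2 ≤ f (p+3)) ∧ ¬ (2 ≤ f p ∧ 1 ≤ f (p+3) ∧ 1 ≤ f (p+4)) ∧
  ¬ (1 ≤ f p ∧ 1 ≤ f (p+1) ∧ 1 ≤ f (p+3) ∧ 1 ≤ f (p+4)) ∧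
  ¬ (1 ≤ f p ∧ 1 ≤ f (p+1) ∧ 2 ≤ f (p+4)) ∧
  ¬ (1 ≤ f p ∧ 1 ≤ f (p+1) ∧ 1 ≤ f (p+3) ∧ 1 ≤ f (p+5) ∧ 1 ≤ f (p+6))

/-- the local conditions at `p`. -/
def Loc (f : ℕ → ℕ) (p : ℕ) : Prop := Loc0 f p ∧ ¬ (2 ≤ f p ∧ 1 ≤ f (p+2))

/-- count version of `MemP`. -/
def PF (f : ℕ → ℕ) : Prop :=
  f 0 = 0 ∧ f 1 = 0 ∧ Loc0 f 2 ∧ (∀ p, Loc f (p + 3)) ∧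
  ¬ (2 ≤ f 2 ∧ 1 ≤ f 4 ∧ 1 ≤ f 5) ∧ ¬ (2 ≤ f 2 ∧ 1 ≤ f 4 ∧ 1 ≤ f 6 ∧ 1 ≤ f 7) ∧
  ¬ (2 ≤ f 2 ∧ 1 ≤ f 4 ∧ 2 ≤ f 7) ∧
  ¬ (2 ≤ f 2 ∧ 1 ≤ f 4 ∧ 1 ≤ f 6 ∧ 1 ≤ f 8 ∧ 1 ≤ f 9)

def QA (f : ℕ → ℕ) : Prop := ∀ p, Loc f p
def QB (f : ℕ → ℕ) : Prop := QA f ∧ f 0 ≤ 1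
def QD (f : ℕ → ℕ) : Prop := QA f ∧ f 0 ≤ 1 ∧ ¬ (1 ≤ f 0 ∧ 1 ≤ f 1)
def QC (f : ℕ → ℕ) : Prop := QA f ∧ f 0 ≤ 1 ∧ ¬ (1 ≤ f 0 ∧ 1 ≤ f 1) ∧ f 1 ≤ 1 ∧
  ¬ (1 ≤ f 0 ∧ 1 ≤ f 2 ∧ 1 ≤ f 3)

theorem loc_shift {s f : ℕ → ℕ} {k : ℕ} (h : ∀ i, s (i + k) = f i) (p : ℕ) :
    Loc s (p + k) ↔ Loc f p := by
  have e : ∀ j, s (p + k + j) = f (p + j) := fun j => by rw [← h (p + j)]; congr 1; omega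
  unfold Loc Loc0
  simp only [e, h]

theorem qa_step (f : ℕ → ℕ) (k : ℕ) :
    (∀ p, Loc f (p + k)) ↔ Loc f k ∧ ∀ p, Loc f (p + (k + 1)) := by
  constructor
  · intro h
    refine ⟨by simpa using h 0, fun p => ?_⟩
    have := h (p + 1)
    rwa [show p + 1 + k = p + (k + 1) by omega] at this
  · rintro ⟨h0, h⟩ (_ | p)
    · simpa using h0
    · have := h p
      rwa [show p + (k + 1) = p + 1 + k by omega] at this

theorem qa_shift {s f : ℕ → ℕ} {k : ℕ} (h : ∀ i, s (i + k) = f i) :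
    (∀ p, Loc s (p + k)) ↔ QA f := forall_congr' (loc_shift h)

theorem qa_zero (f : ℕ → ℕ) : QA f ↔ ∀ p, Loc f (p + 0) := Iff.rfl

theorem loc_weak {f : ℕ → ℕ} {p : ℕ} (h : Loc0 f p) : f p ≤ 2 ∧ ¬ (2 ≤ f p ∧ 1 ≤ f (p+1)) ∧
    ¬ (1 ≤ f p ∧ 2 ≤ f (p+1)) ∧ ¬ (1 ≤ f p ∧ 1 ≤ f (p+1) ∧ 1 ≤ f (p+2)) ∧
    ¬ (1 ≤ f p ∧ 2 ≤ f (p+2)) := ⟨h.1, h.2.1, h.2.2.1, h.2.2.2.1, h.2.2.2.2.1⟩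

theorem outA (n m : ℤ) : gcnt (fun f => PF f ∧ f 2 = 0) n m =
    gcnt QA (n - 0 - 3 * (m - 0)) (m - 0) := by
  have key : ∀ s f : ℕ → ℕ, (∀ i, s (i + 3) = f i) → (∀ i < 3, s i = (0 : Multiset ℕ).count i) →
      ((fun f => PF f ∧ f 2 = 0) s ↔ QA f) := by
    intro s f h hl
    have e0 : s 0 = 0 := by rw [hl 0 (by norm_num)]; decide
    have e1 : s 1 = 0 := by rw [hl 1 (by norm_num)]; decide
    have e2 : s 2 = 0 := by rw [hl 2 (by norm_num)]; decide
    have h0 : s 3 = f 0 := h 0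
    have h1 : s 4 = f 1 := h 1
    have h2 : s 5 = f 2 := h 2
    have h3 : s 6 = f 3 := h 3
    have h4 : s 7 = f 4 := h 4
    have h5 : s 8 = f 5 := h 5
    have h6 : s 9 = f 6 := h 6
    have h7 : s 10 = f 7 := h 7
    have hq : (∀ p, Loc s (p + 3)) ↔ QA f := by
      rw [← qa_shift h]
    unfold PF
    beta_reduce
    rw [hq]
    generalize QA f = q
    clear hq h hl
    simp only [Loc, Loc0, Nat.reduceAdd, e0, e1, e2, h0, h1, h2, h3, h4, h5, h6, h7]
    clear e0 e1 e2 h0 h1 h2 h3 h4 h5 h6 h7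
    by_cases hq : q <;> simp [hq] <;> omega
  refine gcnt_transfer 0 3 (by simp) ?_ key (by simp; try ring) (by simp)
  intro s hs i hi
  obtain ⟨⟨g0, g1, l2, hqa, -⟩, hs⟩ := hs
  replace l2 := loc_weak l2
  have l3 := loc_weak (hqa 0).1
  have l4 := loc_weak (hqa 1).1
  clear hqa
  simp only [Nat.reduceAdd, Nat.zero_add] at l2 l3 l4
  interval_cases i
  · rw [show (0 : Multiset ℕ).count 0 = 0 by decide]; omega
  · rw [show (0 : Multiset ℕ).count 1 = 0 by decide]; omega
  · rw [show (0 : Multiset ℕ).count 2 = 0 by decide]; omega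

theorem outB (n m : ℤ) : gcnt (fun f => PF f ∧ f 2 = 1 ∧ f 3 = 0) n m =
    gcnt QB (n - 2 - 4 * (m - 1)) (m - 1) := by
  have key : ∀ s f : ℕ → ℕ, (∀ i, s (i + 4) = f i) → (∀ i < 4, s i = ({2} : Multiset ℕ).count i) →
      ((fun f => PF f ∧ f 2 = 1 ∧ f 3 = 0) s ↔ QB f) := by
    intro s f h hl
    have e0 : s 0 = 0 := by rw [hl 0 (by norm_num)]; decide
    have e1 : s 1 = 0 := by rw [hl 1 (by norm_num)]; decide
    have e2 : s 2 = 1 := by rw [hl 2 (by norm_num)]; decide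
    have e3 : s 3 = 0 := by rw [hl 3 (by norm_num)]; decide
    have h0 : s 4 = f 0 := h 0
    have h1 : s 5 = f 1 := h 1
    have h2 : s 6 = f 2 := h 2
    have h3 : s 7 = f 3 := h 3
    have h4 : s 8 = f 4 := h 4
    have h5 : s 9 = f 5 := h 5
    have h6 : s 10 = f 6 := h 6
    have h7 : s 11 = f 7 := h 7
    have hq : (∀ p, Loc s (p + 3)) ↔ Loc s 3 ∧ QA f := by
      rw [← qa_shift h, ← qa_step s 3]
    unfold QB PF
    beta_reduce
    rw [hq]
    generalize QA f = q
    clear hq h hl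
    simp only [Loc, Loc0, Nat.reduceAdd, e0, e1, e2, e3, h0, h1, h2, h3, h4, h5, h6, h7]
    clear e0 e1 e2 e3 h0 h1 h2 h3 h4 h5 h6 h7
    by_cases hq : q <;> simp [hq] <;> omega
  refine gcnt_transfer {2} 4 (by simp) ?_ key (by simp; try ring) (by simp)
  intro s hs i hi
  obtain ⟨⟨g0, g1, l2, hqa, -⟩, hs⟩ := hs
  replace l2 := loc_weak l2
  have l3 := loc_weak (hqa 0).1
  have l4 := loc_weak (hqa 1).1
  clear hqa
  simp only [Nat.reduceAdd, Nat.zero_add] at l2 l3 l4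
  interval_cases i
  · rw [show ({2} : Multiset ℕ).count 0 = 0 by decide]; omega
  · rw [show ({2} : Multiset ℕ).count 1 = 0 by decide]; omega
  · rw [show ({2} : Multiset ℕ).count 2 = 1 by decide]; omega
  · rw [show ({2} : Multiset ℕ).count 3 = 0 by decide]; omega

theorem outC (n m : ℤ) : gcnt (fun f => PF f ∧ 1 ≤ f 2 ∧ 1 ≤ f 3) n m =
    gcnt QC (n - 5 - 5 * (m - 2)) (m - 2) := by
  have key : ∀ s f : ℕ → ℕ, (∀ i, s (i + 5) = f i) → (∀ i < 5, s i = ({2,3} : Multiset ℕ).count i) →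
      ((fun f => PF f ∧ 1 ≤ f 2 ∧ 1 ≤ f 3) s ↔ QC f) := by
    intro s f h hl
    have e0 : s 0 = 0 := by rw [hl 0 (by norm_num)]; decide
    have e1 : s 1 = 0 := by rw [hl 1 (by norm_num)]; decide
    have e2 : s 2 = 1 := by rw [hl 2 (by norm_num)]; decide
    have e3 : s 3 = 1 := by rw [hl 3 (by norm_num)]; decide
    have e4 : s 4 = 0 := by rw [hl 4 (by norm_num)]; decide
    have h0 : s 5 = f 0 := h 0
    have h1 : s 6 = f 1 := h 1
    have h2 : s 7 = f 2 := h 2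
    have h3 : s 8 = f 3 := h 3
    have h4 : s 9 = f 4 := h 4
    have h5 : s 10 = f 5 := h 5
    have h6 : s 11 = f 6 := h 6
    have h7 : s 12 = f 7 := h 7
    have hq : (∀ p, Loc s (p + 3)) ↔ Loc s 3 ∧ Loc s 4 ∧ QA f := by
      rw [← qa_shift h, ← qa_step s 4, ← qa_step s 3]
    unfold QC PF
    beta_reduce
    rw [hq]
    generalize QA f = q
    clear hq h hl
    simp only [Loc, Loc0, Nat.reduceAdd, e0, e1, e2, e3, e4, h0, h1, h2, h3, h4, h5, h6, h7]
    clear e0 e1 e2 e3 e4 h0 h1 h2 h3 h4 h5 h6 h7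
    by_cases hq : q <;> simp [hq] <;> omega
  refine gcnt_transfer {2,3} 5 (by simp) ?_ key (by simp; try ring) (by simp)
  intro s hs i hi
  obtain ⟨⟨g0, g1, l2, hqa, -⟩, hs⟩ := hs
  replace l2 := loc_weak l2
  have l3 := loc_weak (hqa 0).1
  have l4 := loc_weak (hqa 1).1
  clear hqa
  simp only [Nat.reduceAdd, Nat.zero_add] at l2 l3 l4
  interval_cases i
  · rw [show ({2,3} : Multiset ℕ).count 0 = 0 by decide]; omega
  · rw [show ({2,3} : Multiset ℕ).count 1 = 0 by decide]; omega
  · rw [show ({2,3} : Multiset ℕ).count 2 = 1 by decide]; omega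
  · rw [show ({2,3} : Multiset ℕ).count 3 = 1 by decide]; omega
  · rw [show ({2,3} : Multiset ℕ).count 4 = 0 by decide]; omega

theorem outD (n m : ℤ) : gcnt (fun f => PF f ∧ f 2 = 2 ∧ f 4 = 0) n m =
    gcnt QD (n - 4 - 5 * (m - 2)) (m - 2) := by
  have key : ∀ s f : ℕ → ℕ, (∀ i, s (i + 5) = f i) → (∀ i < 5, s i = ({2,2} : Multiset ℕ).count i) →
      ((fun f => PF f ∧ f 2 = 2 ∧ f 4 = 0) s ↔ QD f) := by
    intro s f h hl
    have e0 : s 0 = 0 := by rw [hl 0 (by norm_num)]; decide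
    have e1 : s 1 = 0 := by rw [hl 1 (by norm_num)]; decide
    have e2 : s 2 = 2 := by rw [hl 2 (by norm_num)]; decide
    have e3 : s 3 = 0 := by rw [hl 3 (by norm_num)]; decide
    have e4 : s 4 = 0 := by rw [hl 4 (by norm_num)]; decide
    have h0 : s 5 = f 0 := h 0
    have h1 : s 6 = f 1 := h 1
    have h2 : s 7 = f 2 := h 2
    have h3 : s 8 = f 3 := h 3
    have h4 : s 9 = f 4 := h 4
    have h5 : s 10 = f 5 := h 5
    have h6 : s 11 = f 6 := h 6
    have h7 : s 12 = f 7 := h 7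
    have hq : (∀ p, Loc s (p + 3)) ↔ Loc s 3 ∧ Loc s 4 ∧ QA f := by
      rw [← qa_shift h, ← qa_step s 4, ← qa_step s 3]
    unfold QD PF
    beta_reduce
    rw [hq]
    generalize QA f = q
    clear hq h hl
    simp only [Loc, Loc0, Nat.reduceAdd, e0, e1, e2, e3, e4, h0, h1, h2, h3, h4, h5, h6, h7]
    clear e0 e1 e2 e3 e4 h0 h1 h2 h3 h4 h5 h6 h7
    by_cases hq : q <;> simp [hq] <;> omega
  refine gcnt_transfer {2,2} 5 (by simp) ?_ key (by simp; try ring) (by simp)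
  intro s hs i hi
  obtain ⟨⟨g0, g1, l2, hqa, -⟩, hs⟩ := hs
  replace l2 := loc_weak l2
  have l3 := loc_weak (hqa 0).1
  have l4 := loc_weak (hqa 1).1
  clear hqa
  simp only [Nat.reduceAdd, Nat.zero_add] at l2 l3 l4
  interval_cases i
  · rw [show ({2,2} : Multiset ℕ).count 0 = 0 by decide]; omega
  · rw [show ({2,2} : Multiset ℕ).count 1 = 0 by decide]; omega
  · rw [show ({2,2} : Multiset ℕ).count 2 = 2 by decide]; omega
  · rw [show ({2,2} : Multiset ℕ).count 3 = 0 by decide]; omega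
  · rw [show ({2,2} : Multiset ℕ).count 4 = 0 by decide]; omega

theorem outE (n m : ℤ) : gcnt (fun f => PF f ∧ f 2 = 2 ∧ 1 ≤ f 4) n m =
    gcnt QC (n - 8 - 6 * (m - 3)) (m - 3) := by
  have key : ∀ s f : ℕ → ℕ, (∀ i, s (i + 6) = f i) → (∀ i < 6, s i = ({2,2,4} : Multiset ℕ).count i) →
      ((fun f => PF f ∧ f 2 = 2 ∧ 1 ≤ f 4) s ↔ QC f) := by
    intro s f h hl
    have e0 : s 0 = 0 := by rw [hl 0 (by norm_num)]; decide
    have e1 : s 1 = 0 := by rw [hl 1 (by norm_num)]; decide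
    have e2 : s 2 = 2 := by rw [hl 2 (by norm_num)]; decide
    have e3 : s 3 = 0 := by rw [hl 3 (by norm_num)]; decide
    have e4 : s 4 = 1 := by rw [hl 4 (by norm_num)]; decide
    have e5 : s 5 = 0 := by rw [hl 5 (by norm_num)]; decide
    have h0 : s 6 = f 0 := h 0
    have h1 : s 7 = f 1 := h 1
    have h2 : s 8 = f 2 := h 2
    have h3 : s 9 = f 3 := h 3
    have h4 : s 10 = f 4 := h 4
    have h5 : s 11 = f 5 := h 5
    have h6 : s 12 = f 6 := h 6
    have h7 : s 13 = f 7 := h 7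
    have hq : (∀ p, Loc s (p + 3)) ↔ Loc s 3 ∧ Loc s 4 ∧ Loc s 5 ∧ QA f := by
      rw [← qa_shift h, ← qa_step s 5, ← qa_step s 4, ← qa_step s 3]
    unfold QC PF
    beta_reduce
    rw [hq]
    generalize QA f = q
    clear hq h hl
    simp only [Loc, Loc0, Nat.reduceAdd, e0, e1, e2, e3, e4, e5, h0, h1, h2, h3, h4, h5, h6, h7]
    clear e0 e1 e2 e3 e4 e5 h0 h1 h2 h3 h4 h5 h6 h7
    by_cases hq : q <;> simp [hq] <;> omega
  refine gcnt_transfer {2,2,4} 6 (by simp) ?_ key (by simp; try ring) (by simp)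
  intro s hs i hi
  obtain ⟨⟨g0, g1, l2, hqa, x0, -⟩, hs⟩ := hs
  replace l2 := loc_weak l2
  have l3 := loc_weak (hqa 0).1
  have l4 := loc_weak (hqa 1).1
  clear hqa
  simp only [Nat.reduceAdd, Nat.zero_add] at l2 l3 l4
  interval_cases i
  · rw [show ({2,2,4} : Multiset ℕ).count 0 = 0 by decide]; omega
  · rw [show ({2,2,4} : Multiset ℕ).count 1 = 0 by decide]; omega
  · rw [show ({2,2,4} : Multiset ℕ).count 2 = 2 by decide]; omega
  · rw [show ({2,2,4} : Multiset ℕ).count 3 = 0 by decide]; omega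
  · rw [show ({2,2,4} : Multiset ℕ).count 4 = 1 by decide]; omega
  · rw [show ({2,2,4} : Multiset ℕ).count 5 = 0 by decide]; omega

theorem inA0 (n m : ℤ) : gcnt (fun f => QA f ∧ f 0 = 0) n m =
    gcnt QA (n - 0 - 1 * (m - 0)) (m - 0) := by
  have key : ∀ s f : ℕ → ℕ, (∀ i, s (i + 1) = f i) → (∀ i < 1, s i = (0 : Multiset ℕ).count i) →
      ((fun f => QA f ∧ f 0 = 0) s ↔ QA f) := by
    intro s f h hl
    have e0 : s 0 = 0 := by rw [hl 0 (by norm_num)]; decide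
    have h0 : s 1 = f 0 := h 0
    have h1 : s 2 = f 1 := h 1
    have h2 : s 3 = f 2 := h 2
    have h3 : s 4 = f 3 := h 3
    have h4 : s 5 = f 4 := h 4
    have h5 : s 6 = f 5 := h 5
    have h6 : s 7 = f 6 := h 6
    have h7 : s 8 = f 7 := h 7
    have hq : (QA s) ↔ Loc s 0 ∧ QA f := by
      rw [← qa_shift h, ← qa_step s 0]; rfl
    beta_reduce
    rw [hq]
    generalize QA f = q
    clear hq h hl
    simp only [Loc, Loc0, Nat.reduceAdd, e0, h0, h1, h2, h3, h4, h5, h6, h7]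
    clear e0 h0 h1 h2 h3 h4 h5 h6 h7
    by_cases hq : q <;> simp [hq] <;> omega
  refine gcnt_transfer 0 1 (by simp) ?_ key (by simp; try ring) (by simp)
  intro s hs i hi
  obtain ⟨hqa, hs⟩ := hs
  have l0 := loc_weak (hqa 0).1
  have l1 := loc_weak (hqa 1).1
  have l2 := (hqa 0).2
  clear hqa
  simp only [Nat.reduceAdd, Nat.zero_add] at l0 l1 l2
  interval_cases i
  · rw [show (0 : Multiset ℕ).count 0 = 0 by decide]; omega

theorem inA1 (n m : ℤ) : gcnt (fun f => QA f ∧ f 0 = 1 ∧ f 1 = 0) n m =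
    gcnt QB (n - 0 - 2 * (m - 1)) (m - 1) := by
  have key : ∀ s f : ℕ → ℕ, (∀ i, s (i + 2) = f i) → (∀ i < 2, s i = ({0} : Multiset ℕ).count i) →
      ((fun f => QA f ∧ f 0 = 1 ∧ f 1 = 0) s ↔ QB f) := by
    intro s f h hl
    have e0 : s 0 = 1 := by rw [hl 0 (by norm_num)]; decide
    have e1 : s 1 = 0 := by rw [hl 1 (by norm_num)]; decide
    have h0 : s 2 = f 0 := h 0
    have h1 : s 3 = f 1 := h 1
    have h2 : s 4 = f 2 := h 2
    have h3 : s 5 = f 3 := h 3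
    have h4 : s 6 = f 4 := h 4
    have h5 : s 7 = f 5 := h 5
    have h6 : s 8 = f 6 := h 6
    have h7 : s 9 = f 7 := h 7
    have hq : (QA s) ↔ Loc s 0 ∧ Loc s 1 ∧ QA f := by
      rw [← qa_shift h, ← qa_step s 1, ← qa_step s 0]; rfl
    unfold QB
    beta_reduce
    rw [hq]
    generalize QA f = q
    clear hq h hl
    simp only [Loc, Loc0, Nat.reduceAdd, e0, e1, h0, h1, h2, h3, h4, h5, h6, h7]
    clear e0 e1 h0 h1 h2 h3 h4 h5 h6 h7
    by_cases hq : q <;> simp [hq] <;> omega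
  refine gcnt_transfer {0} 2 (by simp) ?_ key (by simp; try ring) (by simp)
  intro s hs i hi
  obtain ⟨hqa, hs⟩ := hs
  have l0 := loc_weak (hqa 0).1
  have l1 := loc_weak (hqa 1).1
  have l2 := (hqa 0).2
  clear hqa
  simp only [Nat.reduceAdd, Nat.zero_add] at l0 l1 l2
  interval_cases i
  · rw [show ({0} : Multiset ℕ).count 0 = 1 by decide]; omega
  · rw [show ({0} : Multiset ℕ).count 1 = 0 by decide]; omega

theorem inA2 (n m : ℤ) : gcnt (fun f => QA f ∧ 1 ≤ f 0 ∧ 1 ≤ f 1) n m =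
    gcnt QC (n - 1 - 3 * (m - 2)) (m - 2) := by
  have key : ∀ s f : ℕ → ℕ, (∀ i, s (i + 3) = f i) → (∀ i < 3, s i = ({0,1} : Multiset ℕ).count i) →
      ((fun f => QA f ∧ 1 ≤ f 0 ∧ 1 ≤ f 1) s ↔ QC f) := by
    intro s f h hl
    have e0 : s 0 = 1 := by rw [hl 0 (by norm_num)]; decide
    have e1 : s 1 = 1 := by rw [hl 1 (by norm_num)]; decide
    have e2 : s 2 = 0 := by rw [hl 2 (by norm_num)]; decide
    have h0 : s 3 = f 0 := h 0
    have h1 : s 4 = f 1 := h 1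
    have h2 : s 5 = f 2 := h 2
    have h3 : s 6 = f 3 := h 3
    have h4 : s 7 = f 4 := h 4
    have h5 : s 8 = f 5 := h 5
    have h6 : s 9 = f 6 := h 6
    have h7 : s 10 = f 7 := h 7
    have hq : (QA s) ↔ Loc s 0 ∧ Loc s 1 ∧ Loc s 2 ∧ QA f := by
      rw [← qa_shift h, ← qa_step s 2, ← qa_step s 1, ← qa_step s 0]; rfl
    unfold QC
    beta_reduce
    rw [hq]
    generalize QA f = q
    clear hq h hl
    simp only [Loc, Loc0, Nat.reduceAdd, e0, e1, e2, h0, h1, h2, h3, h4, h5, h6, h7]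
    clear e0 e1 e2 h0 h1 h2 h3 h4 h5 h6 h7
    by_cases hq : q <;> simp [hq] <;> omega
  refine gcnt_transfer {0,1} 3 (by simp) ?_ key (by simp; try ring) (by simp)
  intro s hs i hi
  obtain ⟨hqa, hs⟩ := hs
  have l0 := loc_weak (hqa 0).1
  have l1 := loc_weak (hqa 1).1
  have l2 := (hqa 0).2
  clear hqa
  simp only [Nat.reduceAdd, Nat.zero_add] at l0 l1 l2
  interval_cases i
  · rw [show ({0,1} : Multiset ℕ).count 0 = 1 by decide]; omega
  · rw [show ({0,1} : Multiset ℕ).count 1 = 1 by decide]; omega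
  · rw [show ({0,1} : Multiset ℕ).count 2 = 0 by decide]; omega

theorem inA3 (n m : ℤ) : gcnt (fun f => QA f ∧ 2 ≤ f 0) n m =
    gcnt QD (n - 0 - 3 * (m - 2)) (m - 2) := by
  have key : ∀ s f : ℕ → ℕ, (∀ i, s (i + 3) = f i) → (∀ i < 3, s i = ({0,0} : Multiset ℕ).count i) →
      ((fun f => QA f ∧ 2 ≤ f 0) s ↔ QD f) := by
    intro s f h hl
    have e0 : s 0 = 2 := by rw [hl 0 (by norm_num)]; decide
    have e1 : s 1 = 0 := by rw [hl 1 (by norm_num)]; decide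
    have e2 : s 2 = 0 := by rw [hl 2 (by norm_num)]; decide
    have h0 : s 3 = f 0 := h 0
    have h1 : s 4 = f 1 := h 1
    have h2 : s 5 = f 2 := h 2
    have h3 : s 6 = f 3 := h 3
    have h4 : s 7 = f 4 := h 4
    have h5 : s 8 = f 5 := h 5
    have h6 : s 9 = f 6 := h 6
    have h7 : s 10 = f 7 := h 7
    have hq : (QA s) ↔ Loc s 0 ∧ Loc s 1 ∧ Loc s 2 ∧ QA f := by
      rw [← qa_shift h, ← qa_step s 2, ← qa_step s 1, ← qa_step s 0]; rfl
    unfold QD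
    beta_reduce
    rw [hq]
    generalize QA f = q
    clear hq h hl
    simp only [Loc, Loc0, Nat.reduceAdd, e0, e1, e2, h0, h1, h2, h3, h4, h5, h6, h7]
    clear e0 e1 e2 h0 h1 h2 h3 h4 h5 h6 h7
    by_cases hq : q <;> simp [hq] <;> omega
  refine gcnt_transfer {0,0} 3 (by simp) ?_ key (by simp; try ring) (by simp)
  intro s hs i hi
  obtain ⟨hqa, hs⟩ := hs
  have l0 := loc_weak (hqa 0).1
  have l1 := loc_weak (hqa 1).1
  have l2 := (hqa 0).2
  clear hqa
  simp only [Nat.reduceAdd, Nat.zero_add] at l0 l1 l2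
  interval_cases i
  · rw [show ({0,0} : Multiset ℕ).count 0 = 2 by decide]; omega
  · rw [show ({0,0} : Multiset ℕ).count 1 = 0 by decide]; omega
  · rw [show ({0,0} : Multiset ℕ).count 2 = 0 by decide]; omega

theorem inC0 (n m : ℤ) : gcnt (fun f => QC f ∧ f 0 = 0) n m =
    gcnt QB (n - 0 - 1 * (m - 0)) (m - 0) := by
  have key : ∀ s f : ℕ → ℕ, (∀ i, s (i + 1) = f i) → (∀ i < 1, s i = (0 : Multiset ℕ).count i) →
      ((fun f => QC f ∧ f 0 = 0) s ↔ QB f) := by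
    intro s f h hl
    have e0 : s 0 = 0 := by rw [hl 0 (by norm_num)]; decide
    have h0 : s 1 = f 0 := h 0
    have h1 : s 2 = f 1 := h 1
    have h2 : s 3 = f 2 := h 2
    have h3 : s 4 = f 3 := h 3
    have h4 : s 5 = f 4 := h 4
    have h5 : s 6 = f 5 := h 5
    have h6 : s 7 = f 6 := h 6
    have h7 : s 8 = f 7 := h 7
    have hq : (QA s) ↔ Loc s 0 ∧ QA f := by
      rw [← qa_shift h, ← qa_step s 0]; rfl
    unfold QB QC
    beta_reduce
    rw [hq]
    generalize QA f = q
    clear hq h hl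
    simp only [Loc, Loc0, Nat.reduceAdd, e0, h0, h1, h2, h3, h4, h5, h6, h7]
    clear e0 h0 h1 h2 h3 h4 h5 h6 h7
    by_cases hq : q <;> simp [hq] <;> omega
  refine gcnt_transfer 0 1 (by simp) ?_ key (by simp; try ring) (by simp)
  intro s hs i hi
  unfold QC at hs
  obtain ⟨⟨hqa, hs1⟩, hs⟩ := hs
  have l0 := loc_weak (hqa 0).1
  have l1 := loc_weak (hqa 1).1
  have l2 := (hqa 0).2
  clear hqa
  simp only [Nat.reduceAdd, Nat.zero_add] at l0 l1 l2
  interval_cases i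
  · rw [show (0 : Multiset ℕ).count 0 = 0 by decide]; omega

theorem inC1 (n m : ℤ) : gcnt (fun f => QC f ∧ ¬ f 0 = 0) n m =
    gcnt QD (n - 0 - 2 * (m - 1)) (m - 1) := by
  have key : ∀ s f : ℕ → ℕ, (∀ i, s (i + 2) = f i) → (∀ i < 2, s i = ({0} : Multiset ℕ).count i) →
      ((fun f => QC f ∧ ¬ f 0 = 0) s ↔ QD f) := by
    intro s f h hl
    have e0 : s 0 = 1 := by rw [hl 0 (by norm_num)]; decide
    have e1 : s 1 = 0 := by rw [hl 1 (by norm_num)]; decide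
    have h0 : s 2 = f 0 := h 0
    have h1 : s 3 = f 1 := h 1
    have h2 : s 4 = f 2 := h 2
    have h3 : s 5 = f 3 := h 3
    have h4 : s 6 = f 4 := h 4
    have h5 : s 7 = f 5 := h 5
    have h6 : s 8 = f 6 := h 6
    have h7 : s 9 = f 7 := h 7
    have hq : (QA s) ↔ Loc s 0 ∧ Loc s 1 ∧ QA f := by
      rw [← qa_shift h, ← qa_step s 1, ← qa_step s 0]; rfl
    unfold QC QD
    beta_reduce
    rw [hq]
    generalize QA f = q
    clear hq h hl
    simp only [Loc, Loc0, Nat.reduceAdd, e0, e1, h0, h1, h2, h3, h4, h5, h6, h7]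
    clear e0 e1 h0 h1 h2 h3 h4 h5 h6 h7
    by_cases hq : q <;> simp [hq] <;> omega
  refine gcnt_transfer {0} 2 (by simp) ?_ key (by simp; try ring) (by simp)
  intro s hs i hi
  unfold QC at hs
  obtain ⟨⟨hqa, hs1⟩, hs⟩ := hs
  have l0 := loc_weak (hqa 0).1
  have l1 := loc_weak (hqa 1).1
  have l2 := (hqa 0).2
  clear hqa
  simp only [Nat.reduceAdd, Nat.zero_add] at l0 l1 l2
  interval_cases i
  · rw [show ({0} : Multiset ℕ).count 0 = 1 by decide]; omega
  · rw [show ({0} : Multiset ℕ).count 1 = 0 by decide]; omega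

theorem le_iff_mem (mu s : Multiset ℕ) : mu ≤ s ↔ ∀ x ∈ mu, mu.count x ≤ s.count x := by
  rw [Multiset.le_iff_count]
  constructor
  · intro h x _; exact h x
  · intro h x
    by_cases hx : x ∈ mu
    · exact h x hx
    · rw [Multiset.count_eq_zero_of_notMem hx]; exact Nat.zero_le _

theorem forb_iff (s : Multiset ℕ) : (∀ mu ∈ Forbidden, ¬ mu ≤ s) ↔
    (∀ p : ℕ, 2 ≤ p →
      (¬ {p, p, p} ≤ s ∧ ¬ {p + 1, p, p} ≤ s ∧ ¬ {p + 1, p + 1, p} ≤ s ∧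
       ¬ {p + 2, p + 1, p} ≤ s ∧ ¬ {p + 2, p + 2, p} ≤ s ∧
       ¬ {p + 3, p + 3, p, p} ≤ s ∧ ¬ {p + 4, p + 3, p, p} ≤ s ∧
       ¬ {p + 4, p + 3, p + 1, p} ≤ s ∧ ¬ {p + 4, p + 4, p + 1, p} ≤ s ∧
       ¬ {p + 6, p + 5, p + 3, p + 1, p} ≤ s)) ∧
    (∀ p : ℕ, 3 ≤ p → ¬ {p + 2, p, p} ≤ s) ∧
    ¬ {5, 4, 2, 2} ≤ s ∧ ¬ {7, 6, 4, 2, 2} ≤ s ∧ ¬ {7, 7, 4, 2, 2} ≤ s ∧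
    ¬ {9, 8, 6, 4, 2, 2} ≤ s := by
  constructor
  · intro h
    refine ⟨fun p hp => ?_, fun p hp => h _ (Or.inr (Or.inl ⟨p, hp, rfl⟩)), ?_, ?_, ?_, ?_⟩
    · refine ⟨?_, ?_, ?_, ?_, ?_, ?_, ?_, ?_, ?_, ?_⟩ <;>
        refine h _ (Or.inl ⟨p, hp, ?_⟩) <;> tauto
    all_goals exact h _ (Or.inr (Or.inr (by tauto)))
  · rintro ⟨h1, h2, h3, h4, h5, h6⟩ mu (⟨p, hp, hm⟩ | ⟨p, hp, rfl⟩ | rfl | rfl | rfl | rfl)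
    · obtain ⟨k1, k2, k3, k4, k5, k6, k7, k8, k9, k10⟩ := h1 p hp
      rcases hm with rfl | rfl | rfl | rfl | rfl | rfl | rfl | rfl | rfl | rfl <;> assumption
    · exact h2 p hp
    all_goals assumption

theorem memP_iff {n : ℕ} (l : n.Partition) : MemP l ↔ PF (fun i => l.parts.count i) := by
  unfold MemP
  rw [forb_iff]
  generalize l.parts = s
  have hloc : ∀ p, (¬ {p, p, p} ≤ s ∧ ¬ {p + 1, p, p} ≤ s ∧ ¬ {p + 1, p + 1, p} ≤ s ∧
       ¬ {p + 2, p + 1, p} ≤ s ∧ ¬ {p + 2, p + 2, p} ≤ s ∧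
       ¬ {p + 3, p + 3, p, p} ≤ s ∧ ¬ {p + 4, p + 3, p, p} ≤ s ∧
       ¬ {p + 4, p + 3, p + 1, p} ≤ s ∧ ¬ {p + 4, p + 4, p + 1, p} ≤ s ∧
       ¬ {p + 6, p + 5, p + 3, p + 1, p} ≤ s) ↔ Loc0 (fun i => s.count i) p := by
    intro p
    unfold Loc0
    refine and_congr ?_ (and_congr ?_ (and_congr ?_ (and_congr ?_ (and_congr ?_ (and_congr ?_
      (and_congr ?_ (and_congr ?_ (and_congr ?_ ?_))))))))
    all_goals
      rw [le_iff_mem]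
      simp [Multiset.count_cons, Multiset.count_singleton, -Multiset.count_eq_zero]
      try omega
  have hloc2 : ∀ p, ¬ {p + 2, p, p} ≤ s ↔ ¬ (2 ≤ s.count p ∧ 1 ≤ s.count (p+2)) := by
    intro p
    rw [le_iff_mem]
    simp [Multiset.count_cons, Multiset.count_singleton, -Multiset.count_eq_zero]
    try omega
  have s1 : ¬ {5, 4, 2, 2} ≤ s ↔ ¬ (2 ≤ s.count 2 ∧ 1 ≤ s.count 4 ∧ 1 ≤ s.count 5) := by
    rw [le_iff_mem]
    simp [Multiset.count_cons, Multiset.count_singleton, -Multiset.count_eq_zero]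
    try omega
  have s2 : ¬ {7, 6, 4, 2, 2} ≤ s ↔
      ¬ (2 ≤ s.count 2 ∧ 1 ≤ s.count 4 ∧ 1 ≤ s.count 6 ∧ 1 ≤ s.count 7) := by
    rw [le_iff_mem]
    simp [Multiset.count_cons, Multiset.count_singleton, -Multiset.count_eq_zero]
    try omega
  have s3 : ¬ {7, 7, 4, 2, 2} ≤ s ↔ ¬ (2 ≤ s.count 2 ∧ 1 ≤ s.count 4 ∧ 2 ≤ s.count 7) := by
    rw [le_iff_mem]
    simp [Multiset.count_cons, Multiset.count_singleton, -Multiset.count_eq_zero]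
    try omega
  have s4 : ¬ {9, 8, 6, 4, 2, 2} ≤ s ↔
      ¬ (2 ≤ s.count 2 ∧ 1 ≤ s.count 4 ∧ 1 ≤ s.count 6 ∧ 1 ≤ s.count 8 ∧ 1 ≤ s.count 9) := by
    rw [le_iff_mem]
    simp [Multiset.count_cons, Multiset.count_singleton, -Multiset.count_eq_zero]
    try omega
  have h01 : (∀ i ∈ s, 2 ≤ i) ↔ s.count 0 = 0 ∧ s.count 1 = 0 := by
    rw [Multiset.count_eq_zero, Multiset.count_eq_zero]
    constructor
    · intro h
      exact ⟨fun h' => absurd (h _ h') (by norm_num), fun h' => absurd (h _ h') (by norm_num)⟩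
    · rintro ⟨h0, h1⟩ i hi
      by_contra hc
      interval_cases i
      · exact h0 hi
      · exact h1 hi
  unfold PF
  rw [s1, s2, s3, s4, h01]
  simp only [hloc, hloc2]
  constructor
  · rintro ⟨⟨a0, a1⟩, b, c, d⟩
    exact ⟨a0, a1, b 2 le_rfl, fun p => ⟨b _ (by omega), c _ (by omega)⟩, d⟩
  · rintro ⟨a0, a1, b, c, d⟩
    refine ⟨⟨a0, a1⟩, fun p hp => ?_, fun p hp => ?_, d⟩
    · rcases hp.eq_or_lt with rfl | hp
      · exact b
      · obtain ⟨q, rfl⟩ := Nat.exists_eq_add_of_le' hp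
        exact (c q).1
    · obtain ⟨q, rfl⟩ := Nat.exists_eq_add_of_le' hp
      exact (c q).2

/-- counts of the sorted list -/
theorem sparts_spec {n : ℕ} (l : n.Partition) :
    (sparts l).Pairwise (· ≤ ·) ∧ ∀ i, l.parts.count i = (sparts l).count i := by
  refine ⟨Multiset.pairwise_sort _ _, fun i => ?_⟩
  rw [← Multiset.coe_count, sparts, Multiset.sort_eq]

theorem count_zero_of_lt {L : List ℕ} {x i : ℕ} (h : ∀ y ∈ L, x ≤ y) (hi : i < x) :
    L.count i = 0 := List.count_eq_zero_of_not_mem fun h' => by have := h _ h'; omega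

theorem listB {L : List ℕ} (hL : L.Pairwise (· ≤ ·)) (h2 : L.count 0 = 0 ∧ L.count 1 = 0) :
    (L[0]? = some 2 ∧ (L.length = 1 ∨ ∃ x, L[1]? = some x ∧ 3 < x)) ↔
      L.count 2 = 1 ∧ L.count 3 = 0 := by
  rcases L with _ | ⟨x, _ | ⟨y, t⟩⟩
  · simp
  · simp [List.count_cons]; grind
  · have ht := (List.pairwise_cons.1 (List.pairwise_cons.1 hL).2).1
    have hx := (List.pairwise_cons.1 hL).1 y (by simp)
    have z2 : 2 < y → t.count 2 = 0 := fun h => count_zero_of_lt ht h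
    have z3 : 3 < y → t.count 3 = 0 := fun h => count_zero_of_lt ht h
    simp [List.count_cons] at h2 ⊢
    grind

theorem listC {L : List ℕ} (hL : L.Pairwise (· ≤ ·)) (h2 : L.count 0 = 0 ∧ L.count 1 = 0)
    (h3 : ¬ (2 ≤ L.count 2 ∧ 1 ≤ L.count 3)) :
    (L[0]? = some 2 ∧ L[1]? = some 3) ↔ 1 ≤ L.count 2 ∧ 1 ≤ L.count 3 := by
  rcases L with _ | ⟨x, _ | ⟨y, t⟩⟩
  · simp
  · simp [List.count_cons, -List.one_le_count_iff]; grind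
  · have ht := (List.pairwise_cons.1 (List.pairwise_cons.1 hL).2).1
    have hx := (List.pairwise_cons.1 hL).1 y (by simp)
    have z2 : 2 < y → t.count 2 = 0 := fun h => count_zero_of_lt ht h
    have z3 : 3 < y → t.count 3 = 0 := fun h => count_zero_of_lt ht h
    simp [List.count_cons, -List.one_le_count_iff] at h2 h3 ⊢
    grind

theorem listDE {L : List ℕ} (hL : L.Pairwise (· ≤ ·)) (h2 : L.count 0 = 0 ∧ L.count 1 = 0)
    (h3 : ¬ (2 ≤ L.count 2 ∧ 1 ≤ L.count 3)) (h4 : L.count 2 ≤ 2) :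
    ((L[0]? = some 2 ∧ L[1]? = some 2 ∧ (L.length = 2 ∨ ∃ x, L[2]? = some x ∧ 4 < x)) ↔
      L.count 2 = 2 ∧ L.count 4 = 0) ∧ 
    ((L[0]? = some 2 ∧ L[1]? = some 2 ∧ L[2]? = some 4) ↔
      L.count 2 = 2 ∧ 1 ≤ L.count 4) := by
  rcases L with _ | ⟨x, _ | ⟨y, _ | ⟨z, t⟩⟩⟩
  · simp
  · simp [List.count_cons, -List.one_le_count_iff]; grind
  · have hx := (List.pairwise_cons.1 hL).1 y (by simp)
    simp [List.count_cons, -List.one_le_count_iff] at h2 h3 h4 ⊢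
    grind
  · have ht := (List.pairwise_cons.1 (List.pairwise_cons.1 (List.pairwise_cons.1 hL).2).2).1
    have hx := (List.pairwise_cons.1 hL).1 y (by simp)
    have hy := (List.pairwise_cons.1 (List.pairwise_cons.1 hL).2).1 z (by simp)
    have z2 : 2 < z → t.count 2 = 0 := fun h => count_zero_of_lt ht h
    have z3 : 3 < z → t.count 3 = 0 := fun h => count_zero_of_lt ht h
    have z4 : 4 < z → t.count 4 = 0 := fun h => count_zero_of_lt ht h
    simp [List.count_cons, -List.one_le_count_iff] at h2 h3 h4 ⊢
    grind

theorem memA_iff {n : ℕ} (l : n.Partition) :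
    MemA l ↔ PF (fun i => l.parts.count i) ∧ l.parts.count 2 = 0 := by
  unfold MemA
  rw [memP_iff]
  refine and_congr_right fun h => ?_
  obtain ⟨h0, h1, -⟩ := h
  rw [Multiset.count_eq_zero] at h0 h1 ⊢
  constructor
  · intro h h'; exact absurd (h _ h') (by norm_num)
  · intro h i hi
    by_contra hc
    interval_cases i <;> contradiction

theorem memB_iff {n : ℕ} (l : n.Partition) :
    MemB l ↔ PF (fun i => l.parts.count i) ∧ l.parts.count 2 = 1 ∧ l.parts.count 3 = 0 := by
  unfold MemB
  rw [memP_iff]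
  refine and_congr_right fun h => ?_
  obtain ⟨h0, h1, hl, -⟩ := h
  obtain ⟨hp, hc⟩ := sparts_spec l
  simp only [hc] at *
  exact listB hp ⟨h0, h1⟩

theorem memC_iff {n : ℕ} (l : n.Partition) :
    MemC l ↔ PF (fun i => l.parts.count i) ∧ 1 ≤ l.parts.count 2 ∧ 1 ≤ l.parts.count 3 := by
  unfold MemC
  rw [memP_iff]
  refine and_congr_right fun h => ?_
  obtain ⟨h0, h1, hl, -⟩ := h
  obtain ⟨hp, hc⟩ := sparts_spec l
  simp only [hc] at *
  exact listC hp ⟨h0, h1⟩ hl.2.1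

theorem memD_iff {n : ℕ} (l : n.Partition) :
    MemD l ↔ PF (fun i => l.parts.count i) ∧ l.parts.count 2 = 2 ∧ l.parts.count 4 = 0 := by
  unfold MemD
  rw [memP_iff]
  refine and_congr_right fun h => ?_
  obtain ⟨h0, h1, hl, -⟩ := h
  obtain ⟨hp, hc⟩ := sparts_spec l
  simp only [hc] at *
  exact (listDE hp ⟨h0, h1⟩ hl.2.1 hl.1).1

theorem memE_iff {n : ℕ} (l : n.Partition) :
    MemE l ↔ PF (fun i => l.parts.count i) ∧ l.parts.count 2 = 2 ∧ 1 ≤ l.parts.count 4 := by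
  unfold MemE
  rw [memP_iff]
  refine and_congr_right fun h => ?_
  obtain ⟨h0, h1, hl, -⟩ := h
  obtain ⟨hp, hc⟩ := sparts_spec l
  simp only [hc] at *
  exact (listDE hp ⟨h0, h1⟩ hl.2.1 hl.1).2

theorem cnt_eq_gcnt (S : {n : ℕ} → n.Partition → Prop) (F : (ℕ → ℕ) → Prop)
    (h0 : ∀ f, F f → f 0 = 0)
    (h : ∀ {n : ℕ} (l : n.Partition), S l ↔ F (fun i => l.parts.count i)) (n m : ℤ) :
    cnt (fun {_} l => S l) n m = gcnt F n m := by
  unfold cnt gcnt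
  split_ifs with hnm
  · obtain ⟨hn, hm⟩ := hnm
    congr 1
    refine Nat.card_eq_of_bijective (fun l => ⟨l.1.parts, (h _).1 l.2.1, ?_, ?_⟩) ⟨?_, ?_⟩
    · rw [l.1.parts_sum]; omega
    · rw [l.2.2]; omega
    · intro l l' hl
      have := congrArg Subtype.val hl
      exact Subtype.ext (Nat.Partition.ext this)
    · rintro ⟨s, hF, hs, hc⟩
      have hz : 0 ∉ s := Multiset.count_eq_zero.1 (h0 _ hF)
      refine ⟨⟨⟨s, fun {i} hi => Nat.pos_of_ne_zero fun e => hz (e ▸ hi), by omega⟩,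
        (h _).2 hF, ?_⟩, rfl⟩
      change Multiset.card s = _
      omega
  · have : IsEmpty {s : Multiset ℕ // F (fun i => s.count i) ∧ (s.sum : ℤ) = n ∧
        (Multiset.card s : ℤ) = m} := ⟨fun s => hnm (by
          obtain ⟨s, -, h1, h2⟩ := s
          constructor <;> omega)⟩
    rw [Nat.card_of_isEmpty]; rfl

theorem aEq (n m : ℤ) : aCnt n m = gcnt QA (n - 0 - 3 * (m - 0)) (m - 0) :=
  (cnt_eq_gcnt _ _ (fun _ h => h.1.1) memA_iff n m).trans (outA n m)
theorem bEq (n m : ℤ) : bCnt n m = gcnt QB (n - 2 - 4 * (m - 1)) (m - 1) :=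
  (cnt_eq_gcnt _ _ (fun _ h => h.1.1) memB_iff n m).trans (outB n m)
theorem cEq (n m : ℤ) : cCnt n m = gcnt QC (n - 5 - 5 * (m - 2)) (m - 2) :=
  (cnt_eq_gcnt _ _ (fun _ h => h.1.1) memC_iff n m).trans (outC n m)
theorem dEq (n m : ℤ) : dCnt n m = gcnt QD (n - 4 - 5 * (m - 2)) (m - 2) :=
  (cnt_eq_gcnt _ _ (fun _ h => h.1.1) memD_iff n m).trans (outD n m)
theorem eEq (n m : ℤ) : eCnt n m = gcnt QC (n - 8 - 6 * (m - 3)) (m - 3) :=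
  (cnt_eq_gcnt _ _ (fun _ h => h.1.1) memE_iff n m).trans (outE n m)

theorem splitAB (n m : ℤ) : gcnt QA n m = gcnt QB n m + gcnt (fun f => QA f ∧ 2 ≤ f 0) n m := by
  rw [gcnt_split QA (fun f => f 0 ≤ 1)]
  congr 1
  exact gcnt_congr (fun f => and_congr_right fun _ => by omega) n m

theorem splitBD (n m : ℤ) :
    gcnt QB n m = gcnt QD n m + gcnt (fun f => QA f ∧ 1 ≤ f 0 ∧ 1 ≤ f 1) n m := by
  rw [gcnt_split QB (fun f => ¬ (1 ≤ f 0 ∧ 1 ≤ f 1))]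
  congr 1
  · exact gcnt_congr (fun f => and_assoc) n m
  · refine gcnt_congr (fun f => ?_) n m
    unfold QB
    constructor
    · rintro ⟨⟨h, -⟩, h'⟩; exact ⟨h, not_not.1 h'⟩
    · rintro ⟨h, h'⟩
      have := loc_weak (h 0).1
      simp only [Nat.zero_add] at this
      exact ⟨⟨h, by omega⟩, not_not.2 h'⟩

theorem splitD (n m : ℤ) :
    gcnt QD n m = gcnt (fun f => QA f ∧ f 0 = 0) n m +
      gcnt (fun f => QA f ∧ f 0 = 1 ∧ f 1 = 0) n m := by
  rw [gcnt_split QD (fun f => f 0 = 0)]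
  unfold QD
  congr 1
  · exact gcnt_congr (fun f => by rw [and_assoc]; exact and_congr_right fun _ => by omega) n m
  · exact gcnt_congr (fun f => by rw [and_assoc]; exact and_congr_right fun _ => by omega) n m

theorem gcnt_args {F : (ℕ → ℕ) → Prop} {a b c d : ℤ} (h1 : a = c) (h2 : b = d) :
    gcnt F a b = gcnt F c d := by rw [h1, h2]

/-- the recurrences satisfied by `a, b, c, d, e`. -/
theorem ising_partition_recurrences (n m : ℕ) :
    aCnt n m = aCnt (n - m) m + bCnt (n - m) m + cCnt (n - m) m + dCnt (n - m) m ∧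
    bCnt n m = aCnt (n - m - 1) (m - 1) - dCnt (n - 2 * m) (m - 1) ∧
    cCnt n m = bCnt (n - 2 * m + 1) (m - 1) + dCnt (n - 2 * m) (m - 1) ∧
    dCnt n m = bCnt (n - m) (m - 1) - eCnt (n - 2 * m + 1) (m - 1) ∧
    eCnt n m = cCnt (n - m) (m - 1) := by

  simp only [aEq, bEq, cEq, dEq, eEq]
  refine ⟨?_, ?_, ?_, ?_, ?_⟩
  · rw [splitAB, splitBD, splitD, inA0, inA1, inA2, inA3]
    have e : ∀ a b c d a' b' c' d' : ℤ, a = a' → b = b' → c = c' → d = d' →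
        a + b + c + d = a' + b' + c' + d' := by intros; subst_vars; rfl
    apply e <;> apply gcnt_args <;> ring
  · rw [eq_sub_iff_add_eq]
    symm
    rw [splitAB, inA3]
    congr 1 <;> apply gcnt_args <;> ring
  · rw [gcnt_split QC (fun f => f 0 = 0), inC0, inC1]
    congr 1 <;> apply gcnt_args <;> ring
  · rw [eq_sub_iff_add_eq]
    symm
    rw [splitBD, inA2]
    congr 1 <;> apply gcnt_args <;> ring
  · apply gcnt_args <;> ring
end

section
/- For every n ≥ 0, S_n = T_n as polynomials in ℤ[q]. -/
open PowerSeries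

/-- `(q)_n = ∏_{j=1}^n (1 - q^j)` in `ℤ⟦q⟧`. -/
noncomputable def qPoch (n : ℕ) : PowerSeries ℤ :=
  ∏ j ∈ Finset.range n, (1 - (X : PowerSeries ℤ) ^ (j + 1))

/-- The multiplicative inverse of `(q)_n` in `ℤ⟦q⟧` (its constant term is `1`). -/
noncomputable def qPochInv (n : ℕ) : PowerSeries ℤ := invOfUnit (qPoch n) 1

/-- The Gaussian binomial coefficient `binom(m,k)_q = (q)_m/((q)_k (q)_{m-k})`
for integer arguments `0 ≤ k ≤ m`, and `0` for negative or out-of-range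
arguments.  (It is a polynomial in `q`; we regard it inside `ℤ⟦q⟧`.) -/
noncomputable def qBinom (m k : ℤ) : PowerSeries ℤ :=
  if 0 ≤ k ∧ k ≤ m then qPoch m.toNat * qPochInv k.toNat * qPochInv (m - k).toNat else 0

/-- `S_n = ∑_{k≥0} q^{2k²} binom(n-k, 2k)_q`; all summands with `k > n` vanish,
so the sum is taken over `k ≤ n`. -/
noncomputable def S (n : ℕ) : PowerSeries ℤ :=
  ∑ k ∈ Finset.range (n + 1),
    (X : PowerSeries ℤ) ^ (2 * k ^ 2) * qBinom ((n : ℤ) - k) (2 * k)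

/-- `T_n = ∑_{m,k≥0} q^{m²+3km+4k²} (binom(n-3k-m,k)_q binom(n-4k-m,m)_q
- q^k binom(n-3k-m-1,k)_q binom(n-4k-m-1,m-1)_q)`; all summands with `m > n` or
`k > n` vanish, so the sum is taken over `m, k ≤ n`. -/
noncomputable def T (n : ℕ) : PowerSeries ℤ :=
  ∑ m ∈ Finset.range (n + 1), ∑ k ∈ Finset.range (n + 1),
    (X : PowerSeries ℤ) ^ (m ^ 2 + 3 * k * m + 4 * k ^ 2) *
      (qBinom ((n : ℤ) - 3 * k - m) k * qBinom ((n : ℤ) - 4 * k - m) m -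
        (X : PowerSeries ℤ) ^ k * qBinom ((n : ℤ) - 3 * k - m - 1) k *
          qBinom ((n : ℤ) - 4 * k - m - 1) ((m : ℤ) - 1))

namespace QAux

/-- The inner variable `q`. -/
noncomputable abbrev q : PowerSeries ℤ := X

lemma qPoch_succ (n : ℕ) : qPoch (n + 1) = qPoch n * (1 - q ^ (n + 1)) := by
  simp [qPoch, Finset.prod_range_succ]

lemma qPoch_mul_inv (n : ℕ) : qPoch n * qPochInv n = 1 := by
  unfold qPochInv
  apply mul_invOfUnit
  simp [qPoch, map_prod]

lemma inv_succ (n : ℕ) : qPochInv n = qPochInv (n + 1) * (1 - q ^ (n + 1)) := by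
  have h1 := qPoch_mul_inv n
  have h2 := qPoch_mul_inv (n + 1)
  rw [qPoch_succ] at h2
  linear_combination (-qPochInv n) * h2 + (1 - q ^ (n + 1)) * qPochInv (n + 1) * h1

/-- Symmetric trinomial coefficient. -/
noncomputable def M3 (a b c : ℤ) : PowerSeries ℤ :=
  if 0 ≤ a ∧ 0 ≤ b ∧ 0 ≤ c then
    qPoch (a + b + c).toNat * qPochInv a.toNat * qPochInv b.toNat * qPochInv c.toNat else 0

lemma M3_neg1 {a : ℤ} (b c : ℤ) (h : a < 0) : M3 a b c = 0 := by
  unfold M3; rw [if_neg (by omega)]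
lemma M3_neg2 {b : ℤ} (a c : ℤ) (h : b < 0) : M3 a b c = 0 := by
  unfold M3; rw [if_neg (by omega)]
lemma M3_neg3 {c : ℤ} (a b : ℤ) (h : c < 0) : M3 a b c = 0 := by
  unfold M3; rw [if_neg (by omega)]

lemma M3_nat (a b c : ℕ) :
    M3 a b c = qPoch (a + b + c) * qPochInv a * qPochInv b * qPochInv c := by
  unfold M3
  rw [if_pos (by omega)]
  have : ((a : ℤ) + b + c).toNat = a + b + c := by omega
  rw [this]; simp

lemma M3_swap12 (a b c : ℤ) : M3 a b c = M3 b a c := by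
  unfold M3
  by_cases h : 0 ≤ a ∧ 0 ≤ b ∧ 0 ≤ c
  · rw [if_pos h, if_pos (by omega), add_comm a b]; ring
  · rw [if_neg h, if_neg (by omega)]

lemma M3_swap23 (a b c : ℤ) : M3 a b c = M3 a c b := by
  unfold M3
  by_cases h : 0 ≤ a ∧ 0 ≤ b ∧ 0 ≤ c
  · rw [if_pos h, if_pos (by omega), show a + b + c = a + c + b by ring]; ring
  · rw [if_neg h, if_neg (by omega)]

lemma M3_pred (a b c N : ℕ) (h : a + b + c = N + 1) :
    M3 ((a : ℤ) - 1) b c =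
      qPoch N * (1 - q ^ a) * qPochInv a * qPochInv b * qPochInv c := by
  cases a with
  | zero => rw [M3_neg1 _ _ (by simp)]; simp
  | succ a =>
    have : ((a + 1 : ℕ) : ℤ) - 1 = (a : ℕ) := by push_cast; ring
    rw [this, M3_nat, inv_succ a, show a + b + c = N by omega]; ring

lemma pascal (a b c : ℤ) (h : ¬ (a = 0 ∧ b = 0 ∧ c = 0)) :
    M3 a b c = M3 (a - 1) b c + q ^ a.toNat * M3 a (b - 1) c
      + q ^ a.toNat * q ^ b.toNat * M3 a b (c - 1) := by
  by_cases ha : a < 0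
  · simp [M3_neg1 _ _ ha, M3_neg1 _ _ (show a - 1 < 0 by omega)]
  by_cases hb : b < 0
  · simp [M3_neg2 _ _ hb, M3_neg2 _ _ (show b - 1 < 0 by omega)]
  by_cases hc : c < 0
  · simp [M3_neg3 _ _ hc, M3_neg3 _ _ (show c - 1 < 0 by omega)]
  lift a to ℕ using by omega
  lift b to ℕ using by omega
  lift c to ℕ using by omega
  obtain ⟨N, hN⟩ : ∃ N, a + b + c = N + 1 := ⟨a + b + c - 1, by omega⟩
  rw [M3_pred a b c N hN, M3_swap12 a (b - 1), M3_pred b a c N (by omega), M3_swap23 a b (c - 1),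
    M3_swap12 a (c - 1), M3_pred c a b N (by omega), M3_nat, hN, qPoch_succ, ← hN]
  simp only [Int.toNat_natCast]
  ring

lemma qBinom_eq (m k : ℤ) : qBinom m k = M3 k (m - k) 0 := by
  unfold qBinom M3
  by_cases h : 0 ≤ k ∧ k ≤ m
  · rw [if_pos h, if_pos (by omega), show k + (m - k) + 0 = m by ring]
    have : qPochInv (0 : ℤ).toNat = 1 := by
      have := qPoch_mul_inv 0
      simpa [qPoch] using this
    rw [this, mul_one]
  · rw [if_neg h, if_neg (by omega)]

lemma qBinom_mul (N k m : ℤ) : qBinom N k * qBinom (N - k) m = M3 k m (N - k - m) := by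
  unfold qBinom M3
  by_cases h : 0 ≤ k ∧ 0 ≤ m ∧ 0 ≤ N - k - m
  · rw [if_pos h, if_pos (by omega), if_pos (by omega), show k + m + (N - k - m) = N by ring]
    linear_combination qPoch N.toNat * qPochInv k.toNat * qPochInv m.toNat *
      qPochInv (N - k - m).toNat * qPoch_mul_inv (N - k).toNat
  · rw [if_neg h]
    by_cases h1 : 0 ≤ k ∧ k ≤ N
    · rw [if_neg (show ¬ (0 ≤ m ∧ m ≤ N - k) by omega), mul_zero]
    · rw [if_neg h1, zero_mul]

/-! ### Double sums -/

/-- General double sum. -/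
noncomputable def ds (L : ℕ) (f : ℕ → ℕ → PowerSeries ℤ) (n : ℤ) : PowerSeries ℤ :=
  ∑ k ∈ Finset.range L, ∑ m ∈ Finset.range L, f k m * M3 k m (n - 4 * k - 2 * m)

lemma ds_indep (L : ℕ) (f : ℕ → ℕ → PowerSeries ℤ) (n : ℤ) (h : n < L) :
    ds (L + 1) f n = ds L f n := by
  unfold ds
  rw [Finset.sum_range_succ]
  have h0 : ∑ m ∈ Finset.range (L + 1), f L m * M3 L m (n - 4 * L - 2 * m) = 0 := by
    apply Finset.sum_eq_zero
    intro m _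
    rw [M3_neg3 _ _ (by omega), mul_zero]
  rw [h0, add_zero]
  apply Finset.sum_congr rfl
  intro k _
  rw [Finset.sum_range_succ, M3_neg3 _ _ (by omega), mul_zero, add_zero]

lemma ds_eq (L : ℕ) (f : ℕ → ℕ → PowerSeries ℤ) (n : ℤ) (h : n < L) :
    ds L f n = ds n.toNat.succ f n := by
  induction L with
  | zero =>
    rw [show n.toNat = 0 by omega]
    rw [ds_indep 0 f n h]
  | succ L ih =>
    by_cases h2 : n < L
    · rw [ds_indep L f n h2, ih h2]
    · rw [show n.toNat = L by omega]

lemma shiftK (L : ℕ) (f : ℕ → ℕ → PowerSeries ℤ) (n : ℤ) (h : n < L) :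
    ∑ k ∈ Finset.range L, ∑ m ∈ Finset.range L, f k m * M3 ((k : ℤ) - 1) m (n - 4 * k - 2 * m)
      = ds L (fun k m => f (k + 1) m) (n - 4) := by
  cases L with
  | zero => simp [ds]
  | succ L =>
    unfold ds
    rw [Finset.sum_range_succ', Finset.sum_range_succ (fun k => ∑ m ∈ Finset.range (L + 1), f (k + 1) m * M3 k m (n - 4 - 4 * k - 2 * m)) L]
    congr 1
    · apply Finset.sum_congr rfl; intro k _
      apply Finset.sum_congr rfl; intro m _
      congr 2 <;> push_cast <;> ring
    · trans (0 : PowerSeries ℤ)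
      · apply Finset.sum_eq_zero
        intro m _
        rw [M3_neg1 _ _ (by simp), mul_zero]
      · symm
        apply Finset.sum_eq_zero
        intro m _
        rw [M3_neg3 _ _ (by push_cast at h; omega), mul_zero]

lemma shiftM (L : ℕ) (f : ℕ → ℕ → PowerSeries ℤ) (n : ℤ) (h : n < L) :
    ∑ k ∈ Finset.range L, ∑ m ∈ Finset.range L, f k m * M3 k ((m : ℤ) - 1) (n - 4 * k - 2 * m)
      = ds L (fun k m => f k (m + 1)) (n - 2) := by
  cases L with
  | zero => simp [ds]
  | succ L =>
    unfold ds
    apply Finset.sum_congr rfl; intro k _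
    rw [Finset.sum_range_succ', Finset.sum_range_succ _ L]
    congr 1
    · apply Finset.sum_congr rfl; intro m _
      congr 2 <;> push_cast <;> ring
    · rw [M3_neg3 (c := n - 2 - 4 * k - 2 * L) _ _ (by push_cast at h; omega), mul_zero,
        M3_neg2 (b := ((0 : ℕ) : ℤ) - 1) _ _ (by simp), mul_zero]

/-- The exponent weight. -/
noncomputable def wt (a b k m : ℕ) : PowerSeries ℤ :=
  q ^ (m ^ 2 + 3 * k * m + 4 * k ^ 2 + a * k + b * m)

/-- The basic family of double sums. -/
noncomputable def g (a b : ℕ) (n : ℤ) : PowerSeries ℤ := ds n.toNat.succ (wt a b) n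

lemma g_neg (a b : ℕ) (n : ℤ) (h : n < 0) : g a b n = 0 := by
  unfold g
  rw [← ds_eq 0 _ n (by simpa using h)]; simp [ds]

lemma g_zero (a b : ℕ) : g a b 0 = 1 := by
  have := M3_nat 0 0 0
  have h2 := qPoch_mul_inv 0
  simp [qPoch] at this h2
  simp [g, ds, wt, this, h2]

lemma ds_congr (L : ℕ) (f f' : ℕ → ℕ → PowerSeries ℤ) (n : ℤ)
    (h : ∀ k m : ℕ, 4 * k + 2 * m ≤ n → f k m = f' k m) : ds L f n = ds L f' n := by
  apply Finset.sum_congr rfl; intro k _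
  apply Finset.sum_congr rfl; intro m _
  by_cases h' : 4 * (k : ℤ) + 2 * m ≤ n
  · rw [h k m h']
  · rw [M3_neg3 _ _ (by omega)]; simp

/-- identify a weighted `ds` with a multiple of `g`. -/
lemma ds_g (L : ℕ) (f : ℕ → ℕ → PowerSeries ℤ) (n : ℤ) (hL : n < L) (e a b : ℕ)
    (h : ∀ k m : ℕ, 4 * k + 2 * m ≤ n → f k m = q ^ e * wt a b k m) :
    ds L f n = q ^ e * g a b n := by
  rw [ds_congr L f _ n h]
  unfold g
  rw [← ds_eq L _ n hL]
  simp only [ds, Finset.mul_sum, mul_assoc]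

/-- general splitting -/
lemma split (a b : ℕ) (n : ℤ) (hn : 0 < n) (fK fM fR : ℕ → ℕ → PowerSeries ℤ)
    (eK aK bK eM aM bM eR aR bR : ℕ)
    (hp : ∀ k m : ℕ, 4 * k + 2 * m ≤ n → M3 k m (n - 4 * k - 2 * m) =
      fK k m * M3 ((k : ℤ) - 1) m (n - 4 * k - 2 * m)
      + fM k m * M3 k ((m : ℤ) - 1) (n - 4 * k - 2 * m)
      + fR k m * M3 k m (n - 4 * k - 2 * m - 1))
    (hK : ∀ k m : ℕ, 4 * k + 2 * m ≤ n - 4 →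
      wt a b (k + 1) m * fK (k + 1) m = q ^ eK * wt aK bK k m)
    (hM : ∀ k m : ℕ, 4 * k + 2 * m ≤ n - 2 →
      wt a b k (m + 1) * fM k (m + 1) = q ^ eM * wt aM bM k m)
    (hR : ∀ k m : ℕ, 4 * k + 2 * m ≤ n - 1 →
      wt a b k m * fR k m = q ^ eR * wt aR bR k m) :
    g a b n = q ^ eK * g aK bK (n - 4) + q ^ eM * g aM bM (n - 2) + q ^ eR * g aR bR (n - 1) := by
  have hL : n < (n.toNat.succ : ℕ) := by omega
  rw [← ds_g n.toNat.succ (fun k m => wt a b (k + 1) m * fK (k + 1) m) (n - 4) (by omega) _ _ _ hK,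
    ← ds_g n.toNat.succ (fun k m => wt a b k (m + 1) * fM k (m + 1)) (n - 2) (by omega) _ _ _ hM,
    ← ds_g n.toNat.succ (fun k m => wt a b k m * fR k m) (n - 1) (by omega) _ _ _ hR,
    ← shiftK _ (fun k m => wt a b k m * fK k m) n hL,
    ← shiftM _ (fun k m => wt a b k m * fM k m) n hL]
  unfold g ds
  rw [← Finset.sum_add_distrib, ← Finset.sum_add_distrib]
  apply Finset.sum_congr rfl; intro k _
  rw [← Finset.sum_add_distrib, ← Finset.sum_add_distrib]
  apply Finset.sum_congr rfl; intro m _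
  by_cases h : 4 * (k : ℤ) + 2 * m ≤ n
  · rw [hp k m h, show n - 1 - 4 * (k : ℤ) - 2 * m = n - 4 * k - 2 * m - 1 by ring]; ring
  · rw [M3_neg3 _ _ (by omega), M3_neg3 _ _ (by omega), M3_neg3 _ _ (by omega),
      M3_neg3 _ _ (by omega)]; simp

lemma RKM (a b : ℕ) (n : ℤ) (hn : 0 < n) :
    g a b n = q ^ (4 + a + (n - 4).toNat) * g (a + 4) (b + 1) (n - 4)
      + q ^ (1 + b + (n - 2).toNat) * g a b (n - 2) + q ^ 0 * g a b (n - 1) := by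
  apply split a b n hn (fun k m => q ^ (n - 4 * k - 2 * m).toNat)
    (fun k m => q ^ ((n - 4 * k - 2 * m).toNat + k)) (fun k m => 1)
  · intro k m h
    rw [M3_swap23, M3_swap12, pascal _ _ _ (by omega), M3_swap12 _ ((k : ℤ) - 1),
      M3_swap23 ((k : ℤ) - 1), M3_swap12 (n - 4 * k - 2 * m) k, M3_swap23 k (n - 4 * k - 2 * m),
      M3_swap12 (n - 4 * k - 2 * m - 1) k, M3_swap23 k (n - 4 * k - 2 * m - 1)]
    simp only [Int.toNat_natCast]
    ring
  · intro k m h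
    obtain ⟨r, hr⟩ : ∃ r : ℕ, n = 4 + 4 * k + 2 * m + r := ⟨(n - 4 - 4 * k - 2 * m).toNat, by omega⟩
    simp only [wt, ← pow_add]
    rw [show (n - 4 * ((k + 1 : ℕ) : ℤ) - 2 * m).toNat = r by push_cast; omega,
      show (n - 4).toNat = 4 * k + 2 * m + r by omega]
    congr 1; ring
  · intro k m h
    obtain ⟨r, hr⟩ : ∃ r : ℕ, n = 2 + 4 * k + 2 * m + r := ⟨(n - 2 - 4 * k - 2 * m).toNat, by omega⟩
    simp only [wt, ← pow_add]
    rw [show (n - 4 * (k : ℤ) - 2 * ((m + 1 : ℕ) : ℤ)).toNat = r by push_cast; omega,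
      show (n - 2).toNat = 4 * k + 2 * m + r by omega]
    congr 1; ring
  · intro k m h
    simp

lemma RMK (a b : ℕ) (n : ℤ) (hn : 0 < n) :
    g (a + 1) b n = q ^ (5 + a + (n - 4).toNat) * g (a + 5) (b + 2) (n - 4)
      + q ^ (1 + b + (n - 2).toNat) * g a b (n - 2) + q ^ 0 * g (a + 1) b (n - 1) := by
  apply split (a + 1) b n hn (fun k m => q ^ ((n - 4 * k - 2 * m).toNat + m))
    (fun k m => q ^ ((n - 4 * k - 2 * m).toNat)) (fun k m => 1)
  · intro k m h
    rw [M3_swap12, M3_swap23, M3_swap12, pascal _ _ _ (by omega), M3_swap12 _ ((m : ℤ) - 1),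
      M3_swap23 ((m : ℤ) - 1), M3_swap12 ((m : ℤ) - 1), M3_swap12 (n - 4 * k - 2 * m) m,
      M3_swap23 m (n - 4 * k - 2 * m), M3_swap12 m,
      M3_swap12 (n - 4 * k - 2 * m - 1) m, M3_swap23 m (n - 4 * k - 2 * m - 1), M3_swap12 m]
    simp only [Int.toNat_natCast]
    ring
  · intro k m h
    obtain ⟨r, hr⟩ : ∃ r : ℕ, n = 4 + 4 * k + 2 * m + r := ⟨(n - 4 - 4 * k - 2 * m).toNat, by omega⟩
    simp only [wt, ← pow_add]
    rw [show (n - 4 * ((k + 1 : ℕ) : ℤ) - 2 * m).toNat = r by push_cast; omega,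
      show (n - 4).toNat = 4 * k + 2 * m + r by omega]
    congr 1; ring
  · intro k m h
    obtain ⟨r, hr⟩ : ∃ r : ℕ, n = 2 + 4 * k + 2 * m + r := ⟨(n - 2 - 4 * k - 2 * m).toNat, by omega⟩
    simp only [wt, ← pow_add]
    rw [show (n - 4 * (k : ℤ) - 2 * ((m + 1 : ℕ) : ℤ)).toNat = r by push_cast; omega,
      show (n - 2).toNat = 4 * k + 2 * m + r by omega]
    congr 1; ring
  · intro k m h
    simp

lemma KMR (a b : ℕ) (n : ℤ) (hn : 0 < n) :
    g a b n = q ^ (4 + a) * g (a + 8) (b + 3) (n - 4)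
      + q ^ (1 + b) * g (a + 4) (b + 2) (n - 2) + q ^ 0 * g (a + 1) (b + 1) (n - 1) := by
  apply split a b n hn (fun k m => 1) (fun k m => q ^ k) (fun k m => q ^ (k + m))
  · intro k m h
    rw [pascal _ _ _ (by omega)]
    simp only [Int.toNat_natCast]
    ring
  all_goals
    intro k m h
    simp only [wt, ← pow_add, mul_one]
    congr 1; ring

lemma KRM (a b : ℕ) (n : ℤ) (hn : 0 < n) :
    g a b n = q ^ (4 + a) * g (a + 8) (b + 3) (n - 4)
      + q ^ (1 + b + (n - 2).toNat) * g a b (n - 2) + q ^ 0 * g (a + 1) b (n - 1) := by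
  apply split a b n hn (fun k m => 1) (fun k m => q ^ ((n - 4 * k - 2 * m).toNat + k))
    (fun k m => q ^ k)
  · intro k m h
    rw [M3_swap23, pascal _ _ _ (by omega), M3_swap23 ((k : ℤ) - 1),
      M3_swap23 k (n - 4 * k - 2 * m), M3_swap23 k (n - 4 * k - 2 * m - 1)]
    simp only [Int.toNat_natCast]
    ring
  · intro k m h
    simp only [wt, ← pow_add, mul_one]
    congr 1; ring
  · intro k m h
    obtain ⟨r, hr⟩ : ∃ r : ℕ, n = 2 + 4 * k + 2 * m + r := ⟨(n - 2 - 4 * k - 2 * m).toNat, by omega⟩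
    simp only [wt, ← pow_add]
    rw [show (n - 4 * (k : ℤ) - 2 * ((m + 1 : ℕ) : ℤ)).toNat = r by push_cast; omega,
      show (n - 2).toNat = 4 * k + 2 * m + r by omega]
    congr 1; ring
  · intro k m h
    simp only [wt, ← pow_add, mul_one]
    congr 1; ring

lemma MRK (a b : ℕ) (n : ℤ) (hn : 0 < n) :
    g a b n = q ^ (4 + a + (n - 4).toNat) * g (a + 4) (b + 2) (n - 4)
      + q ^ (1 + b) * g (a + 3) (b + 2) (n - 2) + q ^ 0 * g a (b + 1) (n - 1) := by
  apply split a b n hn (fun k m => q ^ ((n - 4 * k - 2 * m).toNat + m)) (fun k m => 1)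
    (fun k m => q ^ m)
  · intro k m h
    rw [M3_swap12, M3_swap23, pascal _ _ _ (by omega), M3_swap23 ((m : ℤ) - 1), M3_swap12 ((m : ℤ) - 1),
      M3_swap23 m (n - 4 * k - 2 * m), M3_swap12 m (k - 1),
      M3_swap23 m (n - 4 * k - 2 * m - 1), M3_swap12 m k]
    simp only [Int.toNat_natCast]
    ring
  · intro k m h
    obtain ⟨r, hr⟩ : ∃ r : ℕ, n = 4 + 4 * k + 2 * m + r := ⟨(n - 4 - 4 * k - 2 * m).toNat, by omega⟩
    simp only [wt, ← pow_add]
    rw [show (n - 4 * ((k + 1 : ℕ) : ℤ) - 2 * m).toNat = r by push_cast; omega,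
      show (n - 4).toNat = 4 * k + 2 * m + r by omega]
    congr 1; ring
  all_goals
    intro k m h
    simp only [wt, ← pow_add, mul_one]
    congr 1; ring

/-! ### Single sums -/

/-- Single sum with bottom entry `2k`. -/
noncomputable def sL (L c : ℕ) (n : ℤ) : PowerSeries ℤ :=
  ∑ k ∈ Finset.range L, q ^ (2 * k ^ 2 + c * k) * M3 (2 * k) (n - 3 * k) 0

/-- Single sum with bottom entry `2k+1`. -/
noncomputable def tL (L c : ℕ) (n : ℤ) : PowerSeries ℤ :=
  ∑ k ∈ Finset.range L, q ^ (2 * k ^ 2 + c * k) * M3 (2 * k + 1) (n - 3 * k - 1) 0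

lemma sL_eq (L c : ℕ) (n : ℤ) (h : n < L) : sL L c n = sL n.toNat.succ c n := by
  have step : ∀ L : ℕ, n < L → sL (L + 1) c n = sL L c n := by
    intro L hL
    unfold sL
    rw [Finset.sum_range_succ, M3_neg2 _ _ (by omega), mul_zero, add_zero]
  induction L with
  | zero => rw [show n.toNat = 0 by omega, step 0 h]
  | succ L ih =>
    by_cases h2 : n < L
    · rw [step L h2, ih h2]
    · rw [show n.toNat = L by omega]

lemma tL_eq (L c : ℕ) (n : ℤ) (h : n < L) : tL L c n = tL n.toNat.succ c n := by
  have step : ∀ L : ℕ, n < L → tL (L + 1) c n = tL L c n := by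
    intro L hL
    unfold tL
    rw [Finset.sum_range_succ, M3_neg2 _ _ (by omega), mul_zero, add_zero]
  induction L with
  | zero => rw [show n.toNat = 0 by omega, step 0 h]
  | succ L ih =>
    by_cases h2 : n < L
    · rw [step L h2, ih h2]
    · rw [show n.toNat = L by omega]

/-- Single sum with bottom entry `2k`. -/
noncomputable def s (c : ℕ) (n : ℤ) : PowerSeries ℤ := sL n.toNat.succ c n

/-- Single sum with bottom entry `2k+1`. -/
noncomputable def t (c : ℕ) (n : ℤ) : PowerSeries ℤ := tL n.toNat.succ c n

lemma s_neg (c : ℕ) (n : ℤ) (h : n < 0) : s c n = 0 := by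
  unfold s; rw [← sL_eq 0 _ n (by simpa using h)]; simp [sL]

lemma t_neg (c : ℕ) (n : ℤ) (h : n < 0) : t c n = 0 := by
  unfold t; rw [← tL_eq 0 _ n (by simpa using h)]; simp [tL]

lemma s_zero (c : ℕ) : s c 0 = 1 := by
  have := M3_nat 0 0 0
  have h2 := qPoch_mul_inv 0
  simp [qPoch] at this h2
  simp [s, sL, this, h2]

lemma t_zero (c : ℕ) : t c 0 = 0 := by
  simp [t, tL, M3_neg2]

lemma pascal2 (a b : ℤ) (h : ¬ (a = 0 ∧ b = 0)) :
    M3 a b 0 = M3 (a - 1) b 0 + q ^ a.toNat * M3 a (b - 1) 0 := by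
  rw [pascal a b 0 (by omega), M3_neg3 a b (show (0 : ℤ) - 1 < 0 by omega)]; ring

lemma pascal2' (a b : ℤ) (h : ¬ (a = 0 ∧ b = 0)) :
    M3 a b 0 = M3 a (b - 1) 0 + q ^ b.toNat * M3 (a - 1) b 0 := by
  rw [M3_swap12, pascal2 b a (by omega), M3_swap12 (b - 1), M3_swap12 b]

lemma shiftS (L : ℕ) (f : ℕ → PowerSeries ℤ) (n : ℤ) (h : n < L) :
    ∑ k ∈ Finset.range L, f k * M3 (2 * (k : ℤ) - 1) (n - 3 * k) 0
      = ∑ k ∈ Finset.range L, f (k + 1) * M3 (2 * (k : ℤ) + 1) (n - 2 - 3 * k - 1) 0 := by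
  cases L with
  | zero => simp
  | succ L =>
    rw [Finset.sum_range_succ', Finset.sum_range_succ _ L]
    congr 1
    · apply Finset.sum_congr rfl; intro k _
      congr 2 <;> push_cast <;> ring
    · rw [M3_neg2 (b := n - 2 - 3 * L - 1) _ _ (by push_cast at h; omega), mul_zero,
        M3_neg1 (a := 2 * ((0 : ℕ) : ℤ) - 1) _ _ (by simp), mul_zero]

lemma A1 (c : ℕ) (n : ℤ) (hn : 0 < n) :
    s c n = s (c + 2) (n - 1) + q ^ (2 + c) * t (c + 4) (n - 2) := by
  unfold s t
  rw [← sL_eq n.toNat.succ _ (n - 1) (by omega), ← tL_eq n.toNat.succ _ (n - 2) (by omega)]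
  have := shiftS n.toNat.succ (fun k => q ^ (2 * k ^ 2 + c * k)) n (by omega)
  unfold sL tL
  rw [Finset.mul_sum]
  trans (∑ k ∈ Finset.range n.toNat.succ, q ^ (2 * k ^ 2 + (c + 2) * k) * M3 (2 * k) (n - 1 - 3 * k) 0
    + ∑ k ∈ Finset.range n.toNat.succ, q ^ (2 * k ^ 2 + c * k) * M3 (2 * (k : ℤ) - 1) (n - 3 * k) 0)
  · rw [← Finset.sum_add_distrib]
    apply Finset.sum_congr rfl; intro k _
    rw [pascal2 _ _ (by omega), show n - 1 - 3 * (k : ℤ) = n - 3 * k - 1 by ring,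
      show (2 * (k : ℤ)).toNat = 2 * k by omega]
    ring
  · rw [this]
    congr 1
    apply Finset.sum_congr rfl; intro k _
    ring

lemma A2 (c : ℕ) (n : ℤ) (hn : 0 < n) :
    s c n = s c (n - 1) + q ^ (1 + c + (n - 2).toNat) * t (c + 1) (n - 2) := by
  unfold s t
  rw [← sL_eq n.toNat.succ _ (n - 1) (by omega), ← tL_eq n.toNat.succ _ (n - 2) (by omega)]
  have := shiftS n.toNat.succ (fun k => q ^ (2 * k ^ 2 + c * k) * q ^ (n - 3 * k).toNat) n (by omega)
  unfold sL tL
  rw [Finset.mul_sum]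
  trans (∑ k ∈ Finset.range n.toNat.succ, q ^ (2 * k ^ 2 + c * k) * M3 (2 * k) (n - 1 - 3 * k) 0
    + ∑ k ∈ Finset.range n.toNat.succ, q ^ (2 * k ^ 2 + c * k) * q ^ (n - 3 * k).toNat *
      M3 (2 * (k : ℤ) - 1) (n - 3 * k) 0)
  · rw [← Finset.sum_add_distrib]
    apply Finset.sum_congr rfl; intro k _
    rw [pascal2' _ _ (by omega), show n - 1 - 3 * (k : ℤ) = n - 3 * k - 1 by ring]
    ring
  · rw [this]
    congr 1
    apply Finset.sum_congr rfl; intro k _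
    by_cases h : 0 ≤ n - 2 - 3 * (k : ℤ) - 1
    · obtain ⟨r, hr⟩ : ∃ r : ℕ, n = 3 + 3 * k + r := ⟨(n - 3 - 3 * k).toNat, by omega⟩
      rw [show (n - 3 * ((k + 1 : ℕ) : ℤ)).toNat = r by push_cast; omega,
        show (n - 2).toNat = 1 + 3 * k + r by omega]
      ring
    · rw [M3_neg2 _ _ (by omega)]; simp

lemma B1 (c : ℕ) (n : ℤ) (hn : 0 < n) :
    t c n = q * t (c + 2) (n - 1) + s c (n - 1) := by
  unfold s t
  rw [← sL_eq n.toNat.succ _ (n - 1) (by omega), ← tL_eq n.toNat.succ _ (n - 1) (by omega)]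
  unfold sL tL
  rw [Finset.mul_sum, ← Finset.sum_add_distrib]
  apply Finset.sum_congr rfl; intro k _
  rw [pascal2 _ _ (by omega), show (2 * (k : ℤ) + 1).toNat = 2 * k + 1 by omega,
    show 2 * (k : ℤ) + 1 - 1 = 2 * k by ring, show n - 3 * (k : ℤ) - 1 = n - 1 - 3 * k by ring]
  ring

lemma B2 (c : ℕ) (n : ℤ) (hn : 0 < n) :
    t (c + 3) n = t (c + 3) (n - 1) + q ^ (n - 1).toNat * s c (n - 1) := by
  unfold s t
  rw [← sL_eq n.toNat.succ _ (n - 1) (by omega), ← tL_eq n.toNat.succ _ (n - 1) (by omega)]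
  unfold sL tL
  rw [Finset.mul_sum, ← Finset.sum_add_distrib]
  apply Finset.sum_congr rfl; intro k _
  rw [pascal2' _ _ (by omega),
    show 2 * (k : ℤ) + 1 - 1 = 2 * k by ring, show n - 3 * (k : ℤ) - 1 = n - 1 - 3 * k by ring]
  by_cases h : 0 ≤ n - 1 - 3 * (k : ℤ)
  · obtain ⟨r, hr⟩ : ∃ r : ℕ, n = 1 + 3 * k + r := ⟨(n - 1 - 3 * k).toNat, by omega⟩
    rw [show (n - 1 - 3 * (k : ℤ)).toNat = r by omega,
        show (n - 1).toNat = 3 * k + r by omega]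
    ring
  · simp [M3_neg2 _ _ (show n - 1 - 3 * (k : ℤ) < 0 by omega),
      M3_neg2 _ _ (show n - 1 - 3 * (k : ℤ) - 1 < 0 by omega)]

/-! ### Generating functions -/

/-- The constant `q` in the outer ring. -/
noncomputable def Q : PowerSeries (PowerSeries ℤ) := C q

/-- The outer variable. -/
noncomputable def z : PowerSeries (PowerSeries ℤ) := X

/-- Generating function of `u`, at `z q^j`. -/
noncomputable def gf (u : ℤ → PowerSeries ℤ) (j : ℕ) : PowerSeries (PowerSeries ℤ) :=
  PowerSeries.mk fun n => q ^ (j * n) * u n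

lemma coeff_Q_mul (e n : ℕ) (F : PowerSeries (PowerSeries ℤ)) :
    coeff n (Q ^ e * F) = q ^ e * coeff n F := by
  unfold Q
  rw [← map_pow, coeff_C_mul]

lemma coeff_gf (u : ℤ → PowerSeries ℤ) (hu : ∀ n < 0, u n = 0) (i j e n : ℕ) :
    coeff n ((Q ^ j * z) ^ i * gf u (j + e)) =
      q ^ (j * n) * (q ^ (e * ((n : ℤ) - i).toNat) * u ((n : ℤ) - i)) := by
  rw [mul_pow, ← pow_mul, mul_assoc, coeff_Q_mul]
  unfold z
  rw [coeff_X_pow_mul']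
  by_cases h : i ≤ n
  · obtain ⟨d, rfl⟩ := Nat.exists_eq_add_of_le h
    rw [if_pos h]
    have h1 : ((i + d : ℕ) : ℤ) - i = (d : ℕ) := by push_cast; ring
    rw [h1, show i + d - i = d by omega]
    simp only [gf, coeff_mk, Int.toNat_natCast]
    ring
  · rw [if_neg h, hu _ (by omega)]; simp

lemma coeff_gf0 (u : ℤ → PowerSeries ℤ) (j n : ℕ) : coeff n (gf u j) = q ^ (j * n) * u n := by
  simp [gf]

lemma gf_rel3 (u uK uM uR : ℤ → PowerSeries ℤ) (eK eM eR dK dM dR j : ℕ)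
    (hK : ∀ n < 0, uK n = 0) (hM : ∀ n < 0, uM n = 0) (hR : ∀ n < 0, uR n = 0) (h0 : u 0 = 1)
    (h : ∀ n : ℤ, 0 < n → u n = q ^ (eK + dK * (n - 4).toNat) * uK (n - 4)
      + q ^ (eM + dM * (n - 2).toNat) * uM (n - 2)
      + q ^ (eR + dR * (n - 1).toNat) * uR (n - 1)) :
    gf u j = 1 + Q ^ eK * ((Q ^ j * z) ^ 4 * gf uK (j + dK))
      + Q ^ eM * ((Q ^ j * z) ^ 2 * gf uM (j + dM))
      + Q ^ eR * ((Q ^ j * z) ^ 1 * gf uR (j + dR)) := by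
  ext1 n
  simp only [map_add, coeff_Q_mul, coeff_gf _ hK, coeff_gf _ hM, coeff_gf _ hR, coeff_gf0, coeff_one]
  rcases Nat.eq_zero_or_pos n with rfl | hn
  · rw [hK _ (by simp), hM _ (by simp), hR _ (by simp)]
    simp [h0]
  · rw [h n (by exact_mod_cast hn), if_neg (by omega)]
    push_cast
    ring

lemma gf_rel2 (u u1 u2 : ℤ → PowerSeries ℤ) (i1 i2 e1 e2 d1 d2 j : ℕ) (ε : ℕ)
    (hi1 : 0 < i1) (hi2 : 0 < i2)
    (hu1 : ∀ n < 0, u1 n = 0) (hu2 : ∀ n < 0, u2 n = 0) (h0 : u 0 = ε)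
    (h : ∀ n : ℤ, 0 < n → u n = q ^ (e1 + d1 * (n - i1).toNat) * u1 (n - i1)
      + q ^ (e2 + d2 * (n - i2).toNat) * u2 (n - i2)) :
    gf u j = ε + Q ^ e1 * ((Q ^ j * z) ^ i1 * gf u1 (j + d1))
      + Q ^ e2 * ((Q ^ j * z) ^ i2 * gf u2 (j + d2)) := by
  ext1 n
  have hε : (ε : PowerSeries (PowerSeries ℤ)) = C (ε : PowerSeries ℤ) := by simp
  rw [hε]
  simp only [map_add, coeff_Q_mul, coeff_gf _ hu1, coeff_gf _ hu2, coeff_gf0, coeff_C]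
  rcases Nat.eq_zero_or_pos n with rfl | hn
  · rw [hu1 _ (by simpa using hi1), hu2 _ (by simpa using hi2)]
    simp [h0]
  · rw [h n (by exact_mod_cast hn), if_neg (by omega)]
    ring

/-- Generating function of the double sums. -/
noncomputable def H (a b j : ℕ) := gf (g a b) j

lemma gRKM (a b j : ℕ) : H a b j = 1 + Q ^ (4 + a) * ((Q ^ j * z) ^ 4 * H (a + 4) (b + 1) (j + 1))
    + Q ^ (1 + b) * ((Q ^ j * z) ^ 2 * H a b (j + 1)) + Q ^ 0 * ((Q ^ j * z) ^ 1 * H a b (j + 0)) :=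
  gf_rel3 _ _ _ _ _ _ _ _ _ _ _ (g_neg _ _) (g_neg _ _) (g_neg _ _) (g_zero _ _)
    (fun n hn => by simpa using RKM a b n hn)

lemma gRMK (a b j : ℕ) : H (a + 1) b j = 1
    + Q ^ (5 + a) * ((Q ^ j * z) ^ 4 * H (a + 5) (b + 2) (j + 1))
    + Q ^ (1 + b) * ((Q ^ j * z) ^ 2 * H a b (j + 1))
    + Q ^ 0 * ((Q ^ j * z) ^ 1 * H (a + 1) b (j + 0)) :=
  gf_rel3 _ _ _ _ _ _ _ _ _ _ _ (g_neg _ _) (g_neg _ _) (g_neg _ _) (g_zero _ _)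
    (fun n hn => by simpa using RMK a b n hn)

lemma gKMR (a b j : ℕ) : H a b j = 1 + Q ^ (4 + a) * ((Q ^ j * z) ^ 4 * H (a + 8) (b + 3) (j + 0))
    + Q ^ (1 + b) * ((Q ^ j * z) ^ 2 * H (a + 4) (b + 2) (j + 0))
    + Q ^ 0 * ((Q ^ j * z) ^ 1 * H (a + 1) (b + 1) (j + 0)) :=
  gf_rel3 _ _ _ _ _ _ _ _ _ _ _ (g_neg _ _) (g_neg _ _) (g_neg _ _) (g_zero _ _)
    (fun n hn => by simpa using KMR a b n hn)

lemma gKRM (a b j : ℕ) : H a b j = 1 + Q ^ (4 + a) * ((Q ^ j * z) ^ 4 * H (a + 8) (b + 3) (j + 0))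
    + Q ^ (1 + b) * ((Q ^ j * z) ^ 2 * H a b (j + 1))
    + Q ^ 0 * ((Q ^ j * z) ^ 1 * H (a + 1) b (j + 0)) :=
  gf_rel3 _ _ _ _ _ _ _ _ _ _ _ (g_neg _ _) (g_neg _ _) (g_neg _ _) (g_zero _ _)
    (fun n hn => by simpa using KRM a b n hn)

lemma gMRK (a b j : ℕ) : H a b j = 1 + Q ^ (4 + a) * ((Q ^ j * z) ^ 4 * H (a + 4) (b + 2) (j + 1))
    + Q ^ (1 + b) * ((Q ^ j * z) ^ 2 * H (a + 3) (b + 2) (j + 0))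
    + Q ^ 0 * ((Q ^ j * z) ^ 1 * H a (b + 1) (j + 0)) :=
  gf_rel3 _ _ _ _ _ _ _ _ _ _ _ (g_neg _ _) (g_neg _ _) (g_neg _ _) (g_zero _ _)
    (fun n hn => by simpa using MRK a b n hn)

/-- Generating function of `s`. -/
noncomputable def GS (c j : ℕ) := gf (s c) j

/-- Generating function of `t`. -/
noncomputable def GT (c j : ℕ) := gf (t c) j

lemma gA1 (c j : ℕ) : GS c j = (1 : ℕ) + Q ^ 0 * ((Q ^ j * z) ^ 1 * GS (c + 2) (j + 0))
    + Q ^ (2 + c) * ((Q ^ j * z) ^ 2 * GT (c + 4) (j + 0)) :=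
  gf_rel2 _ _ _ _ _ _ _ _ _ _ _ (by norm_num) (by norm_num) (s_neg _) (t_neg _)
    (by simpa using s_zero c) (fun n hn => by simpa using A1 c n hn)

lemma gA2 (c j : ℕ) : GS c j = (1 : ℕ) + Q ^ 0 * ((Q ^ j * z) ^ 1 * GS c (j + 0))
    + Q ^ (1 + c) * ((Q ^ j * z) ^ 2 * GT (c + 1) (j + 1)) :=
  gf_rel2 _ _ _ _ _ _ _ _ _ _ _ (by norm_num) (by norm_num) (s_neg _) (t_neg _)
    (by simpa using s_zero c) (fun n hn => by simpa using A2 c n hn)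

lemma gB1 (c j : ℕ) : GT c j = (0 : ℕ) + Q ^ 1 * ((Q ^ j * z) ^ 1 * GT (c + 2) (j + 0))
    + Q ^ 0 * ((Q ^ j * z) ^ 1 * GS c (j + 0)) :=
  gf_rel2 _ _ _ _ _ _ _ _ _ _ _ (by norm_num) (by norm_num) (t_neg _) (s_neg _)
    (by simpa using t_zero c) (fun n hn => by simpa using B1 c n hn)

lemma gB2 (c j : ℕ) : GT (c + 3) j = (0 : ℕ) + Q ^ 0 * ((Q ^ j * z) ^ 1 * GT (c + 3) (j + 0))
    + Q ^ 0 * ((Q ^ j * z) ^ 1 * GS c (j + 1)) :=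
  gf_rel2 _ _ _ _ _ _ _ _ _ _ _ (by norm_num) (by norm_num) (t_neg _) (s_neg _)
    (by simpa using t_zero (c + 3)) (fun n hn => by simpa using B2 c n hn)

/-- inhomogeneous part -/
noncomputable def kap : PowerSeries (PowerSeries ℤ) :=
  1 - (Q + Q ^ 2) * z + Q ^ 3 * z ^ 2 + Q ^ 2 * z ^ 3 - (Q ^ 3 + Q ^ 4) * z ^ 4 + Q ^ 8 * z ^ 6

lemma recS : (1 - z) * (1 - Q * z) * (1 - Q ^ 2 * z) * GS 0 0 = kap
    + Q ^ 3 * (1 + Q) * z ^ 4 * (1 - Q ^ 2 * z) * GS 0 2 - Q ^ 15 * z ^ 8 * GS 0 4 := by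
  have r1 := gA2 0 0
  have r2 := gB2 0 1
  have r3 := gA2 1 1
  have r4 := gB1 1 1
  have r5 := gA1 0 2
  have r6 := gA2 2 2
  have r7 := gB1 2 2
  have r8 := gB2 0 3
  norm_num at r1 r2 r3 r4 r5 r6 r7 r8
  unfold kap
  linear_combination (1 - (Q + Q ^ 2) * z + Q ^ 3 * z ^ 2) * r1
    + (Q ^ 3 * z ^ 3 - Q ^ 5 * z ^ 4) * r2 + (Q ^ 2 * z ^ 3 - Q ^ 4 * z ^ 4) * r3
    + (Q * z ^ 2 - (Q ^ 2 + Q ^ 3) * z ^ 3 + Q ^ 4 * z ^ 4) * r4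
    - (Q ^ 3 * z ^ 4 - Q ^ 5 * z ^ 5) * r5 - (Q ^ 5 * z ^ 5 - Q ^ 8 * z ^ 6) * r6
    + (Q ^ 6 * z ^ 5 - Q ^ 8 * z ^ 6) * r7 - Q ^ 12 * z ^ 7 * r8

/-- Generating function of the T side. -/
noncomputable def G (j : ℕ) := H 0 0 j - Q * (Q ^ j * z) ^ 2 * H 4 2 j

lemma recT : (1 - z) * (1 - Q * z) * (1 - Q ^ 2 * z) * G 0 = kap
    + Q ^ 3 * (1 + Q) * z ^ 4 * (1 - Q ^ 2 * z) * G 2 - Q ^ 15 * z ^ 8 * G 4 := by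
  have r1 := gRKM 0 0 0
  have r2 := gRKM 4 2 0
  have r3 := gKMR 0 0 1
  have r4 := gRKM 1 1 1
  have r5 := gRMK 3 1 1
  have r6 := gRKM 0 0 2
  have r7 := gKMR 0 0 2
  have r8 := gRMK 1 0 2
  have r9 := gMRK 2 0 2
  have r10 := gRKM 2 1 2
  have r11 := gRMK 2 1 2
  have r12 := gRKM 4 2 2
  have r13 := gKRM 0 0 3
  have r14 := gMRK 4 1 3
  have r15 := gRKM 4 2 3
  norm_num at r1 r2 r3 r4 r5 r6 r7 r8 r9 r10 r11 r12 r13 r14 r15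
  unfold kap G
  linear_combination (1 - (Q + Q ^ 2) * z + Q ^ 3 * z ^ 2) * r1
    - (Q * z ^ 2 - (Q ^ 2 + Q ^ 3) * z ^ 3 + Q ^ 4 * z ^ 4) * r2
    + (Q * z ^ 2 - (Q ^ 2 + Q ^ 3) * z ^ 3 + Q ^ 4 * z ^ 4) * r3
    + (Q ^ 2 * z ^ 3 - Q ^ 4 * z ^ 4) * r4 + (Q ^ 4 * z ^ 4 - Q ^ 6 * z ^ 5) * r5
    - Q ^ 3 * z ^ 4 * r6 - (Q ^ 4 * z ^ 4 - Q ^ 6 * z ^ 5) * r7 + Q ^ 6 * z ^ 5 * r8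
    - (Q ^ 6 * z ^ 5 - Q ^ 8 * z ^ 6) * r9 - Q ^ 8 * z ^ 6 * r10 + Q ^ 8 * z ^ 6 * r11
    + Q ^ 8 * z ^ 6 * r12 - Q ^ 8 * z ^ 6 * r13 - Q ^ 15 * z ^ 8 * r14 + Q ^ 15 * z ^ 8 * r15

/-- The coefficients of the `T` side. -/
noncomputable def tau (n : ℤ) : PowerSeries ℤ := g 0 0 n - q * g 4 2 (n - 2)

lemma G_eq (j : ℕ) : G j = gf tau j := by
  ext1 n
  have h := coeff_gf (g 4 2) (g_neg _ _) 2 j 0 n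
  have h2 := coeff_Q_mul 1 n ((Q ^ j * z) ^ 2 * H 4 2 j)
  rw [pow_one, ← mul_assoc] at h2
  unfold G
  rw [map_sub, h2]
  unfold H at *
  rw [add_zero] at h
  rw [h, coeff_gf0, coeff_gf0]
  simp [tau]
  ring

lemma uniq (d : ℤ → PowerSeries ℤ)
    (h : (1 - z) * (1 - Q * z) * (1 - Q ^ 2 * z) * gf d 0 =
      Q ^ 3 * (1 + Q) * z ^ 4 * (1 - Q ^ 2 * z) * gf d 2 - Q ^ 15 * z ^ 8 * gf d 4) (n : ℕ) :
    d n = 0 := by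
  have key : ∀ n : ℕ, z ^ n ∣ gf d 0 := by
    intro n
    induction n with
    | zero => simp
    | succ n ih =>
      have hz : ∀ i < n, d (i : ℕ) = 0 := by
        intro i hi
        unfold z at ih
        have := X_pow_dvd_iff.1 ih i hi
        simpa [coeff_gf0] using this
      have hj : ∀ j, z ^ n ∣ gf d j := by
        intro j
        unfold z
        rw [X_pow_dvd_iff]
        intro i hi
        rw [coeff_gf0, hz i hi, mul_zero]
      obtain ⟨x0, h0⟩ := hj 0
      obtain ⟨x2, h2⟩ := hj 2
      obtain ⟨x4, h4⟩ := hj 4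
      refine ⟨((1 + Q + Q ^ 2) - (Q + Q ^ 2 + Q ^ 3) * z + Q ^ 3 * z ^ 2) * x0
        + Q ^ 3 * (1 + Q) * z ^ 3 * (1 - Q ^ 2 * z) * x2 - Q ^ 15 * z ^ 7 * x4, ?_⟩
      rw [h0, h2, h4] at h
      rw [h0]
      linear_combination h
  have := key (n + 1)
  unfold z at this
  have := X_pow_dvd_iff.1 this n (by omega)
  simpa [coeff_gf0] using this

lemma s_eq_tau (n : ℕ) : s 0 n = tau n := by
  have h := uniq (fun n => s 0 n - tau n) (by
    have hg : ∀ j, gf (fun n => s 0 n - tau n) j = GS 0 j - G j := by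
      intro j
      rw [G_eq]
      ext1 n
      simp only [GS, map_sub, coeff_gf0]
      ring
    rw [hg, hg, hg]
    linear_combination recS - recT) n
  exact sub_eq_zero.1 h

lemma S_eq_s (n : ℕ) : S n = s 0 n := by
  unfold S s sL
  apply Finset.sum_congr (by simp)
  intro k _
  rw [qBinom_eq]
  congr 2
  · simp
  · ring

lemma T_eq_tau (n : ℕ) : T n = tau n := by
  unfold T tau
  have h1 : g 0 0 n = ds (n + 1) (wt 0 0) n := by
    unfold g; rw [ds_eq (n + 1) _ _ (by push_cast; omega)]
  have h2 : q * g 4 2 ((n : ℤ) - 2) = ds (n + 1) (fun k m => wt 0 0 k (m + 1) * q ^ k) (n - 2) := by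
    rw [ds_g (n + 1) _ ((n : ℤ) - 2) (by push_cast; omega) 1 4 2]
    · simp
    · intro k m _
      simp only [wt, ← pow_add]
      congr 1; ring
  rw [h1, h2, ← shiftM (n + 1) (fun k m => wt 0 0 k m * q ^ k) n (by push_cast; omega),
    Finset.sum_comm]
  unfold ds
  rw [← Finset.sum_sub_distrib]
  apply Finset.sum_congr rfl; intro k _
  rw [← Finset.sum_sub_distrib]
  apply Finset.sum_congr rfl; intro m _
  have e1 := qBinom_mul ((n : ℤ) - 3 * k - m) k m
  have e2 := qBinom_mul ((n : ℤ) - 3 * k - m - 1) k (m - 1)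
  rw [show (n : ℤ) - 3 * k - m - k = n - 4 * k - m by ring,
    show (n : ℤ) - 4 * k - m - m = n - 4 * k - 2 * m by ring] at e1
  rw [show (n : ℤ) - 3 * k - m - 1 - k = n - 4 * k - m - 1 by ring,
    show (n : ℤ) - 4 * k - m - 1 - (m - 1) = n - 4 * k - 2 * m by ring] at e2
  rw [← e1, ← e2]
  simp only [wt]
  ring

end QAux

/-- for every `n ≥ 0`, `S_n = T_n`. -/
theorem S_eq_T (n : ℕ) : S n = T n := by
  rw [QAux.S_eq_s, QAux.T_eq_tau, QAux.s_eq_tau]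
end
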